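/- Let 0 < r ≤ R with B(0, r) ⊆ K ⊆ B(0, R), let 0 < ε < 1 and M ≥ 1, and let σ be a probability measure on K for which there exists a measurable set S ⊆ K with σ(S) ≤ ε/2 such that the restriction of σ to K∖S is absolutely continuous with respect to π_K with density at most M. Then for every integer m > 10^{10} · (n² R²/r²) · ln(M/ε), the total variation distance between σ^{(m)} (the distribution after m steps of the hit-and-run kernel started from σ) and π_K is less than ε. -/

import Mathlib

section
open MeasureTheory ProbabilityTheory
open scoped ENNReal Pointwise

namespace HR

/-- One-dimensional Brunn–Minkowski, compact case. -/
lemma bm1_compact {A B Z : Set ℝ} (hA : IsCompact A) (hB : IsCompact B)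
    (hA0 : A.Nonempty) (hB0 : B.Nonempty)
    (h : ∀ a ∈ A, ∀ b ∈ B, a + b ∈ Z) : volume A + volume B ≤ volume Z := by
  obtain ⟨a, haA, ha⟩ := hA.exists_isGreatest hA0
  obtain ⟨b, hbB, hb⟩ := hB.exists_isLeast hB0
  have h1 : volume A = volume ((fun x => x + b) '' A) := by
    simp
  have h2 : volume B = volume ((fun x => a + x) '' B) := by
    simp
  have hm : MeasurableSet ((fun x => a + x) '' B) :=
    (hB.image (by fun_prop)).measurableSet
  have hd : AEDisjoint volume ((fun x => x + b) '' A) ((fun x => a + x) '' B) := by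
    refine measure_mono_null (t := {a + b}) ?_ (by simp)
    rintro _ ⟨⟨x, hx, rfl⟩, ⟨y, hy, hxy⟩⟩
    have := ha hx
    have := hb hy
    simp only [Set.mem_singleton_iff] at *
    linarith
  rw [h1, h2, ← measure_union₀ hm.nullMeasurableSet hd]
  refine measure_mono ?_
  rintro _ (⟨x, hx, rfl⟩ | ⟨x, hx, rfl⟩)
  · exact h _ hx _ hbB
  · exact h _ haA _ hx

lemma bm1 {A B Z : Set ℝ} (hA : MeasurableSet A) (hB : MeasurableSet B)
    (hA0 : A.Nonempty) (hB0 : B.Nonempty)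
    (h : ∀ a ∈ A, ∀ b ∈ B, a + b ∈ Z) : volume A + volume B ≤ volume Z := by
  obtain ⟨a, ha⟩ := hA0
  obtain ⟨b, hb⟩ := hB0
  rw [hA.measure_eq_iSup_isCompact, hB.measure_eq_iSup_isCompact]
  simp only [iSup_and']
  have hne : ∃ K : Set ℝ, K ⊆ A ∧ IsCompact K := ⟨∅, by simp, isCompact_empty⟩
  have hne' : ∃ K : Set ℝ, K ⊆ B ∧ IsCompact K := ⟨∅, by simp, isCompact_empty⟩
  refine ENNReal.biSup_add_biSup_le' hne hne' ?_
  rintro K ⟨hKA, hK⟩ L ⟨hLB, hL⟩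
  calc volume K + volume L ≤ volume (insert a K) + volume (insert b L) := by
        gcongr <;> exact Set.subset_insert _ _
    _ ≤ volume Z := by
        refine bm1_compact (hK.insert a) (hL.insert b) (Set.insert_nonempty _ _)
          (Set.insert_nonempty _ _) ?_
        intro x hx y hy
        exact h _ (Set.insert_subset ha hKA hx) _ (Set.insert_subset hb hLB hy)

lemma pl1_norm {f g h : ℝ → ℝ≥0∞} (hf : Measurable f) (hg : Measurable g) (hh : Measurable h)
    (hf1 : ⨆ x, f x = 1) (hg1 : ⨆ x, g x = 1) {t : ℝ} (ht0 : 0 < t) (ht1 : t < 1)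
    (H : ∀ x y, f x ^ (1 - t) * g y ^ t ≤ h ((1 - t) * x + t * y)) :
    ENNReal.ofReal (1 - t) * (∫⁻ x, f x) + ENNReal.ofReal t * (∫⁻ x, g x) ≤ ∫⁻ x, h x := by
  have fle : ∀ x, f x ≤ 1 := fun x => hf1 ▸ le_iSup f x
  have gle : ∀ x, g x ≤ 1 := fun x => hg1 ▸ le_iSup g x
  have ftop : ∀ x, f x ≠ ⊤ := fun x => ((fle x).trans_lt ENNReal.one_lt_top).ne
  have gtop : ∀ x, g x ≠ ⊤ := fun x => ((gle x).trans_lt ENNReal.one_lt_top).ne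
  have e1 : ∫⁻ x, f x = ∫⁻ s in Set.Ioi (0:ℝ), volume {x | s < (f x).toReal} := by
    rw [← lintegral_eq_lintegral_meas_lt volume (by filter_upwards with x; simp)
      hf.ennreal_toReal.aemeasurable]
    refine lintegral_congr fun x => (ENNReal.ofReal_toReal (ftop x)).symm
  have e2 : ∫⁻ x, g x = ∫⁻ s in Set.Ioi (0:ℝ), volume {x | s < (g x).toReal} := by
    rw [← lintegral_eq_lintegral_meas_lt volume (by filter_upwards with x; simp)
      hg.ennreal_toReal.aemeasurable]
    refine lintegral_congr fun x => (ENNReal.ofReal_toReal (gtop x)).symm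
  have e3 : ∫⁻ s in Set.Ioi (0:ℝ), volume {x | s ≤ (min (h x) 1).toReal} ≤ ∫⁻ x, h x := by
    rw [← lintegral_eq_lintegral_meas_le volume (by filter_upwards with x; simp)
      (hh.min measurable_const).ennreal_toReal.aemeasurable]
    refine lintegral_mono fun x => ?_
    exact ENNReal.ofReal_toReal_le.trans (min_le_left _ _)
  refine le_trans ?_ e3
  have m1 : Measurable fun s : ℝ => volume {x | s < (f x).toReal} := by
    refine Antitone.measurable ?_
    intro a b hab
    exact measure_mono fun x hx => lt_of_le_of_lt hab hx
  have m2 : Measurable fun s : ℝ => volume {x | s < (g x).toReal} := by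
    refine Antitone.measurable ?_
    intro a b hab
    exact measure_mono fun x hx => lt_of_le_of_lt hab hx
  rw [e1, e2, ← lintegral_const_mul _ m1, ← lintegral_const_mul _ m2, ← lintegral_add_left
    (m1.const_mul _)]
  refine setLIntegral_mono' measurableSet_Ioi fun s hs => ?_
  simp only [Set.mem_Ioi] at hs
  by_cases hs1 : s < 1
  · have ex : ∀ k : ℝ → ℝ≥0∞, (⨆ x, k x = 1) → (∀ x, k x ≠ ⊤) → ∃ x, s < (k x).toReal := by
      intro k hk hkt
      have : ENNReal.ofReal s < ⨆ x, k x := by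
        rw [hk]; exact ENNReal.ofReal_lt_one.2 hs1
      obtain ⟨x, hx⟩ := lt_iSup_iff.1 this
      exact ⟨x, (ENNReal.ofReal_lt_iff_lt_toReal hs.le (hkt x)).1 hx⟩
    have mA : MeasurableSet {x | s < (f x).toReal} :=
      measurableSet_lt measurable_const hf.ennreal_toReal
    have mB : MeasurableSet {x | s < (g x).toReal} :=
      measurableSet_lt measurable_const hg.ennreal_toReal
    have v1 : ENNReal.ofReal (1 - t) * volume {x | s < (f x).toReal}
        = volume ((1 - t) • {x | s < (f x).toReal}) := by
      rw [Measure.addHaar_smul]; simp [abs_of_pos (sub_pos.2 ht1)]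
    have v2 : ENNReal.ofReal t * volume {x | s < (g x).toReal}
        = volume (t • {x | s < (g x).toReal}) := by
      rw [Measure.addHaar_smul]; simp [abs_of_pos ht0]
    rw [v1, v2]
    refine bm1 (mA.const_smul₀ _) (mB.const_smul₀ _) (Set.Nonempty.smul_set (ex f hf1 ftop))
      (Set.Nonempty.smul_set (ex g hg1 gtop)) ?_
    rintro _ ⟨x, hx, rfl⟩ _ ⟨y, hy, rfl⟩
    simp only [Set.mem_ofPred_eq, smul_eq_mul] at *
    have h1 : ENNReal.ofReal s ≤ h ((1 - t) * x + t * y) := by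
      refine le_trans ?_ (H x y)
      have a1 : ENNReal.ofReal s ≤ f x := ((ENNReal.ofReal_lt_iff_lt_toReal hs.le (ftop x)).2 hx).le
      have a2 : ENNReal.ofReal s ≤ g y := ((ENNReal.ofReal_lt_iff_lt_toReal hs.le (gtop y)).2 hy).le
      calc ENNReal.ofReal s = ENNReal.ofReal s ^ (1 - t) * ENNReal.ofReal s ^ t := by
            rw [← ENNReal.rpow_add_of_nonneg _ _ (sub_pos.2 ht1).le ht0.le]; simp
        _ ≤ _ := by
          gcongr
    rw [← ENNReal.ofReal_le_iff_le_toReal]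
    · exact le_min h1 (ENNReal.ofReal_lt_one.2 hs1).le
    · exact ((min_le_right _ _).trans_lt ENNReal.one_lt_top).ne
  · have z : ∀ k : ℝ → ℝ≥0∞, (∀ x, k x ≤ 1) → {x | s < (k x).toReal} = ∅ := by
      intro k hk
      ext x
      simp only [Set.mem_ofPred_eq, Set.mem_empty_iff_false, iff_false, not_lt]
      have := ENNReal.toReal_mono ENNReal.one_ne_top (hk x)
      simp at this
      linarith
    rw [z f fle, z g gle]; simp

lemma amgm {t : ℝ} (ht0 : 0 < t) (ht1 : t < 1) (a b : ℝ≥0∞) :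
    a ^ (1 - t) * b ^ t ≤ ENNReal.ofReal (1 - t) * a + ENNReal.ofReal t * b := by
  have h1 : 0 < 1 - t := sub_pos.2 ht1
  rcases eq_or_ne a ⊤ with rfl | ha
  · rw [ENNReal.mul_top (by simpa using ht1)]; simp
  rcases eq_or_ne b ⊤ with rfl | hb
  · rw [ENNReal.mul_top (by simpa using ht0)]; simp
  lift a to NNReal using ha
  lift b to NNReal using hb
  have := NNReal.geom_mean_le_arith_mean2_weighted (⟨1 - t, h1.le⟩) (⟨t, ht0.le⟩) a b
    (by apply NNReal.eq; exact sub_add_cancel 1 t)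
  rw [ENNReal.ofReal_eq_coe_nnreal h1.le, ENNReal.ofReal_eq_coe_nnreal ht0.le,
    ← ENNReal.coe_rpow_of_nonneg _ h1.le, ← ENNReal.coe_rpow_of_nonneg _ ht0.le]
  exact_mod_cast this

lemma pl1_bdd {f g h : ℝ → ℝ≥0∞} (hf : Measurable f) (hg : Measurable g) (hh : Measurable h)
    (hf1 : ⨆ x, f x ≠ ⊤) (hg1 : ⨆ x, g x ≠ ⊤) {t : ℝ} (ht0 : 0 < t) (ht1 : t < 1)
    (H : ∀ x y, f x ^ (1 - t) * g y ^ t ≤ h ((1 - t) * x + t * y)) :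
    (∫⁻ x, f x) ^ (1 - t) * (∫⁻ x, g x) ^ t ≤ ∫⁻ x, h x := by
  have h1t : 0 < 1 - t := sub_pos.2 ht1
  set a := ⨆ x, f x with ha
  set b := ⨆ x, g x with hb
  rcases eq_or_ne a 0 with ha0 | ha0
  · have : ∀ x, f x = 0 := fun x => le_antisymm (ha0 ▸ le_iSup f x) bot_le
    simp [this, ENNReal.zero_rpow_of_pos h1t]
  rcases eq_or_ne b 0 with hb0 | hb0
  · have : ∀ x, g x = 0 := fun x => le_antisymm (hb0 ▸ le_iSup g x) bot_le
    simp [this, ENNReal.zero_rpow_of_pos ht0]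
  set c := a ^ (1 - t) * b ^ t with hc
  have hc0 : c ≠ 0 := by
    refine mul_ne_zero ?_ ?_
    · simp [ENNReal.rpow_eq_zero_iff, ha0, hf1]
    · simp [ENNReal.rpow_eq_zero_iff, hb0, hg1]
  have hct : c ≠ ⊤ := ENNReal.mul_ne_top (ENNReal.rpow_ne_top_of_nonneg h1t.le hf1)
    (ENNReal.rpow_ne_top_of_nonneg ht0.le hg1)
  have key := pl1_norm (f := fun x => a⁻¹ * f x) (g := fun x => b⁻¹ * g x)
    (h := fun x => c⁻¹ * h x) (hf.const_mul _) (hg.const_mul _) (hh.const_mul _)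
    (by rw [← ENNReal.mul_iSup]; exact ENNReal.inv_mul_cancel ha0 hf1)
    (by rw [← ENNReal.mul_iSup]; exact ENNReal.inv_mul_cancel hb0 hg1) ht0 ht1 (by
      intro x y
      have : c⁻¹ = (a⁻¹) ^ (1 - t) * (b⁻¹) ^ t := by
        rw [hc, ENNReal.mul_inv, ENNReal.inv_rpow, ENNReal.inv_rpow]
        · right; exact ENNReal.rpow_ne_top_of_nonneg ht0.le hg1
        · left; exact ENNReal.rpow_ne_top_of_nonneg h1t.le hf1
      rw [ENNReal.mul_rpow_of_nonneg _ _ h1t.le, ENNReal.mul_rpow_of_nonneg _ _ ht0.le, this]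
      calc _ = (a⁻¹) ^ (1 - t) * (b⁻¹) ^ t * (f x ^ (1 - t) * g y ^ t) := by ring
        _ ≤ _ := by gcongr; exact H x y)
  rw [lintegral_const_mul _ hf, lintegral_const_mul _ hg, lintegral_const_mul _ hh] at key
  have k2 := (amgm ht0 ht1 _ _).trans key
  rw [ENNReal.mul_rpow_of_nonneg _ _ h1t.le, ENNReal.mul_rpow_of_nonneg _ _ ht0.le,
    ENNReal.inv_rpow, ENNReal.inv_rpow] at k2
  have : c⁻¹ = (a ^ (1 - t))⁻¹ * (b ^ t)⁻¹ := by
    rw [hc, ENNReal.mul_inv]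
    · right; exact ENNReal.rpow_ne_top_of_nonneg ht0.le hg1
    · left; exact ENNReal.rpow_ne_top_of_nonneg h1t.le hf1
  have k3 : c⁻¹ * ((∫⁻ x, f x) ^ (1 - t) * (∫⁻ x, g x) ^ t) ≤ c⁻¹ * ∫⁻ x, h x := by
    refine le_trans (le_of_eq ?_) k2
    rw [this]; ring
  exact (ENNReal.mul_le_mul_iff_right (ENNReal.inv_ne_zero.2 hct) (ENNReal.inv_ne_top.2 hc0)).1 k3

lemma pl1 {f g h : ℝ → ℝ≥0∞} (hf : Measurable f) (hg : Measurable g) (hh : Measurable h)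
    {t : ℝ} (ht0 : 0 < t) (ht1 : t < 1)
    (H : ∀ x y, f x ^ (1 - t) * g y ^ t ≤ h ((1 - t) * x + t * y)) :
    (∫⁻ x, f x) ^ (1 - t) * (∫⁻ x, g x) ^ t ≤ ∫⁻ x, h x := by
  have h1t : 0 < 1 - t := sub_pos.2 ht1
  have mono : ∀ k : ℝ → ℝ≥0∞, Measurable k →
      ∫⁻ x, k x = ⨆ n : ℕ, ∫⁻ x, min (k x) n := by
    intro k hk
    rw [← lintegral_iSup (fun n => hk.min measurable_const)]
    · refine lintegral_congr fun x => ?_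
      apply le_antisymm
      · refine le_of_forall_lt fun c hc => ?_
        obtain ⟨n, hn⟩ := ENNReal.exists_nat_gt hc.ne_top
        exact lt_iSup_iff.2 ⟨n, lt_min hc hn⟩
      · exact iSup_le fun n => min_le_left _ _
    · intro m n hmn x
      exact min_le_min_left _ (by exact_mod_cast hmn)
  have im : ∀ (s : ℝ), 0 < s → ∀ u : ℕ → ℝ≥0∞, (⨆ n, u n) ^ s = ⨆ n, u n ^ s := by
    intro s hs u
    exact (ENNReal.orderIsoRpow s hs).map_iSup u
  rw [mono f hf, mono g hg, im _ h1t, im _ ht0, ENNReal.iSup_mul]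
  refine iSup_le fun i => ?_
  rw [ENNReal.mul_iSup]
  refine iSup_le fun j => ?_
  have key : (∫⁻ x, min (f x) (max i j : ℕ)) ^ (1 - t) * (∫⁻ x, min (g x) (max i j : ℕ)) ^ t
      ≤ ∫⁻ x, h x := by
    refine pl1_bdd (hf.min measurable_const) (hg.min measurable_const) hh ?_ ?_ ht0 ht1 ?_
    · exact ((iSup_le fun x => min_le_right _ _).trans_lt (ENNReal.natCast_lt_top _)).ne
    · exact ((iSup_le fun x => min_le_right _ _).trans_lt (ENNReal.natCast_lt_top _)).ne
    · intro x y
      refine le_trans ?_ (H x y)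
      gcongr
      · exact min_le_left _ _
      · exact min_le_left _ _
  refine le_trans ?_ key
  gcongr
  · exact le_max_left _ _
  · exact le_max_right _ _

/-- Prékopa–Leindler on `Fin n → ℝ`. -/
lemma pl (n : ℕ) {t : ℝ} (ht0 : 0 < t) (ht1 : t < 1) :
    ∀ {f g h : (Fin n → ℝ) → ℝ≥0∞}, Measurable f → Measurable g → Measurable h →
    (∀ x y, f x ^ (1 - t) * g y ^ t ≤ h ((1 - t) • x + t • y)) →
    (∫⁻ x, f x) ^ (1 - t) * (∫⁻ x, g x) ^ t ≤ ∫⁻ x, h x := by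
  induction n with
  | zero =>
    intro f g h hf hg hh H
    have : ∀ k : (Fin 0 → ℝ) → ℝ≥0∞, ∫⁻ x, k x = k 0 := by
      intro k
      rw [lintegral_unique, volume_pi, Measure.pi_of_empty]
      simp only [Measure.dirac_apply_of_mem, Set.mem_univ, mul_one]
      exact congrArg k (Subsingleton.elim _ _)
    rw [this, this, this]
    simpa using H 0 0
  | succ n ih =>
    intro f g h hf hg hh H
    let e := MeasurableEquiv.piFinSuccAbove (fun _ : Fin (n + 1) => ℝ) 0
    have ev := (volume_preserving_piFinSuccAbove (fun _ : Fin (n + 1) => ℝ) 0).symm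
    have fub : ∀ k : (Fin (n + 1) → ℝ) → ℝ≥0∞, Measurable k →
        ∫⁻ x, k x = ∫⁻ a : ℝ, ∫⁻ y : Fin n → ℝ, k (e.symm (a, y)) := by
      intro k hk
      rw [← ev.lintegral_comp hk]
      exact lintegral_prod _ (hk.comp e.symm.measurable).aemeasurable
    have mm : ∀ k : (Fin (n + 1) → ℝ) → ℝ≥0∞, Measurable k →
        Measurable fun a : ℝ => ∫⁻ y : Fin n → ℝ, k (e.symm (a, y)) := by
      intro k hk
      exact (hk.comp e.symm.measurable).lintegral_prod_right'
    rw [fub f hf, fub g hg, fub h hh]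
    refine pl1 (mm f hf) (mm g hg) (mm h hh) ht0 ht1 ?_
    intro a b
    have sl : ∀ a : ℝ, Measurable fun y : Fin n → ℝ => e.symm (a, y) := fun a =>
      e.symm.measurable.comp (measurable_const.prodMk measurable_id)
    refine ih (hf.comp (sl _)) (hg.comp (sl _)) (hh.comp (sl _)) ?_
    intro x y
    refine (H _ _).trans (le_of_eq ?_)
    refine congrArg h ?_
    ext i
    refine Fin.cases ?_ (fun j => ?_) i
    · simp [e, MeasurableEquiv.piFinSuccAbove, Fin.insertNthEquiv]
    · simp [e, MeasurableEquiv.piFinSuccAbove, Fin.insertNthEquiv]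

/-- Multiplicative Brunn–Minkowski. -/
lemma bm {n : ℕ} {t : ℝ} (ht0 : 0 < t) (ht1 : t < 1) {A B C : Set (EuclideanSpace ℝ (Fin n))}
    (hA : MeasurableSet A) (hB : MeasurableSet B) (hC : MeasurableSet C)
    (H : ∀ x ∈ A, ∀ y ∈ B, (1 - t) • x + t • y ∈ C) :
    volume A ^ (1 - t) * volume B ^ t ≤ volume C := by
  have h1t : 0 < 1 - t := sub_pos.2 ht1
  have mp := EuclideanSpace.volume_preserving_symm_measurableEquiv_toLp (Fin n)
  let e := (MeasurableEquiv.toLp 2 (Fin n → ℝ))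
  have key : ∀ D : Set (EuclideanSpace ℝ (Fin n)), MeasurableSet D →
      volume D = ∫⁻ x : Fin n → ℝ, D.indicator 1 (e x) := by
    intro D hD
    rw [← lintegral_indicator_one hD, ← mp.symm.lintegral_comp (measurable_one.indicator hD)]
    rfl
  have ms : ∀ D : Set (EuclideanSpace ℝ (Fin n)), MeasurableSet D →
      Measurable fun x : Fin n → ℝ => D.indicator (1 : EuclideanSpace ℝ (Fin n) → ℝ≥0∞) (e x) := fun D hD =>
    (measurable_one.indicator hD).comp e.measurable
  rw [key A hA, key B hB, key C hC]
  refine pl n ht0 ht1 (ms A hA) (ms B hB) (ms C hC) ?_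
  intro x y
  by_cases hx : e x ∈ A
  · by_cases hy : e y ∈ B
    · have : e ((1 - t) • x + t • y) ∈ C := H _ hx _ hy
      simp [hx, hy, this]
    · simp [hy, ENNReal.zero_rpow_of_pos ht0]
  · simp [hx, ENNReal.zero_rpow_of_pos h1t]

end HR

end

section
open MeasureTheory ProbabilityTheory
open scoped ENNReal Pointwise

namespace HR

section cheeger
variable {α : Type*} [MeasurableSpace α]

lemma exists_median (μ : Measure α) [IsFiniteMeasure μ] {f : α → ℝ} (hf : Measurable f)
    {b : ℝ} (hb : ∀ x, |f x| ≤ b) :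
    ∃ c : ℝ, μ {x | c < f x} ≤ μ {x | c < f x}ᶜ ∧ μ {x | f x < c} ≤ μ {x | f x < c}ᶜ := by
  set T : Set ℝ := {c | μ {x | c < f x} ≤ μ {x | c < f x}ᶜ} with hT
  have mgt : ∀ c, MeasurableSet {x | c < f x} := fun c => measurableSet_lt measurable_const hf
  have mlt : ∀ c, MeasurableSet {x | f x < c} := fun c => measurableSet_lt hf measurable_const
  have half : ∀ A : Set α, MeasurableSet A → (μ A ≤ μ Aᶜ ↔ μ A ≤ μ Set.univ / 2) := by
    intro A hA
    have h := measure_add_measure_compl (μ := μ) hA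
    rw [ENNReal.le_div_iff_mul_le (by simp) (by simp), mul_two, ← h]
    exact (ENNReal.add_le_add_iff_left (measure_ne_top μ A)).symm
  rcases eq_or_ne (μ Set.univ) 0 with h0 | h0
  · refine ⟨0, ?_, ?_⟩
    · rw [measure_mono_null (Set.subset_univ _) h0]; exact bot_le
    · rw [measure_mono_null (Set.subset_univ _) h0]; exact bot_le
  have hTne : b ∈ T := by
    have : {x | b < f x} = ∅ := by
      ext x; simp; exact (abs_le.1 (hb x)).2
    simp [hT, this]
  have hTbdd : BddBelow T := by
    refine ⟨-b - 1, fun c hc => ?_⟩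
    by_contra! hlt
    have : {x | c < f x} = Set.univ := by
      ext x; simp; have := (abs_le.1 (hb x)).1; linarith
    rw [hT, Set.mem_ofPred_eq, this] at hc
    simp at hc
    exact h0 (by simp [hc])
  set c := sInf T
  refine ⟨c, ?_, ?_⟩
  · rw [half _ (mgt c)]
    have : {x | c < f x} = ⋃ n : ℕ, {x | c + 1 / (n + 1 : ℝ) < f x} := by
      ext x
      simp only [Set.mem_ofPred_eq, Set.mem_iUnion]
      constructor
      · intro h
        obtain ⟨n, hn⟩ := exists_nat_one_div_lt (sub_pos.2 h)
        exact ⟨n, by linarith⟩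
      · rintro ⟨n, hn⟩
        have : (0:ℝ) < 1 / (n + 1 : ℝ) := Nat.one_div_pos_of_nat
        linarith
    rw [this, Monotone.measure_iUnion]
    · refine iSup_le fun n => ?_
      have hp : (0:ℝ) < 1 / (n + 1 : ℝ) := Nat.one_div_pos_of_nat
      obtain ⟨d, hd, hdc⟩ := exists_lt_of_csInf_lt ⟨b, hTne⟩ (show sInf T < c + 1 / (n+1:ℝ) by
        simpa [c] using hp)
      refine le_trans (measure_mono ?_) ((half _ (mgt d)).1 hd)
      intro x hx
      exact lt_trans hdc hx
    · intro m n hmn x hx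
      refine lt_of_le_of_lt ?_ (show c + 1 / (m + 1 : ℝ) < f x from hx)
      gcongr
  · rw [half _ (mlt c)]
    have : {x | f x < c} = ⋃ n : ℕ, {x | f x < c - 1 / (n + 1 : ℝ)} := by
      ext x
      simp only [Set.mem_ofPred_eq, Set.mem_iUnion]
      constructor
      · intro h
        obtain ⟨n, hn⟩ := exists_nat_one_div_lt (sub_pos.2 h)
        exact ⟨n, by linarith⟩
      · rintro ⟨n, hn⟩
        have : (0:ℝ) < 1 / (n + 1 : ℝ) := Nat.one_div_pos_of_nat
        linarith
    rw [this, Monotone.measure_iUnion]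
    · refine iSup_le fun n => ?_
      have hp : (0:ℝ) < 1 / (n + 1 : ℝ) := Nat.one_div_pos_of_nat
      have hd : c - 1 / (n+1:ℝ) ∉ T := by
        intro h
        have := csInf_le hTbdd h
        change c ≤ _ at this
        linarith
      rw [hT, Set.mem_ofPred_eq, not_le] at hd
      rw [← half _ (mlt _)]
      refine le_trans (measure_mono ?_) (hd.le.trans (measure_mono ?_))
      · intro x hx; simp only [Set.mem_ofPred_eq, Set.mem_compl_iff, not_lt] at *; exact hx.le
      · intro x hx; simp only [Set.mem_ofPred_eq, Set.mem_compl_iff, not_lt] at *; exact hx.le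
    · intro m n hmn x hx
      refine lt_of_lt_of_le (show f x < c - 1 / (m + 1 : ℝ) from hx) ?_
      gcongr

lemma vol_interval (a b : ℝ) (hb : 0 ≤ b) :
    ∫⁻ s in Set.Ioi (0:ℝ), (if b ≤ s ∧ s < a then (1 : ℝ≥0∞) else 0) = ENNReal.ofReal (a - b) := by
  have : (fun s : ℝ => if b ≤ s ∧ s < a then (1 : ℝ≥0∞) else 0) = (Set.Ico b a).indicator 1 := by
    ext s; simp [Set.indicator_apply]
  rw [this, lintegral_indicator_one measurableSet_Ico, Measure.restrict_apply measurableSet_Ico,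
    ← Real.volume_Ico]
  apply measure_congr
  have h0 : volume ({0} : Set ℝ) = 0 := by simp
  have : (Set.Ico b a ∩ Set.Ioi 0 : Set ℝ) =ᵐ[volume] (Set.Ico b a ∩ Set.Ici 0 : Set ℝ) :=
    Filter.EventuallyEq.inter (Filter.EventuallyEq.refl _ _) Ioi_ae_eq_Ici
  have e2 : (Set.Ico b a ∩ Set.Ici 0 : Set ℝ) = Set.Ico b a := by
    ext s
    simp only [Set.mem_inter_iff, Set.mem_Ico, Set.mem_Ici]
    exact ⟨fun h => h.1, fun h => ⟨h, hb.trans h.1⟩⟩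
  rwa [e2] at this

lemma cheeger_pos (μ : Measure α) [IsFiniteMeasure μ] {k : α → α → ℝ≥0∞}
    (hk : Measurable (Function.uncurry k)) (hsym : ∀ x y, k x y = k y x) {C Φ : ℝ}
    (hC : 0 < C) (hΦ : 0 < Φ) (hkC : ∀ x, ∫⁻ y, k x y ∂μ ≤ ENNReal.ofReal C)
    (hcond : ∀ A, MeasurableSet A → μ A ≤ μ Aᶜ →
      ENNReal.ofReal Φ * μ A ≤ ∫⁻ x in A, ∫⁻ y in Aᶜ, k x y ∂μ ∂μ)
    {g : α → ℝ} (hg : Measurable g) (hg0 : ∀ x, 0 ≤ g x) {b : ℝ} (hb : ∀ x, g x ≤ b)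
    (hmed : μ {x | 0 < g x} ≤ μ {x | 0 < g x}ᶜ) :
    ENNReal.ofReal (Φ ^ 2) * ∫⁻ x, ENNReal.ofReal (g x ^ 2) ∂μ ≤
      ENNReal.ofReal C * ∫⁻ x, ∫⁻ y, k x y * ENNReal.ofReal ((g x - g y) ^ 2) ∂μ ∂μ := by
  have mg2 : Measurable fun x => g x ^ 2 := hg.pow_const 2
  set I := ∫⁻ x, ENNReal.ofReal (g x ^ 2) ∂μ with hI
  have hIfin : I ≠ ⊤ := by
    have : I ≤ ∫⁻ x, ENNReal.ofReal (b ^ 2) ∂μ := lintegral_mono fun x =>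
      ENNReal.ofReal_le_ofReal (pow_le_pow_left₀ (hg0 x) (hb x) 2)
    refine (this.trans_lt ?_).ne
    rw [lintegral_const]
    exact ENNReal.mul_lt_top ENNReal.ofReal_lt_top (measure_lt_top _ _)
  have hlc : I = ∫⁻ s in Set.Ioi (0:ℝ), μ {x | s < g x ^ 2} :=
    lintegral_eq_lintegral_meas_lt μ (by filter_upwards with x; positivity) mg2.aemeasurable
  have mA : ∀ s : ℝ, MeasurableSet {x | s < g x ^ 2} := fun s =>
    measurableSet_lt measurable_const mg2
  -- step 1
  have s1 : ENNReal.ofReal Φ * I ≤ ∫⁻ x, ∫⁻ y, k x y * ENNReal.ofReal (g x ^ 2 - g y ^ 2) ∂μ ∂μ := by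
    have m1 : Measurable fun s : ℝ => μ {x | s < g x ^ 2} := by
      refine Antitone.measurable ?_
      intro a b hab
      exact measure_mono fun x hx => lt_of_le_of_lt hab hx
    have mF : Measurable fun p : (ℝ × α) × α =>
        k p.1.2 p.2 * (if g p.2 ^ 2 ≤ p.1.1 ∧ p.1.1 < g p.1.2 ^ 2 then (1 : ℝ≥0∞) else 0) := by
      refine Measurable.mul (hk.comp (by fun_prop : Measurable fun p : (ℝ × α) × α => (p.1.2, p.2))) ?_
      refine Measurable.ite ?_ measurable_const measurable_const
      refine MeasurableSet.inter ?_ ?_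
      · exact measurableSet_le (f := fun p : (ℝ × α) × α => g p.2 ^ 2) (by fun_prop)
          (g := fun p => p.1.1) (by fun_prop)
      · exact measurableSet_lt (f := fun p : (ℝ × α) × α => p.1.1) (by fun_prop)
          (g := fun p => g p.1.2 ^ 2) (by fun_prop)
    calc ENNReal.ofReal Φ * I = ∫⁻ s in Set.Ioi (0:ℝ), ENNReal.ofReal Φ * μ {x | s < g x ^ 2} := by
          rw [hlc, lintegral_const_mul _ m1]
      _ ≤ ∫⁻ s in Set.Ioi (0:ℝ), ∫⁻ x, ∫⁻ y, k x y *
            (if g y ^ 2 ≤ s ∧ s < g x ^ 2 then (1 : ℝ≥0∞) else 0) ∂μ ∂μ := by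
          refine setLIntegral_mono' measurableSet_Ioi fun s hs => ?_
          have hs0 : 0 < s := hs
          refine (hcond _ (mA s) ?_).trans ?_
          · have sub : {x | s < g x ^ 2} ⊆ {x | 0 < g x} := by
              intro x hx
              rcases (hg0 x).eq_or_lt with h | h
              · simp [← h] at hx; linarith
              · exact h
            refine (measure_mono sub).trans (hmed.trans (measure_mono ?_))
            exact Set.compl_subset_compl.2 sub
          · rw [← lintegral_indicator (mA s)]
            refine lintegral_mono fun x => ?_
            by_cases hx : s < g x ^ 2
            · rw [Set.indicator_of_mem (by exact hx), ← lintegral_indicator (mA s).compl]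
              refine lintegral_mono fun y => ?_
              by_cases hy : s < g y ^ 2
              · rw [Set.indicator_of_notMem (by simpa using hy)]; exact bot_le
              · rw [Set.indicator_of_mem (by simpa using hy), if_pos ⟨not_lt.1 hy, hx⟩, mul_one]
            · rw [Set.indicator_of_notMem (by exact hx)]; exact bot_le
      _ = ∫⁻ x, ∫⁻ s in Set.Ioi (0:ℝ), ∫⁻ y, k x y *
            (if g y ^ 2 ≤ s ∧ s < g x ^ 2 then (1 : ℝ≥0∞) else 0) ∂μ ∂volume ∂μ := by
          refine lintegral_lintegral_swap ?_
          exact (Measurable.lintegral_prod_right' mF).aemeasurable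
      _ = ∫⁻ x, ∫⁻ y, ∫⁻ s in Set.Ioi (0:ℝ), k x y *
            (if g y ^ 2 ≤ s ∧ s < g x ^ 2 then (1 : ℝ≥0∞) else 0) ∂volume ∂μ ∂μ := by
          refine lintegral_congr fun x => ?_
          refine lintegral_lintegral_swap ?_
          exact (mF.comp (by fun_prop : Measurable fun p : ℝ × α => ((p.1, x), p.2))).aemeasurable
      _ = _ := by
          refine lintegral_congr fun x => lintegral_congr fun y => ?_
          rw [lintegral_const_mul]
          · rw [vol_interval _ _ (sq_nonneg _)]
          · refine Measurable.ite ?_ measurable_const measurable_const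
            refine MeasurableSet.inter ?_ ?_
            · exact measurableSet_le measurable_const measurable_id
            · exact measurableSet_lt measurable_id measurable_const
  -- measurability helper
  have mK : ∀ F : α → α → ℝ, Measurable (Function.uncurry F) →
      Measurable (fun p : α × α => k p.1 p.2 * ENNReal.ofReal (F p.1 p.2)) := fun F hF =>
    hk.mul hF.ennreal_ofReal
  have m2 : Measurable (Function.uncurry fun x y => g x ^ 2 - g y ^ 2) := by
    unfold Function.uncurry; fun_prop
  have m3 : Measurable (Function.uncurry fun x y => g y ^ 2 - g x ^ 2) := by
    unfold Function.uncurry; fun_prop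
  have s1' : ENNReal.ofReal Φ * I ≤
      ∫⁻ x, ∫⁻ y, k x y * ENNReal.ofReal (g y ^ 2 - g x ^ 2) ∂μ ∂μ := by
    refine s1.trans (le_of_eq ?_)
    rw [lintegral_lintegral_swap (mK _ m2).aemeasurable]
    refine lintegral_congr fun x => lintegral_congr fun y => ?_
    rw [hsym]
  set E := ∫⁻ x, ∫⁻ y, k x y * ENNReal.ofReal ((g x - g y) ^ 2) ∂μ ∂μ with hE
  have a1 : ∫⁻ x, ∫⁻ y, k x y * ENNReal.ofReal (g x ^ 2) ∂μ ∂μ ≤ ENNReal.ofReal C * I := by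
    rw [hI, ← lintegral_const_mul _ mg2.ennreal_ofReal]
    refine lintegral_mono fun x => ?_
    have : Measurable (k x) := hk.comp (measurable_prodMk_left)
    rw [lintegral_mul_const _ this]
    gcongr
    exact hkC x
  have m4 : Measurable (Function.uncurry fun x y => g x ^ 2 : α × α → ℝ) := by
    unfold Function.uncurry; fun_prop
  have m4' : Measurable (Function.uncurry fun x y => g y ^ 2 : α × α → ℝ) := by
    unfold Function.uncurry; fun_prop
  have a2 : ∫⁻ x, ∫⁻ y, k x y * ENNReal.ofReal (g y ^ 2) ∂μ ∂μ ≤ ENNReal.ofReal C * I := by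
    refine le_trans (le_of_eq ?_) a1
    rw [lintegral_lintegral_swap (mK _ m4').aemeasurable]
    refine lintegral_congr fun x => lintegral_congr fun y => ?_
    rw [hsym]
  have m5 : Measurable (Function.uncurry fun x y => (g x - g y) ^ 2 : α × α → ℝ) := by
    unfold Function.uncurry; fun_prop
  -- step 2
  have s2 : ENNReal.ofReal Φ * I + ENNReal.ofReal Φ * I ≤
      ENNReal.ofReal (C / Φ) * E + ENNReal.ofReal (Φ / (2 * C)) *
        (ENNReal.ofReal C * I + ENNReal.ofReal C * I) := by
    refine (add_le_add s1 s1').trans ?_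
    have a12 := add_le_add a1 a2
    have dbl : ∀ F : α → α → ℝ, Measurable (Function.uncurry F) →
        ∫⁻ x, ∫⁻ y, k x y * ENNReal.ofReal (F x y) ∂μ ∂μ
        = ∫⁻ p, k p.1 p.2 * ENNReal.ofReal (F p.1 p.2) ∂(μ.prod μ) := fun F hF =>
      (lintegral_prod _ (mK F hF).aemeasurable).symm
    rw [dbl _ m4, dbl _ m4', ← lintegral_add_left (mK _ m4)] at a12
    rw [dbl _ m2, dbl _ m3, hE, dbl _ m5, ← lintegral_add_left (mK _ m2)]
    refine le_trans ?_ (add_le_add le_rfl (mul_le_mul_right a12 _))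
    rw [← lintegral_const_mul _ (mK _ m5), ← lintegral_const_mul _ (show Measurable fun p : α × α => k p.1 p.2 * ENNReal.ofReal (g p.1 ^ 2)
        + k p.1 p.2 * ENNReal.ofReal (g p.2 ^ 2) from (mK _ m4).add (mK _ m4')),
      ← lintegral_add_left ((mK _ m5).const_mul _)]
    refine lintegral_mono fun p => ?_
    obtain ⟨x, y⟩ := p
    dsimp only
    have real_ineq : max (g x ^ 2 - g y ^ 2) 0 + max (g y ^ 2 - g x ^ 2) 0
        ≤ C / Φ * (g x - g y) ^ 2 + Φ / (2 * C) * (g x ^ 2 + g y ^ 2) := by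
      have habs : max (g x ^ 2 - g y ^ 2) 0 + max (g y ^ 2 - g x ^ 2) 0
          = |(g x - g y) * (g x + g y)| := by
        have : (g x - g y) * (g x + g y) = g x ^ 2 - g y ^ 2 := by ring
        rw [this]
        rcases le_total (g x ^ 2) (g y ^ 2) with h | h
        · rw [max_eq_right (by linarith), max_eq_left (by linarith), abs_of_nonpos (by linarith)]
          ring
        · rw [max_eq_left (by linarith), max_eq_right (by linarith), abs_of_nonneg (by linarith)]
          ring
      rw [habs, abs_mul]
      have hθ : 0 < Φ / (4 * C) := by positivity
      have e1 : C / Φ = 1 / (4 * (Φ / (4 * C))) := by field_simp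
      have e2 : Φ / (2 * C) = 2 * (Φ / (4 * C)) := by field_simp; norm_num
      rw [e1, e2]
      set θ := Φ / (4 * C)
      have q1 : |g x - g y| * |g x + g y| ≤ 1 / (4 * θ) * (g x - g y) ^ 2 + θ * (g x + g y) ^ 2 := by
        rw [← sq_abs (g x - g y), ← sq_abs (g x + g y)]
        have : 1 / (4 * θ) * |g x - g y| ^ 2 + θ * |g x + g y| ^ 2 - |g x - g y| * |g x + g y|
            = 1 / (4 * θ) * (|g x - g y| - 2 * θ * |g x + g y|) ^ 2 := by
          field_simp; ring
        have h2 : 0 ≤ 1 / (4 * θ) * (|g x - g y| - 2 * θ * |g x + g y|) ^ 2 := by positivity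
        linarith
      nlinarith [mul_nonneg hθ.le (sq_nonneg (g x - g y))]
    have := ENNReal.ofReal_le_ofReal real_ineq
    rw [ENNReal.ofReal_add (le_max_right _ _) (le_max_right _ _), ENNReal.ofReal_add (by positivity)
      (by positivity), ENNReal.ofReal_mul (by positivity), ENNReal.ofReal_mul (by positivity),
      ENNReal.ofReal_add (by positivity) (by positivity)] at this
    have mx : ∀ z : ℝ, ENNReal.ofReal (max z 0) = ENNReal.ofReal z := fun z => by
      simp [ENNReal.ofReal_max]
    rw [mx, mx] at this
    calc _ = k x y * (ENNReal.ofReal (g x ^ 2 - g y ^ 2) + ENNReal.ofReal (g y ^ 2 - g x ^ 2)) := by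
          ring
      _ ≤ k x y * _ := mul_le_mul_right this _
      _ = _ := by ring
  have s3 : ENNReal.ofReal (Φ / (2 * C)) * (ENNReal.ofReal C * I + ENNReal.ofReal C * I)
      = ENNReal.ofReal Φ * I := by
    rw [← mul_add, ← two_mul, ← mul_assoc, ← mul_assoc]
    congr 1
    rw [← ENNReal.ofReal_mul (by positivity), show (2 : ℝ≥0∞) = ENNReal.ofReal 2 by simp,
      ← ENNReal.ofReal_mul (by positivity)]
    congr 1
    field_simp
  rw [s3] at s2
  have s4 : ENNReal.ofReal Φ * I ≤ ENNReal.ofReal (C / Φ) * E :=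
    (ENNReal.add_le_add_iff_right (ENNReal.mul_ne_top ENNReal.ofReal_ne_top hIfin)).1 s2
  calc ENNReal.ofReal (Φ ^ 2) * I = ENNReal.ofReal Φ * (ENNReal.ofReal Φ * I) := by
        rw [pow_two, ENNReal.ofReal_mul hΦ.le, mul_assoc]
    _ ≤ ENNReal.ofReal Φ * (ENNReal.ofReal (C / Φ) * E) := mul_le_mul_right s4 _
    _ = _ := by
      rw [← mul_assoc, ← ENNReal.ofReal_mul hΦ.le]
      congr 2
      field_simp

lemma max_ineq (a b c : ℝ) : (max (a - c) 0 - max (b - c) 0) ^ 2 +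
    (max (c - a) 0 - max (c - b) 0) ^ 2 ≤ (a - b) ^ 2 := by
  have key : ∀ u v : ℝ, (max u 0 - max v 0) ^ 2 + (max (-u) 0 - max (-v) 0) ^ 2 ≤ (u - v) ^ 2 := by
    intro u v
    rcases le_total u 0 with h | h <;> rcases le_total v 0 with h' | h'
    · rw [max_eq_right h, max_eq_right h', max_eq_left (neg_nonneg.2 h),
        max_eq_left (neg_nonneg.2 h')]
      exact le_of_eq (by ring)
    · rw [max_eq_right h, max_eq_left h', max_eq_left (neg_nonneg.2 h),
        max_eq_right (neg_nonpos.2 h')]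
      nlinarith [mul_nonneg (neg_nonneg.2 h) h']
    · rw [max_eq_left h, max_eq_right h', max_eq_right (neg_nonpos.2 h),
        max_eq_left (neg_nonneg.2 h')]
      nlinarith [mul_nonneg h (neg_nonneg.2 h')]
    · rw [max_eq_left h, max_eq_left h', max_eq_right (neg_nonpos.2 h),
        max_eq_right (neg_nonpos.2 h')]
      exact le_of_eq (by ring)
  have := key (a - c) (b - c)
  rw [neg_sub, neg_sub] at this
  calc _ ≤ _ := this
    _ = _ := by ring

lemma cheeger (μ : Measure α) [IsFiniteMeasure μ] {k : α → α → ℝ≥0∞}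
    (hk : Measurable (Function.uncurry k)) (hsym : ∀ x y, k x y = k y x) {C Φ : ℝ}
    (hC : 0 < C) (hΦ : 0 < Φ) (hkC : ∀ x, ∫⁻ y, k x y ∂μ ≤ ENNReal.ofReal C)
    (hcond : ∀ A, MeasurableSet A → μ A ≤ μ Aᶜ →
      ENNReal.ofReal Φ * μ A ≤ ∫⁻ x in A, ∫⁻ y in Aᶜ, k x y ∂μ ∂μ)
    {f : α → ℝ} (hf : Measurable f) {b : ℝ} (hb : ∀ x, |f x| ≤ b) :
    ∃ c : ℝ, ENNReal.ofReal (Φ ^ 2) * ∫⁻ x, ENNReal.ofReal ((f x - c) ^ 2) ∂μ ≤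
      ENNReal.ofReal C * ∫⁻ x, ∫⁻ y, k x y * ENNReal.ofReal ((f x - f y) ^ 2) ∂μ ∂μ := by
  obtain ⟨c, hc1, hc2⟩ := exists_median μ hf hb
  refine ⟨c, ?_⟩
  have mp : Measurable fun x => max (f x - c) 0 := by fun_prop
  have mm : Measurable fun x => max (c - f x) 0 := by fun_prop
  have e1 : {x | 0 < max (f x - c) 0} = {x | c < f x} := by ext x; simp
  have e2 : {x | 0 < max (c - f x) 0} = {x | f x < c} := by ext x; simp
  have h1 := cheeger_pos μ hk hsym hC hΦ hkC hcond mp (fun x => le_max_right _ _) (b := b + |c|)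
    (fun x => max_le (by have := (abs_le.1 (hb x)).2; have := neg_abs_le c; linarith)
      (by have := (abs_nonneg _).trans (hb x); positivity)) (by rw [e1]; exact hc1)
  have h2 := cheeger_pos μ hk hsym hC hΦ hkC hcond mm (fun x => le_max_right _ _) (b := b + |c|)
    (fun x => max_le (by have := (abs_le.1 (hb x)).1; have := le_abs_self c; linarith)
      (by have := (abs_nonneg _).trans (hb x); positivity)) (by rw [e2]; exact hc2)
  have m5 : ∀ g : α → ℝ, Measurable g →
      Measurable (fun p : α × α => k p.1 p.2 * ENNReal.ofReal ((g p.1 - g p.2) ^ 2)) := fun g hg =>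
    hk.mul (by fun_prop : Measurable fun p : α × α => (g p.1 - g p.2) ^ 2).ennreal_ofReal
  have h3 := add_le_add h1 h2
  rw [← mul_add, ← mul_add, ← lintegral_add_left (mp.pow_const 2).ennreal_ofReal,
    ← lintegral_add_left (Measurable.lintegral_prod_right' (m5 _ mp))] at h3
  calc _ = ENNReal.ofReal (Φ ^ 2) * ∫⁻ x, ENNReal.ofReal (max (f x - c) 0 ^ 2) +
        ENNReal.ofReal (max (c - f x) 0 ^ 2) ∂μ := by
        congr 1
        refine lintegral_congr fun x => ?_
        rw [← ENNReal.ofReal_add (by positivity) (by positivity)]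
        congr 1
        rcases le_total (f x) c with h | h
        · rw [max_eq_right (by linarith), max_eq_left (by linarith)]; ring
        · rw [max_eq_left (by linarith), max_eq_right (by linarith)]; ring
    _ ≤ _ := h3
    _ ≤ _ := by
        refine mul_le_mul_right (lintegral_mono fun x => ?_) _
        refine (lintegral_add_left ((m5 _ mp).comp (measurable_prodMk_left (x := x))) _).symm.trans_le ?_
        refine lintegral_mono fun y => ?_
        simp only [Function.comp]
        rw [← mul_add, ← ENNReal.ofReal_add (by positivity) (by positivity)]
        gcongr
        exact max_ineq _ _ _

end cheeger
end HR

end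

section
open MeasureTheory ProbabilityTheory
open scoped ENNReal Pointwise

namespace HR

abbrev EE (n : ℕ) := EuclideanSpace ℝ (Fin n)

lemma exists_rot {n : ℕ} {v w : EE n} (h : ‖v‖ = ‖w‖) : ∃ f : EE n ≃ₗᵢ[ℝ] EE n, f v = w :=
  ⟨(ℝ ∙ (v - w))ᗮ.reflection, Submodule.reflection_sub h⟩

lemma iso_sq {n : ℕ} {W : Set (EE n)} (hW : MeasurableSet W)
    (hinv : ∀ f : EE n ≃ₗᵢ[ℝ] EE n, f ⁻¹' W = W) {b : ℝ} (hb : ∀ w ∈ W, ‖w‖ ≤ b) (e : EE n) :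
    (n : ℝ≥0∞) * ∫⁻ w in W, ENNReal.ofReal (inner ℝ e w ^ 2) ≤
      ENNReal.ofReal (‖e‖ ^ 2 * b ^ 2) * volume W := by
  have hJ : ∀ e e' : EE n, ‖e‖ = ‖e'‖ → ∫⁻ w in W, ENNReal.ofReal (inner ℝ e w ^ 2)
      = ∫⁻ w in W, ENNReal.ofReal (inner ℝ e' w ^ 2) := by
    intro e e' h
    obtain ⟨f, hf⟩ := exists_rot h
    rw [← (f.measurePreserving).setLIntegral_comp_preimage hW (f := fun w =>
      ENNReal.ofReal (inner ℝ e' w ^ 2)) (by fun_prop), hinv]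
    refine lintegral_congr fun w => ?_
    rw [← hf, f.inner_map_map]
  have h1 : (n : ℝ≥0∞) * ∫⁻ w in W, ENNReal.ofReal (inner ℝ e w ^ 2)
      = ∑ i : Fin n, ∫⁻ w in W, ENNReal.ofReal
          (inner ℝ (EuclideanSpace.single i ‖e‖ : EE n) w ^ 2) := by
    rw [Finset.sum_congr rfl (fun i _ => hJ (EuclideanSpace.single i ‖e‖) e (by simp))]
    simp
  rw [h1, ← lintegral_finsetSum _ (fun i _ => by fun_prop)]
  calc _ ≤ ∫⁻ w in W, ENNReal.ofReal (‖e‖ ^ 2 * b ^ 2) := by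
        refine setLIntegral_mono' hW fun w hw => ?_
        rw [← ENNReal.ofReal_sum_of_nonneg (fun i _ => sq_nonneg _)]
        refine ENNReal.ofReal_le_ofReal ?_
        simp only [EuclideanSpace.inner_single_left, mul_pow, ← Finset.mul_sum]
        rw [← EuclideanSpace.real_norm_sq_eq]
        simp only [conj_trivial]
        have := hb w hw
        gcongr
    _ = _ := by simp

lemma iso_pos {n : ℕ} (hn : 0 < n) {W : Set (EE n)} (hW : MeasurableSet W)
    (hinv : ∀ f : EE n ≃ₗᵢ[ℝ] EE n, f ⁻¹' W = W) {b : ℝ} (hb0 : 0 < b) (hb : ∀ w ∈ W, ‖w‖ ≤ b)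
    (e : EE n) :
    ∫⁻ w in W, ENNReal.ofReal (inner ℝ e w) ≤
      ENNReal.ofReal (‖e‖ * b / (2 * √n)) * volume W := by
  have hn' : (0:ℝ) < n := by exact_mod_cast hn
  have hN : 0 < √(n:ℝ) := Real.sqrt_pos.2 hn'
  rcases eq_or_ne e 0 with rfl | he
  · simp
  have he' : 0 < ‖e‖ := norm_pos_iff.2 he
  set I := ∫⁻ w in W, ENNReal.ofReal (inner ℝ e w) with hI
  have hneg : I = ∫⁻ w in W, ENNReal.ofReal (-inner ℝ e w) := by
    rw [hI, ← ((LinearIsometryEquiv.neg ℝ (E := EE n)).measurePreserving).setLIntegral_comp_preimage hW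
      (f := fun w => ENNReal.ofReal (inner ℝ e w)) (by fun_prop), hinv]
    refine lintegral_congr fun w => ?_
    simp [inner_neg_right]
  set l := ‖e‖ * b / √n with hl
  have hl0 : 0 < l := by positivity
  have h2 : I + I ≤ ENNReal.ofReal l * volume W := by
    calc I + I = ∫⁻ w in W, ENNReal.ofReal (inner ℝ e w) + ENNReal.ofReal (-inner ℝ e w) := by
          rw [lintegral_add_left (by fun_prop), ← hneg]
      _ ≤ ∫⁻ w in W, ENNReal.ofReal (1 / (2 * l)) * ENNReal.ofReal (inner ℝ e w ^ 2)
            + ENNReal.ofReal (l / 2) := by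
          refine lintegral_mono fun w => ?_
          dsimp only
          set x := inner ℝ e w
          have key : |x| ≤ 1 / (2 * l) * x ^ 2 + l / 2 := by
            have : 1 / (2 * l) * x ^ 2 + l / 2 - |x| = 1 / (2 * l) * (|x| - l) ^ 2 := by
              rw [← sq_abs x]; field_simp; ring
            have h2 : 0 ≤ 1 / (2 * l) * (|x| - l) ^ 2 := by positivity
            linarith
          have key2 := ENNReal.ofReal_le_ofReal key
          rw [ENNReal.ofReal_add (by positivity) (by positivity), ENNReal.ofReal_mul (by positivity)] at key2
          refine le_trans ?_ key2
          rcases le_total x 0 with h | h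
          · rw [ENNReal.ofReal_of_nonpos h, abs_of_nonpos h, zero_add]
          · rw [ENNReal.ofReal_of_nonpos (p := -x) (by linarith), abs_of_nonneg h, add_zero]
      _ = ENNReal.ofReal (1 / (2 * l)) * (∫⁻ w in W, ENNReal.ofReal (inner ℝ e w ^ 2))
            + ENNReal.ofReal (l / 2) * volume W := by
          rw [lintegral_add_right _ measurable_const, lintegral_const_mul _ (by fun_prop)]
          simp
      _ ≤ ENNReal.ofReal (l / 2) * volume W + ENNReal.ofReal (l / 2) * volume W := by
          refine add_le_add ?_ le_rfl
          have := iso_sq hW hinv hb e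
          have h3 : ∫⁻ w in W, ENNReal.ofReal (inner ℝ e w ^ 2) ≤ ENNReal.ofReal (l ^ 2) * volume W := by
            have e1 : ENNReal.ofReal (‖e‖ ^ 2 * b ^ 2) = n * ENNReal.ofReal (l ^ 2) := by
              rw [← ENNReal.ofReal_natCast, ← ENNReal.ofReal_mul hn'.le, hl, div_pow,
                Real.sq_sqrt hn'.le]
              congr 1; field_simp
            rw [e1, mul_assoc] at this
            exact (ENNReal.mul_le_mul_iff_right (by exact_mod_cast hn.ne') (by simp)).1 this
          calc _ ≤ ENNReal.ofReal (1 / (2 * l)) * (ENNReal.ofReal (l ^ 2) * volume W) :=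
                mul_le_mul_right h3 _
            _ = _ := by
              rw [← mul_assoc, ← ENNReal.ofReal_mul (by positivity)]
              congr 2; field_simp
      _ = _ := by
          rw [← add_mul, ← ENNReal.ofReal_add (by positivity) (by positivity)]; congr 2; ring
  have h3 : ENNReal.ofReal l * volume W =
      ENNReal.ofReal (‖e‖ * b / (2 * √n)) * volume W + ENNReal.ofReal (‖e‖ * b / (2 * √n)) * volume W := by
    rw [← add_mul, ← ENNReal.ofReal_add (by positivity) (by positivity)]; congr 2
    rw [hl]; field_simp; norm_num
  rw [h3, ← two_mul, ← two_mul] at h2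
  exact (ENNReal.mul_le_mul_iff_right (by simp) (by simp)).1 h2

/-- subgradient of a gauge -/
lemma subgrad {n : ℕ} {U : Set (EE n)} (hUc : Convex ℝ U) {r : ℝ} (hr : 0 < r)
    (hUr : Metric.ball 0 r ⊆ U) (y : EE n) :
    ∃ e : EE n, ‖e‖ ≤ 1 / r ∧ ∀ x, gauge U y + inner ℝ e (x - y) ≤ gauge U x := by
  have hU0 : U ∈ nhds 0 := Filter.mem_of_superset (Metric.ball_mem_nhds 0 hr) hUr
  have habs : Absorbent ℝ U := absorbent_nhds_zero hU0
  have hle : ∀ x, gauge U x ≤ ‖x‖ / r := fun x => by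
    rw [← gauge_ball hr.le x]
    exact gauge_mono (absorbent_nhds_zero (Metric.ball_mem_nhds 0 hr)) hUr x
  have hpos : ∀ (c : ℝ), 0 < c → ∀ (x : EE n), gauge U (c • x) = c * gauge U x := fun c hc x => by
    rw [gauge_smul_of_nonneg hc.le]; simp
  have hg : ∃ g : EE n →ₗ[ℝ] ℝ, g y = gauge U y ∧ ∀ x, g x ≤ gauge U x := by
    rcases eq_or_ne y 0 with rfl | hy
    · exact ⟨0, by simp, fun x => by simpa using gauge_nonneg x⟩
    · obtain ⟨g, hg1, hg2⟩ := exists_extension_of_le_sublinear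
        (LinearPMap.mkSpanSingleton y (gauge U y) hy) (gauge U) hpos (gauge_add_le hUc habs) (by
          rintro ⟨x, hx⟩
          obtain ⟨c, rfl⟩ := Submodule.mem_span_singleton.1 hx
          rw [LinearPMap.mkSpanSingleton'_apply]
          simp only [smul_eq_mul, RingHom.id_apply]
          rcases le_or_gt c 0 with hc | hc
          · exact (mul_nonpos_of_nonpos_of_nonneg hc (gauge_nonneg y)).trans (gauge_nonneg _)
          · rw [hpos c hc])
      refine ⟨g, ?_, hg2⟩
      have := hg1 ⟨y, Submodule.mem_span_singleton_self y⟩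
      simp only at this
      rw [this]
      have h := LinearPMap.mkSpanSingleton_apply (σ := RingHom.id ℝ) ℝ ℝ hy (gauge U y)
      simpa using h
  obtain ⟨g, hgy, hgle⟩ := hg
  let G := LinearMap.toContinuousLinearMap g
  let e := (InnerProductSpace.toDual ℝ (EE n)).symm G
  have hin : ∀ x, inner ℝ e x = g x := fun x => by
    simp [e, G, InnerProductSpace.toDual_symm_apply]
  refine ⟨e, ?_, fun x => ?_⟩
  · have h1 : ‖e‖ ^ 2 ≤ ‖e‖ / r := by
      rw [← real_inner_self_eq_norm_sq, hin]
      exact (hgle _).trans (hle _)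
    rcases (norm_nonneg e).eq_or_lt with h | h
    · rw [← h]; positivity
    · rw [le_div_iff₀ hr] at *
      nlinarith
  · rw [hin, map_sub, hgy]
    linarith [hgle x]

end HR

end

section
open MeasureTheory ProbabilityTheory
open scoped ENNReal Pointwise

namespace HR

lemma gauge_lt_eq {n : ℕ} {U : Set (EE n)} (hUo : IsOpen U) (hUc : Convex ℝ U) (h0 : (0 : EE n) ∈ U)
    {c : ℝ} (hc : 0 < c) : {x | gauge U x < c} = c • U := by
  ext x
  rw [Set.mem_smul_set_iff_inv_smul_mem₀ hc.ne']
  conv_rhs => rw [← setOfPred_gauge_lt_one_eq_self_of_isOpen hUc h0 hUo]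
  simp only [Set.mem_ofPred_eq]
  rw [gauge_smul_of_nonneg (by positivity), smul_eq_mul, inv_mul_lt_iff₀ hc, mul_one]

lemma vol_gauge_lt {n : ℕ} {U : Set (EE n)} (hUo : IsOpen U) (hUc : Convex ℝ U) (h0 : (0 : EE n) ∈ U)
    {c : ℝ} (hc : 0 < c) : volume {x | gauge U x < c} = ENNReal.ofReal (c ^ n) * volume U := by
  rw [gauge_lt_eq hUo hUc h0 hc, Measure.addHaar_smul]
  simp [abs_of_pos hc]

lemma vol_shell {n : ℕ} {U : Set (EE n)} (hUo : IsOpen U) (hUc : Convex ℝ U) (h0 : (0 : EE n) ∈ U)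
    (hfin : volume U ≠ ⊤) {a b : ℝ} (ha : 0 < a) (hab : a ≤ b) :
    volume {x | a ≤ gauge U x ∧ gauge U x < b} = ENNReal.ofReal (b ^ n - a ^ n) * volume U := by
  have hU0 : U ∈ nhds 0 := hUo.mem_nhds h0
  have hcont := continuous_gauge hUc hU0
  have : {x | a ≤ gauge U x ∧ gauge U x < b} = {x | gauge U x < b} \ {x | gauge U x < a} := by
    ext x; simp [and_comm]
  rw [this, measure_sdiff (show {x | gauge U x < a} ⊆ {x | gauge U x < b} from fun x hx => lt_of_lt_of_le hx hab)
    (measurableSet_lt hcont.measurable measurable_const).nullMeasurableSet,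
    vol_gauge_lt hUo hUc h0 ha, vol_gauge_lt hUo hUc h0 (ha.trans_le hab),
    ENNReal.ofReal_sub _ (by positivity), ENNReal.sub_mul (fun _ _ => hfin)]
  rw [vol_gauge_lt hUo hUc h0 ha]
  exact ENNReal.mul_ne_top (by simp) hfin

lemma clip_sub (α β : ℝ) : min 1 (max 0 α) - min 1 (max 0 β) ≤ max 0 (α - β) := by
  rcases le_total α β with h | h
  · have h1 : min 1 (max 0 α) ≤ min 1 (max 0 β) := min_le_min le_rfl (max_le_max le_rfl h)
    linarith [le_max_left 0 (α - β)]
  · have h1 : max 0 α ≤ max 0 β + (α - β) :=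
      max_le (by linarith [le_max_left 0 β]) (by linarith [le_max_right 0 β])
    have h2 : min 1 (max 0 α) ≤ min 1 (max 0 β) + (α - β) := by
      rw [← min_add_add_right]
      exact le_min ((min_le_left _ _).trans (by linarith)) ((min_le_right _ _).trans h1)
    linarith [le_max_right 0 (α - β)]

set_option maxHeartbeats 1000000 in
lemma surf_aux {n : ℕ} (hn : 0 < n) {U : Set (EE n)} (hUo : IsOpen U) (hUc : Convex ℝ U) {r : ℝ}
    (hr : 0 < r) (hUr : Metric.ball 0 r ⊆ U) (hfin : volume U ≠ ⊤) {W : Set (EE n)}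
    (hW : MeasurableSet W) (hinv : ∀ f : EE n ≃ₗᵢ[ℝ] EE n, f ⁻¹' W = W) {s : ℝ} (hs : 0 < s)
    (hWs : ∀ w ∈ W, ‖w‖ ≤ s) {ε : ℝ} (hε : 0 < ε) (hε1 : ε < 1) (M : ℕ) (hM : 0 < M) :
    ∫⁻ w in W, volume {x | x ∈ U ∧ x + w ∉ U} ≤
      ENNReal.ofReal (s / (2 * √n * r * ε) * ((1 + s / (r * M)) ^ n - (1 - ε) ^ n)
        + (1 - (1 - ε) ^ n)) * (volume U * volume W) := by
  have h0 : (0 : EE n) ∈ U := hUr (Metric.mem_ball_self hr)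
  have hU0 : U ∈ nhds 0 := hUo.mem_nhds h0
  have habs : Absorbent ℝ U := absorbent_nhds_zero hU0
  have hcont := continuous_gauge hUc hU0
  have hn' : (0:ℝ) < n := by exact_mod_cast hn
  have hN : 0 < √(n:ℝ) := Real.sqrt_pos.2 hn'
  have hM' : (0:ℝ) < M := by exact_mod_cast hM
  have hle : ∀ x, gauge U x ≤ ‖x‖ / r := fun x => by
    rw [← gauge_ball hr.le x]
    exact gauge_mono (absorbent_nhds_zero (Metric.ball_mem_nhds 0 hr)) hUr x
  set p := gauge U with hp
  set u : EE n → ℝ := fun x => min 1 (max 0 ((1 - p x) / ε)) with hu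
  have hucont : Continuous u := by fun_prop
  set T : EE n → ℝ≥0∞ := fun w => ∫⁻ x, ENNReal.ofReal (u x - u (x + w)) with hT
  have hTadd : ∀ v w, T (v + w) ≤ T v + T w := by
    intro v w
    have e : T w = ∫⁻ x, ENNReal.ofReal (u (x + v) - u (x + v + w)) :=
      (lintegral_add_right_eq_self (fun x => ENNReal.ofReal (u x - u (x + w))) v).symm
    rw [e]
    simp only [hT]
    rw [← lintegral_add_left (by fun_prop)]
    refine lintegral_mono fun x => ?_
    refine le_trans (ENNReal.ofReal_le_ofReal ?_) ENNReal.ofReal_add_le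
    rw [add_assoc]; linarith
  have hTmul : ∀ (k : ℕ) w, T ((k : ℝ) • w) ≤ k * T w := by
    intro k w
    induction k with
    | zero => simp [hT]
    | succ k ih =>
      push_cast
      rw [add_smul, one_smul, add_mul, one_mul]
      exact (hTadd _ _).trans (add_le_add ih le_rfl)
  set δ := s / (r * M) with hδ
  have hδ0 : 0 < δ := by positivity
  set A := {x | 1 - ε ≤ p x ∧ p x < 1 + δ} with hA
  have hAm : MeasurableSet A := (measurableSet_le measurable_const hcont.measurable).inter
    (measurableSet_lt hcont.measurable measurable_const)
  have hAv : volume A = ENNReal.ofReal ((1 + δ) ^ n - (1 - ε) ^ n) * volume U :=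
    vol_shell hUo hUc h0 hfin (by linarith) (by linarith)
  have hTW : ∫⁻ w in W, T w ≤ ENNReal.ofReal (s / (2 * √n * r * ε)) * (volume A * volume W) := by
    have h1 : ∀ w, T w ≤ M * ∫⁻ y, ENNReal.ofReal (u (y - (1 / M : ℝ) • w) - u y) := by
      intro w
      have := hTmul M ((1 / M : ℝ) • w)
      rw [smul_smul, mul_one_div_cancel hM'.ne', one_smul] at this
      refine this.trans (le_of_eq ?_)
      congr 1
      rw [← lintegral_add_right_eq_self _ ((1 / M : ℝ) • w)]
      simp [hT]
    have hm : Measurable (fun z : EE n × EE n => ENNReal.ofReal (u (z.2 - (1 / M : ℝ) • z.1) - u z.2)) := by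
      fun_prop
    calc ∫⁻ w in W, T w ≤ ∫⁻ w in W, M * ∫⁻ y, ENNReal.ofReal (u (y - (1 / M : ℝ) • w) - u y) :=
          lintegral_mono h1
      _ = M * ∫⁻ w in W, ∫⁻ y, ENNReal.ofReal (u (y - (1 / M : ℝ) • w) - u y) :=
          lintegral_const_mul _ (Measurable.lintegral_prod_right' hm)
      _ = M * ∫⁻ y, ∫⁻ w in W, ENNReal.ofReal (u (y - (1 / M : ℝ) • w) - u y) := by
          rw [lintegral_lintegral_swap hm.aemeasurable]
      _ ≤ M * ∫⁻ y, A.indicator (fun _ => ENNReal.ofReal (s / (2 * √n * r * M * ε)) * volume W) y := by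
          gcongr with y
          obtain ⟨e, he, hsub⟩ := subgrad hUc hr hUr y
          have hpt : ∀ w ∈ W, ENNReal.ofReal (u (y - (1 / M : ℝ) • w) - u y) ≤
              A.indicator (fun _ => ENNReal.ofReal (inner ℝ ((1 / (M * ε) : ℝ) • e) w)) y := by
            intro w hw
            by_cases hpos : u (y - (1 / M : ℝ) • w) - u y ≤ 0
            · rw [ENNReal.ofReal_of_nonpos hpos]; exact zero_le
            push Not at hpos
            have hsub' := hsub (y - (1 / M : ℝ) • w)
            have hyA : y ∈ A := by
              simp only [hA, Set.mem_ofPred_eq]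
              constructor
              · by_contra hcon
                push Not at hcon
                have : u y = 1 := by
                  simp only [hu]
                  rw [min_eq_left]
                  refine le_max_of_le_right ?_
                  rw [le_div_iff₀ hε]; linarith
                have h2 : u (y - (1 / M : ℝ) • w) ≤ 1 := min_le_left _ _
                linarith
              · by_contra hcon
                push Not at hcon
                have h3 : p y ≤ p (y - (1 / M : ℝ) • w) + p ((1 / M : ℝ) • w) := by
                  have := gauge_add_le hUc habs (y - (1 / M : ℝ) • w) ((1 / M : ℝ) • w)
                  simpa using this
                have h4 : p ((1 / M : ℝ) • w) ≤ δ := by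
                  refine (hle _).trans ?_
                  rw [norm_smul, Real.norm_of_nonneg (by positivity), hδ]
                  have := hWs w hw
                  calc 1 / (M:ℝ) * ‖w‖ / r ≤ 1 / (M:ℝ) * s / r := by gcongr
                    _ = _ := by field_simp
                have h5 : u (y - (1 / M : ℝ) • w) ≤ 0 := by
                  refine (min_le_right _ _).trans (max_le le_rfl ?_)
                  exact div_nonpos_of_nonpos_of_nonneg (by linarith) hε.le
                have h6 : 0 ≤ u y := le_min zero_le_one (le_max_left _ _)
                linarith
            rw [Set.indicator_of_mem hyA]
            refine ENNReal.ofReal_le_ofReal ?_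
            have hi : inner ℝ ((1 / (M * ε) : ℝ) • e) w = inner ℝ e ((1 / M : ℝ) • w) / ε := by
              rw [real_inner_smul_left, real_inner_smul_right]; field_simp
            rw [hi]
            have h7 : p y - p (y - (1 / M : ℝ) • w) ≤ inner ℝ e ((1 / M : ℝ) • w) := by
              have : inner ℝ e (y - (1 / M : ℝ) • w - y) = - inner ℝ e ((1 / M : ℝ) • w) := by
                rw [← inner_neg_right]; congr 1; abel
              linarith
            have h8 : u (y - (1 / M : ℝ) • w) - u y ≤ max 0 ((p y - p (y - (1 / M : ℝ) • w)) / ε) := by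
              have ea : (p y - p (y - (1 / M : ℝ) • w)) / ε =
                (1 - p (y - (1 / M : ℝ) • w)) / ε - (1 - p y) / ε := by ring
              rw [ea]
              simp only [hu]
              generalize (1 - p (y - (1 / M : ℝ) • w)) / ε = α
              generalize (1 - p y) / ε = β
              exact clip_sub α β
            have h9 : 0 < (p y - p (y - (1 / M : ℝ) • w)) / ε := by
              by_contra hc
              push Not at hc
              rw [max_eq_left hc] at h8
              linarith
            rw [max_eq_right h9.le] at h8
            refine h8.trans ?_
            gcongr
          calc ∫⁻ w in W, ENNReal.ofReal (u (y - (1 / M : ℝ) • w) - u y) ≤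
              ∫⁻ w in W, A.indicator (fun _ => ENNReal.ofReal (inner ℝ ((1 / (M * ε) : ℝ) • e) w)) y :=
                setLIntegral_mono' hW hpt
            _ ≤ _ := by
              by_cases hyA : y ∈ A
              · simp only [Set.indicator_of_mem hyA]
                refine (iso_pos hn hW hinv hs hWs _).trans ?_
                refine mul_le_mul_left (ENNReal.ofReal_le_ofReal ?_) _
                rw [norm_smul, Real.norm_of_nonneg (by positivity)]
                calc 1 / (M * ε) * ‖e‖ * s / (2 * √n) ≤ 1 / (M * ε) * (1 / r) * s / (2 * √n) := by gcongr
                  _ = _ := by field_simp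
              · simp [Set.indicator_of_notMem hyA]
      _ = _ := by
          rw [lintegral_indicator hAm, setLIntegral_const]
          have : ENNReal.ofReal (s / (2 * √n * r * ε)) = M * ENNReal.ofReal (s / (2 * √n * r * M * ε)) := by
            rw [← ENNReal.ofReal_natCast, ← ENNReal.ofReal_mul hM'.le]
            congr 1; field_simp
          rw [this]; ring
  have hpt : ∀ w, volume {x | x ∈ U ∧ x + w ∉ U} ≤ T w + ENNReal.ofReal (1 - (1 - ε) ^ n) * volume U := by
    intro w
    have hsub : {x | x ∈ U ∧ x + w ∉ U} ⊆ {x | 1 ≤ ENNReal.ofReal (u x - u (x + w))} ∪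
        {x | 1 - ε ≤ p x ∧ p x < 1} := by
      rintro x ⟨hx, hxw⟩
      have e := setOfPred_gauge_lt_one_eq_self_of_isOpen hUc h0 hUo
      have hx1 : p x < 1 := by rw [← e] at hx; exact hx
      have hx2 : 1 ≤ p (x + w) := by
        by_contra hc
        push Not at hc
        apply hxw; rw [← e]; exact hc
      by_cases h : 1 - ε ≤ p x
      · exact Or.inr ⟨h, hx1⟩
      · left
        push Not at h
        have h1 : u x = 1 := by
          simp only [hu]
          rw [min_eq_left]
          refine le_max_of_le_right ?_
          rw [le_div_iff₀ hε]; linarith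
        have h2 : u (x + w) = 0 := by
          simp only [hu]
          rw [max_eq_left (div_nonpos_of_nonpos_of_nonneg (by linarith) hε.le)]
          simp
        simp [h1, h2]
    refine (measure_mono hsub).trans ((measure_union_le _ _).trans (add_le_add ?_ (le_of_eq ?_)))
    · have := mul_meas_ge_le_lintegral₀ (μ := volume) (f := fun x => ENNReal.ofReal (u x - u (x + w)))
        (by fun_prop) 1
      simpa using this
    · have := vol_shell hUo hUc h0 hfin (a := 1 - ε) (b := 1) (by linarith) (by linarith)
      simpa using this
  calc ∫⁻ w in W, volume {x | x ∈ U ∧ x + w ∉ U} ≤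
      ∫⁻ w in W, T w + ENNReal.ofReal (1 - (1 - ε) ^ n) * volume U := lintegral_mono hpt
    _ = (∫⁻ w in W, T w) + ENNReal.ofReal (1 - (1 - ε) ^ n) * volume U * volume W := by
        rw [lintegral_add_right _ measurable_const]; simp
    _ ≤ ENNReal.ofReal (s / (2 * √n * r * ε)) * (volume A * volume W) +
        ENNReal.ofReal (1 - (1 - ε) ^ n) * volume U * volume W := add_le_add hTW le_rfl
    _ = _ := by
        have h1 : (1 - ε) ^ n ≤ 1 := pow_le_one₀ (by linarith) (by linarith)
        have h2 : (1:ℝ) ≤ (1 + δ) ^ n := one_le_pow₀ (by linarith)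
        rw [hAv, ENNReal.ofReal_add (mul_nonneg (by positivity) (by linarith)) (by linarith),
          ENNReal.ofReal_mul (by positivity)]
        ring

lemma surf {n : ℕ} (hn : 0 < n) {U : Set (EE n)} (hUo : IsOpen U) (hUc : Convex ℝ U) {r : ℝ}
    (hr : 0 < r) (hUr : Metric.ball 0 r ⊆ U) (hfin : volume U ≠ ⊤) {W : Set (EE n)}
    (hW : MeasurableSet W) (hinv : ∀ f : EE n ≃ₗᵢ[ℝ] EE n, f ⁻¹' W = W) {s : ℝ} (hs : 0 < s)
    (hWs : ∀ w ∈ W, ‖w‖ ≤ s) :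
    ∫⁻ w in W, volume {x | x ∈ U ∧ x + w ∉ U} ≤
      ENNReal.ofReal (s * √n / (2 * r)) * (volume U * volume W) := by
  have hn' : (0:ℝ) < n := by exact_mod_cast hn
  have hN : 0 < √(n:ℝ) := Real.sqrt_pos.2 hn'
  have hWfin : volume W ≠ ⊤ := by
    refine ne_top_of_le_ne_top (measure_closedBall_lt_top (x := (0 : EE n)) (r := s)).ne
      (measure_mono fun w hw => ?_)
    simpa using hWs w hw
  have hUW : volume U * volume W ≠ ⊤ := ENNReal.mul_ne_top hfin hWfin
  have step1 : ∀ ε : ℝ, 0 < ε → ε < 1 → ∫⁻ w in W, volume {x | x ∈ U ∧ x + w ∉ U} ≤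
      ENNReal.ofReal (s / (2 * √n * r * ε) * ((1 + 0) ^ n - (1 - ε) ^ n)
        + (1 - (1 - ε) ^ n)) * (volume U * volume W) := by
    intro ε h0 h1
    refine ge_of_tendsto (f := fun M : ℕ => ENNReal.ofReal (s / (2 * √n * r * ε) * ((1 + s / (r * M)) ^ n - (1 - ε) ^ n)
        + (1 - (1 - ε) ^ n)) * (volume U * volume W)) (x := Filter.atTop) ?_ ?_
    · refine ENNReal.Tendsto.mul_const (ENNReal.tendsto_ofReal ?_) (Or.inr hUW)
      refine Filter.Tendsto.add_const _ (Filter.Tendsto.const_mul _ (Filter.Tendsto.sub_const ?_ _))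
      refine Filter.Tendsto.pow (Filter.Tendsto.const_add _ ?_) _
      have : (fun M : ℕ => s / (r * M)) = fun M : ℕ => (s / r) / (M : ℝ) := by
        ext M; rw [div_div]
      rw [this]
      exact tendsto_const_div_atTop_nhds_zero_nat _
    · filter_upwards [Filter.eventually_gt_atTop 0] with M hM
      exact surf_aux hn hUo hUc hr hUr hfin hW hinv hs hWs h0 h1 M hM
  have step2 : ∀ ε : ℝ, 0 < ε → ε < 1 → ∫⁻ w in W, volume {x | x ∈ U ∧ x + w ∉ U} ≤
      ENNReal.ofReal (s * √n / (2 * r) + n * ε) * (volume U * volume W) := by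
    intro ε h0 h1
    refine (step1 ε h0 h1).trans ?_
    refine mul_le_mul_left (ENNReal.ofReal_le_ofReal ?_) _
    have hb : 1 - (1 - ε) ^ n ≤ n * ε := by
      have := one_add_mul_le_pow (a := -ε) (by linarith) n
      have e : 1 + -ε = 1 - ε := by ring
      rw [e] at this
      linarith
    simp only [add_zero, one_pow]
    refine add_le_add ?_ hb
    calc s / (2 * √n * r * ε) * (1 - (1 - ε) ^ n) ≤ s / (2 * √n * r * ε) * (n * ε) := by gcongr
      _ = s / (2 * √n * r * ε) * ((√n * √n) * ε) := by rw [Real.mul_self_sqrt hn'.le]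
      _ = _ := by field_simp
  refine ge_of_tendsto (f := fun ε : ℝ => ENNReal.ofReal (s * √n / (2 * r) + n * ε) * (volume U * volume W))
    (x := nhdsWithin 0 (Set.Ioi 0)) ?_ ?_
  · refine ENNReal.Tendsto.mul_const (ENNReal.tendsto_ofReal ?_) (Or.inr hUW)
    refine tendsto_nhdsWithin_of_tendsto_nhds ?_
    have : Continuous (fun ε : ℝ => s * √n / (2 * r) + n * ε) := by fun_prop
    have h := this.tendsto 0
    simpa using h
  · filter_upwards [Ioo_mem_nhdsGT (show (0:ℝ) < 1 by norm_num)] with ε hε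
    exact step2 ε hε.1 hε.2

end HR

end

section
open MeasureTheory ProbabilityTheory
open scoped ENNReal Pointwise

namespace HR

lemma shift_aux {n : ℕ} (hn : 0 < n) {ρ : ℝ} (hρ : 0 < ρ) (v : EE n) :
    volume {z | z ∈ Metric.ball (0 : EE n) ρ ∧ z + v ∉ Metric.ball (0 : EE n) ρ} ≤
      ENNReal.ofReal (√n * ‖v‖ / (2 * ρ)) * volume (Metric.ball (0 : EE n) ρ) := by
  set B := Metric.ball (0 : EE n) ρ with hB
  have hBm : MeasurableSet B := measurableSet_ball
  have hBfin : volume B ≠ ⊤ := measure_ball_lt_top.ne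
  rcases eq_or_ne v 0 with rfl | hv
  · have : {z | z ∈ B ∧ z + 0 ∉ B} = ∅ := by ext z; simp
    rw [this]; simp
  have hs : 0 < ‖v‖ := norm_pos_iff.2 hv
  set F : EE n → ℝ≥0∞ := fun w => volume {z | z ∈ B ∧ z + w ∉ B} with hF
  have hmeas : ∀ w, MeasurableSet {z | z ∈ B ∧ z + w ∉ B} := fun w =>
    hBm.inter ((measurable_add_const w) hBm.compl)
  have hFrot : ∀ (f : EE n ≃ₗᵢ[ℝ] EE n) w, F (f w) = F w := by
    intro f w
    simp only [hF]
    rw [← f.measurePreserving.measure_preimage (hmeas (f w)).nullMeasurableSet]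
    congr 1
    ext z
    simp only [hB, Set.mem_preimage, Set.mem_ofPred_eq, mem_ball_zero_iff, ← map_add, f.norm_map]
  have hFscale : ∀ (c : ℝ) w, 1 ≤ c → F w ≤ F (c • w) := by
    intro c w hc
    refine measure_mono ?_
    rintro z ⟨hz, hzw⟩
    refine ⟨hz, fun hcon => hzw ?_⟩
    have := (convex_ball (0 : EE n) ρ) hz hcon (a := 1 - 1 / c) (b := 1 / c)
      (by rw [sub_nonneg, div_le_one (by linarith)]; exact hc) (by positivity) (by ring)
    convert this using 1
    rw [smul_add, smul_smul, one_div_mul_cancel (by linarith), ← add_assoc, ← add_smul]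
    simp
  have hFbig : ∀ w, ‖v‖ ≤ ‖w‖ → F v ≤ F w := by
    intro w hw
    obtain ⟨f, hf⟩ := exists_rot (v := (‖w‖ / ‖v‖) • v) (w := w) (by
      rw [norm_smul, Real.norm_of_nonneg (by positivity)]; field_simp)
    rw [← hf, hFrot]
    exact hFscale _ _ (by rw [le_div_iff₀ hs]; linarith)
  have step : ∀ s', ‖v‖ < s' → F v ≤ ENNReal.ofReal (s' * √n / (2 * ρ)) * volume B := by
    intro s' hs'
    set W := {w : EE n | ‖v‖ ≤ ‖w‖ ∧ ‖w‖ < s'} with hW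
    have hWm : MeasurableSet W := (measurableSet_le measurable_const measurable_norm).inter
      (measurableSet_lt measurable_norm measurable_const)
    have h1 := surf hn (U := B) Metric.isOpen_ball (convex_ball _ _) hρ subset_rfl hBfin hWm
      (fun f => by ext w; simp [hW]) (s := s') (by linarith) (fun w hw => hw.2.le)
    have h2 : F v * volume W ≤ ENNReal.ofReal (s' * √n / (2 * ρ)) * volume B * volume W := by
      rw [mul_assoc]
      refine le_trans ?_ h1
      rw [← setLIntegral_const]
      exact setLIntegral_mono' hWm fun w hw => hFbig w hw.1
    have hWfin : volume W ≠ ⊤ := by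
      refine ne_top_of_le_ne_top (measure_ball_lt_top (x := (0 : EE n)) (r := s')).ne
        (measure_mono fun w hw => ?_)
      simpa using hw.2
    have hW0 : volume W ≠ 0 := by
      have ho : IsOpen {w : EE n | ‖v‖ < ‖w‖ ∧ ‖w‖ < s'} :=
        (isOpen_lt continuous_const continuous_norm).inter (isOpen_lt continuous_norm continuous_const)
      have hne : {w : EE n | ‖v‖ < ‖w‖ ∧ ‖w‖ < s'}.Nonempty := by
        refine ⟨((‖v‖ + s') / 2 / ‖v‖) • v, ?_⟩
        have : ‖((‖v‖ + s') / 2 / ‖v‖) • v‖ = (‖v‖ + s') / 2 := by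
          rw [norm_smul, Real.norm_of_nonneg (div_nonneg (by linarith) hs.le)]; field_simp
        simp only [Set.mem_ofPred_eq, this]
        constructor <;> linarith
      refine (lt_of_lt_of_le (ho.measure_pos volume hne) (measure_mono (t := W) fun w hw =>
        show ‖v‖ ≤ ‖w‖ ∧ ‖w‖ < s' from ⟨hw.1.le, hw.2⟩)).ne'
    exact (ENNReal.mul_le_mul_iff_left hW0 hWfin).1 h2
  refine ge_of_tendsto (f := fun s' : ℝ => ENNReal.ofReal (s' * √n / (2 * ρ)) * volume B)
    (x := nhdsWithin ‖v‖ (Set.Ioi ‖v‖)) ?_ ?_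
  · refine ENNReal.Tendsto.mul_const (ENNReal.tendsto_ofReal ?_) (Or.inr hBfin)
    refine tendsto_nhdsWithin_of_tendsto_nhds ?_
    have : Continuous (fun s' : ℝ => s' * √n / (2 * ρ)) := by fun_prop
    have h := this.tendsto ‖v‖
    rwa [mul_comm ‖v‖] at h
  · filter_upwards [self_mem_nhdsWithin] with s' hs'
    exact step s' hs'

lemma ball_shift {n : ℕ} (hn : 0 < n) {ρ : ℝ} (hρ : 0 < ρ) (x y : EE n) :
    volume (Metric.ball x ρ \ Metric.ball y ρ) ≤
      ENNReal.ofReal (√n * ‖x - y‖ / (2 * ρ)) * volume (Metric.ball (0 : EE n) ρ) := by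
  refine le_trans (le_of_eq ?_) (shift_aux hn hρ (x - y))
  rw [← measure_preimage_add_right volume x]
  congr 1
  ext z
  have e : z - (y - x) = z + (x - y) := by abel
  simp [dist_eq_norm, e]

lemma vol_sub_ball {n : ℕ} (U : Set (EE n)) (hU : MeasurableSet U) (h : ℝ) (x : EE n) :
    volume (Metric.ball x h \ U) = ∫⁻ w in Metric.ball (0 : EE n) h, Set.indicator Uᶜ 1 (x + w) := by
  rw [show (Metric.ball x h \ U) = Metric.ball x h ∩ Uᶜ from rfl, Set.inter_comm,
    ← Measure.restrict_apply hU.compl, ← lintegral_indicator_one hU.compl,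
    ← (measurePreserving_add_left volume x).setLIntegral_comp_preimage measurableSet_ball
      (measurable_one.indicator hU.compl)]
  congr 2
  ext w; simp

lemma surf2 {n : ℕ} (hn : 0 < n) {U : Set (EE n)} (hUo : IsOpen U) (hUc : Convex ℝ U) {r : ℝ}
    (hr : 0 < r) (hUr : Metric.ball 0 r ⊆ U) (hfin : volume U ≠ ⊤) {h : ℝ} (hh : 0 < h) :
    ∫⁻ x in U, volume (Metric.ball x h \ U) ≤
      ENNReal.ofReal (h * √n / (2 * r)) * (volume U * volume (Metric.ball (0 : EE n) h)) := by
  refine le_trans (le_of_eq ?_) (surf hn hUo hUc hr hUr hfin (W := Metric.ball 0 h) measurableSet_ball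
    (fun f => by ext w; simp) hh (fun w hw => by simpa using (mem_ball_zero_iff.1 hw).le))
  simp_rw [vol_sub_ball U hUo.measurableSet]
  rw [lintegral_lintegral_swap]
  · refine lintegral_congr fun w => ?_
    have hm : MeasurableSet {x | x + w ∉ U} := (measurable_add_const w) hUo.measurableSet.compl
    have : {x | x ∈ U ∧ x + w ∉ U} = {x | x + w ∉ U} ∩ U := by ext; simp [and_comm]
    rw [this, ← Measure.restrict_apply hm, ← lintegral_indicator_one hm]
    refine lintegral_congr fun x => ?_
    by_cases hx : x + w ∈ U <;> simp [Set.indicator, hx]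
  · refine Measurable.aemeasurable ?_
    exact (measurable_one.indicator hUo.measurableSet.compl).comp (measurable_fst.add measurable_snd)

end HR

end

section
open MeasureTheory ProbabilityTheory
open scoped ENNReal Pointwise

namespace HR

/-- rescaled part of the ball contained in `U` -/
noncomputable def fr {n : ℕ} (U : Set (EE n)) (x : EE n) (ρ : ℝ) : ℝ≥0∞ :=
  volume {b | b ∈ Metric.ball (0 : EE n) 1 ∧ x + ρ • b ∈ U}

def TT {n : ℕ} (U : Set (EE n)) (h : ℝ) (x : EE n) : Set ℝ :=
  {a | 0 ≤ a ∧ a ≤ 1 ∧ ENNReal.ofReal (5 / 6) * volume (Metric.ball (0 : EE n) 1) ≤ fr U x (a * h)}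

noncomputable def tau {n : ℕ} (U : Set (EE n)) (h : ℝ) (x : EE n) : ℝ := sSup (TT U h x)

lemma vol_ball {n : ℕ} (hn : 0 < n) {ρ : ℝ} (hρ : 0 < ρ) (x : EE n) :
    volume (Metric.ball x ρ) = ENNReal.ofReal (ρ ^ n) * volume (Metric.ball (0 : EE n) 1) := by
  rw [Measure.addHaar_ball_of_pos _ _ hρ]; simp

lemma vol_ball_center {n : ℕ} {ρ : ℝ} (x : EE n) :
    volume (Metric.ball x ρ) = volume (Metric.ball (0 : EE n) ρ) := by
  rw [Measure.addHaar_ball_center]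

lemma fr_meas {n : ℕ} {U : Set (EE n)} (hUo : IsOpen U) (x : EE n) (ρ : ℝ) :
    MeasurableSet {b | b ∈ Metric.ball (0 : EE n) 1 ∧ x + ρ • b ∈ U} := by
  refine measurableSet_ball.inter ?_
  exact (hUo.preimage (f := fun b => x + ρ • b) (by fun_prop)).measurableSet

lemma fr_scale {n : ℕ} (U : Set (EE n)) (x : EE n) {ρ : ℝ} (hρ : 0 < ρ) :
    volume (Metric.ball x ρ ∩ U) = ENNReal.ofReal (ρ ^ n) * fr U x ρ := by
  rw [← measure_preimage_add volume x, fr]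
  have : (fun z => x + z) ⁻¹' (Metric.ball x ρ ∩ U) =
      ρ • {b | b ∈ Metric.ball (0 : EE n) 1 ∧ x + ρ • b ∈ U} := by
    ext z
    rw [Set.mem_smul_set_iff_inv_smul_mem₀ hρ.ne']
    simp only [Set.mem_preimage, Set.mem_inter_iff, mem_ball_iff_norm, add_sub_cancel_left,
      Set.mem_ofPred_eq, sub_zero, norm_smul, smul_smul, mul_inv_cancel₀ hρ.ne', one_smul]
    rw [Real.norm_of_nonneg (by positivity), inv_mul_lt_iff₀ hρ, mul_one]
  rw [this, Measure.addHaar_smul]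
  simp [abs_of_pos hρ]

lemma fr_anti {n : ℕ} {U : Set (EE n)} (hUc : Convex ℝ U) {x : EE n} (hx : x ∈ U) {ρ ρ' : ℝ}
    (h0 : 0 ≤ ρ) (h1 : ρ ≤ ρ') : fr U x ρ' ≤ fr U x ρ := by
  rcases h0.eq_or_lt with rfl | h0
  · exact measure_mono fun b hb => ⟨hb.1, by simpa using hx⟩
  refine measure_mono fun b hb => ⟨hb.1, ?_⟩
  have h2 : 0 < ρ' := h0.trans_le h1
  have := hUc hx hb.2 (a := 1 - ρ / ρ') (b := ρ / ρ')
    (by rw [sub_nonneg, div_le_one h2]; exact h1) (by positivity) (by ring)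
  convert this using 1
  rw [smul_add, smul_smul, div_mul_cancel₀ _ h2.ne', ← add_assoc, ← add_smul]
  simp

section
variable {n : ℕ} (hn : 0 < n) {U : Set (EE n)} (hUo : IsOpen U) (hUc : Convex ℝ U) {h : ℝ} (hh : 0 < h)

lemma zero_mem_TT {x : EE n} (hx : x ∈ U) : 0 ∈ TT U h x := by
  refine ⟨le_rfl, zero_le_one, ?_⟩
  have : fr U x (0 * h) = volume (Metric.ball (0 : EE n) 1) := by
    rw [fr]; congr 1; ext b; simp [hx]
  rw [this]
  refine mul_le_of_le_one_left' ?_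
  rw [← ENNReal.ofReal_one]; exact ENNReal.ofReal_le_ofReal (by norm_num)

lemma TT_bdd (x : EE n) : BddAbove (TT U h x) := ⟨1, fun _ ha => ha.2.1⟩

lemma tau_nonneg (x : EE n) : 0 ≤ tau U h x := Real.sSup_nonneg fun _ ha => ha.1

lemma tau_le_one (x : EE n) : tau U h x ≤ 1 := Real.sSup_le (fun _ ha => ha.2.1) zero_le_one

include hh hUc in
lemma TT_down {x : EE n} (hx : x ∈ U) {a b : ℝ} (ha : a ∈ TT U h x) (hb : 0 ≤ b) (hba : b ≤ a) :
    b ∈ TT U h x :=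
  ⟨hb, hba.trans ha.2.1, ha.2.2.trans (fr_anti hUc hx (by positivity) (by gcongr))⟩

include hh hUc in
lemma tau_mem {x : EE n} (hx : x ∈ U) : tau U h x ∈ TT U h x := by
  rcases (tau_nonneg (U := U) (h := h) x).eq_or_lt with h0 | h0
  · rw [← h0]; exact zero_mem_TT hx
  have hlt : ∀ a, 0 ≤ a → a < tau U h x → a ∈ TT U h x := by
    intro a ha0 ha
    obtain ⟨b, hb, hab⟩ := exists_lt_of_lt_csSup ⟨0, zero_mem_TT hx⟩ ha
    exact TT_down hUc hh hx hb ha0 hab.le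
  refine ⟨h0.le, tau_le_one x, ?_⟩
  set T := tau U h x
  have hTh : 0 < T * h := by positivity
  have key : ENNReal.ofReal ((T * h) ^ n) * (ENNReal.ofReal (5 / 6) * volume (Metric.ball (0 : EE n) 1))
      ≤ volume (Metric.ball x (T * h) ∩ U) := by
    refine le_of_tendsto (f := fun a : ℝ => ENNReal.ofReal ((a * h) ^ n) *
      (ENNReal.ofReal (5 / 6) * volume (Metric.ball (0 : EE n) 1))) (x := nhdsWithin T (Set.Iio T)) ?_ ?_
    · refine ENNReal.Tendsto.mul_const (ENNReal.tendsto_ofReal ?_)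
        (Or.inr (ENNReal.mul_ne_top (by simp) measure_ball_lt_top.ne))
      refine tendsto_nhdsWithin_of_tendsto_nhds ?_
      have : Continuous (fun a : ℝ => (a * h) ^ n) := by fun_prop
      exact this.tendsto T
    · filter_upwards [Ioo_mem_nhdsLT h0] with a ha
      have h1 := (hlt a ha.1.le ha.2).2.2
      have ha0 : 0 < a * h := mul_pos ha.1 hh
      calc _ ≤ ENNReal.ofReal ((a * h) ^ n) * fr U x (a * h) := mul_le_mul_right h1 _
        _ = volume (Metric.ball x (a * h) ∩ U) := (fr_scale U x ha0).symm
        _ ≤ _ := by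
          refine measure_mono (Set.inter_subset_inter_left _ (Metric.ball_subset_ball ?_))
          have := ha.2.le
          gcongr
  rw [fr_scale U x hTh] at key
  refine (ENNReal.mul_le_mul_iff_right ?_ (by simp)).1 key
  simp only [ne_eq, ENNReal.ofReal_eq_zero, not_le]
  positivity

include hh hUc in
lemma tau_ge_iff {x : EE n} (hx : x ∈ U) {a : ℝ} (ha : a ∈ TT U h x) : a ≤ tau U h x :=
  le_csSup (TT_bdd x) ha

include hh hUc in
lemma fr_ge {x : EE n} (hx : x ∈ U) {ρ : ℝ} (h0 : 0 ≤ ρ) (h1 : ρ ≤ tau U h x * h) :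
    ENNReal.ofReal (5 / 6) * volume (Metric.ball (0 : EE n) 1) ≤ fr U x ρ :=
  (tau_mem hUc hh hx).2.2.trans (fr_anti hUc hx h0 h1)

include hh hUc hUo hn in
lemma compl_le {x : EE n} (hx : x ∈ U) {ρ : ℝ} (h0 : 0 < ρ) (h1 : ρ ≤ tau U h x * h) :
    volume (Metric.ball x ρ \ U) ≤ ENNReal.ofReal (1 / 6) * volume (Metric.ball (0 : EE n) ρ) := by
  have h2 := fr_ge hUc hh hx h0.le h1
  have h3 : ENNReal.ofReal (5 / 6) * volume (Metric.ball (0 : EE n) ρ) ≤ volume (Metric.ball x ρ ∩ U) := by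
    rw [fr_scale U x h0, vol_ball hn h0 0, mul_left_comm]
    exact mul_le_mul_right h2 _
  have h4 := measure_inter_add_sdiff (μ := volume) (Metric.ball x ρ) hUo.measurableSet
  have h5 : volume (Metric.ball x ρ) = ENNReal.ofReal (5 / 6) * volume (Metric.ball (0 : EE n) ρ)
      + ENNReal.ofReal (1 / 6) * volume (Metric.ball (0 : EE n) ρ) := by
    rw [← add_mul, ← ENNReal.ofReal_add (by norm_num) (by norm_num), vol_ball_center x]
    norm_num
  have hfin : ENNReal.ofReal (5 / 6) * volume (Metric.ball (0 : EE n) ρ) ≠ ⊤ :=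
    ENNReal.mul_ne_top (by simp) measure_ball_lt_top.ne
  refine (ENNReal.add_le_add_iff_left hfin).1 ?_
  rw [← h5, ← h4]
  exact add_le_add h3 le_rfl

include hUc hUo in
lemma half_out {p : EE n} (hp : p ∉ U) (ρ : ℝ) :
    volume (Metric.ball (0 : EE n) ρ) ≤ 2 * volume (Metric.ball p ρ \ U) := by
  have h4 := measure_inter_add_sdiff (μ := volume) (Metric.ball p ρ) hUo.measurableSet
  rw [← vol_ball_center p, ← h4, two_mul]
  refine add_le_add ?_ le_rfl
  have hm : MeasurableSet (Metric.ball p ρ \ U) := measurableSet_ball.diff hUo.measurableSet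
  rw [← (Measure.measurePreserving_sub_left volume (p + p)).measure_preimage hm.nullMeasurableSet]
  refine measure_mono ?_
  rintro z ⟨hz, hzU⟩
  refine ⟨?_, fun hcon => hp ?_⟩
  · rw [mem_ball_iff_norm] at *
    have : p + p - z - p = -(z - p) := by abel
    rw [this, norm_neg]; exact hz
  · have := hUc hzU hcon (a := 1 / 2) (b := 1 / 2) (by norm_num) (by norm_num) (by norm_num)
    convert this using 1
    module

include hh hUc hUo hn in
lemma in_of_close {x p : EE n} (hx : x ∈ U) (hpos : 0 < tau U h x)
    (hxp : ‖p - x‖ ≤ tau U h x * h / (2 * √n)) : p ∈ U := by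
  by_contra hp
  have hn' : (0:ℝ) < n := by exact_mod_cast hn
  have hN : 0 < √(n:ℝ) := Real.sqrt_pos.2 hn'
  set ρ := tau U h x * h with hρ
  have hρ0 : 0 < ρ := by positivity
  have h1 := half_out hUo hUc hp ρ
  have h2 : volume (Metric.ball p ρ \ U) ≤ ENNReal.ofReal (1 / 4) * volume (Metric.ball (0 : EE n) ρ)
      + ENNReal.ofReal (1 / 6) * volume (Metric.ball (0 : EE n) ρ) := by
    calc _ ≤ volume ((Metric.ball p ρ \ Metric.ball x ρ) ∪ (Metric.ball x ρ \ U)) := by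
          refine measure_mono fun z hz => ?_
          by_cases hzx : z ∈ Metric.ball x ρ
          · exact Or.inr ⟨hzx, hz.2⟩
          · exact Or.inl ⟨hz.1, hzx⟩
      _ ≤ _ := measure_union_le _ _
      _ ≤ _ := by
          refine add_le_add ?_ (compl_le hn hUo hUc hh hx hρ0 le_rfl)
          refine (ball_shift hn hρ0 p x).trans (mul_le_mul_left (ENNReal.ofReal_le_ofReal ?_) _)
          rw [div_le_iff₀ (by positivity)]
          calc √n * ‖p - x‖ ≤ √n * (ρ / (2 * √n)) := by gcongr
            _ = _ := by field_simp; norm_num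
  have h3 : volume (Metric.ball (0 : EE n) ρ) ≤ ENNReal.ofReal (5 / 6) * volume (Metric.ball (0 : EE n) ρ) := by
    refine h1.trans ((mul_le_mul_right h2 2).trans (le_of_eq ?_))
    have e2 : ENNReal.ofReal (5 / 6) = 2 * ENNReal.ofReal (1 / 4 + 1 / 6) := by
      rw [← ENNReal.ofReal_ofNat 2, ← ENNReal.ofReal_mul (by norm_num)]; norm_num
    rw [← add_mul, ← ENNReal.ofReal_add (by norm_num) (by norm_num), ← mul_assoc, e2]
  have hV0 : volume (Metric.ball (0 : EE n) ρ) ≠ 0 := (Metric.measure_ball_pos volume _ hρ0).ne'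
  have hVf : volume (Metric.ball (0 : EE n) ρ) ≠ ⊤ := measure_ball_lt_top.ne
  conv_lhs at h3 => rw [← one_mul (volume (Metric.ball (0 : EE n) ρ))]
  have h5 := (ENNReal.mul_le_mul_iff_left hV0 hVf).1 h3
  rw [← ENNReal.ofReal_one, ENNReal.ofReal_le_ofReal_iff (by norm_num)] at h5
  norm_num at h5

include hh hUo hUc in
lemma TT_conc {x y : EE n} (hx : x ∈ U) (hy : y ∈ U) {α β s t : ℝ} (hα : α ∈ TT U h x)
    (hβ : β ∈ TT U h y) (hs : 0 < s) (ht : 0 < t) (hst : s + t = 1) :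
    s * α + t * β ∈ TT U h (s • x + t • y) := by
  have hs1 : s = 1 - t := by linarith
  refine ⟨by have := hα.1; have := hβ.1; positivity,
    by have := hα.2.1; have := hβ.2.1; nlinarith, ?_⟩
  rcases hα.1.eq_or_lt with h0 | h0
  · rw [← h0]
    refine hβ.2.2.trans (measure_mono fun b hb => ⟨hb.1, ?_⟩)
    convert hUc hx hb.2 hs.le ht.le hst using 1
    module
  rcases hβ.1.eq_or_lt with h0' | h0'
  · rw [← h0']
    refine hα.2.2.trans (measure_mono fun b hb => ⟨hb.1, ?_⟩)
    convert hUc hb.2 hy hs.le ht.le hst using 1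
    module
  set γ := s * α + t * β with hγ
  have hγ0 : 0 < γ := by positivity
  set t' := t * β / γ with ht'
  have ht'0 : 0 < t' := by positivity
  have ht'1 : 1 - t' = s * α / γ := by rw [ht', hγ]; field_simp; ring
  have ht'lt : t' < 1 := by
    have : 0 < s * α / γ := by positivity
    linarith
  have := bm (n := n) ht'0 ht'lt (fr_meas hUo x (α * h)) (fr_meas hUo y (β * h))
    (fr_meas hUo (s • x + t • y) (γ * h)) (by
      rintro a ⟨ha, ha'⟩ b ⟨hb, hb'⟩
      refine ⟨(convex_ball (0 : EE n) 1) ha hb (by linarith) ht'0.le (by ring), ?_⟩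
      convert hUc ha' hb' hs.le ht.le hst using 1
      rw [ht'1, ht']
      have e : (γ * h) • ((s * α / γ) • a + (t * β / γ) • b) = (s * α * h) • a + (t * β * h) • b := by
        rw [smul_add, smul_smul, smul_smul]
        congr 2 <;> field_simp
      rw [e]
      module)
  refine le_trans ?_ this
  set c := ENNReal.ofReal (5 / 6) * volume (Metric.ball (0 : EE n) 1)
  have hc0 : c ≠ 0 := mul_ne_zero (by simp) (Metric.measure_ball_pos volume _ one_pos).ne'
  have hcf : c ≠ ⊤ := ENNReal.mul_ne_top (by simp) measure_ball_lt_top.ne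
  calc c = c ^ (1 - t') * c ^ t' := by
        rw [← ENNReal.rpow_add _ _ hc0 hcf]; simp
    _ ≤ _ := mul_le_mul' (ENNReal.rpow_le_rpow hα.2.2 (by linarith)) (ENNReal.rpow_le_rpow hβ.2.2 ht'0.le)

include hh hUo hUc in
lemma tau_concave : ConcaveOn ℝ U (tau U h) := by
  refine ⟨hUc, fun x hx y hy s t hs ht hst => ?_⟩
  rcases hs.eq_or_lt with rfl | hs
  · have : t = 1 := by linarith
    simp [this]
  rcases ht.eq_or_lt with rfl | ht
  · have : s = 1 := by linarith
    simp [this]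
  exact le_csSup (TT_bdd _) (TT_conc hUo hUc hh hx hy (tau_mem hUc hh hx) (tau_mem hUc hh hy) hs ht hst)

include hh in
lemma tau_ge_of_ball {x : EE n} {d : ℝ} (hd : 0 ≤ d) (hdh : d ≤ h) (hb : Metric.ball x d ⊆ U)
    (hx : x ∈ U) : d / h ≤ tau U h x := by
  refine le_csSup (TT_bdd _) ⟨by positivity, by rw [div_le_one hh]; exact hdh, ?_⟩
  rw [div_mul_cancel₀ _ hh.ne']
  have : fr U x d = volume (Metric.ball (0 : EE n) 1) := by
    rw [fr]; congr 1; ext b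
    simp only [Set.mem_ofPred_eq, and_iff_left_iff_imp]
    intro hb'
    rcases hd.eq_or_lt with rfl | hd
    · simpa using hx
    apply hb
    rw [mem_ball_iff_norm, add_sub_cancel_left, norm_smul, Real.norm_of_nonneg hd.le]
    have : ‖b‖ < 1 := by simpa using hb'
    nlinarith
  rw [this]
  refine mul_le_of_le_one_left' ?_
  rw [← ENNReal.ofReal_one]; exact ENNReal.ofReal_le_ofReal (by norm_num)

include hh hUo in
lemma tau_pos {x : EE n} (hx : x ∈ U) : 0 < tau U h x := by
  obtain ⟨d, hd, hb⟩ := Metric.isOpen_iff.1 hUo x hx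
  have := tau_ge_of_ball (U := U) hh (x := x) (d := min d h) (le_min hd.le hh.le) (min_le_right _ _)
    ((Metric.ball_subset_ball (min_le_left _ _)).trans hb) hx
  refine lt_of_lt_of_le ?_ this
  exact div_pos (lt_min hd hh) hh

include hh hUo hUc hn in
lemma tau_close {x y : EE n} (hx : x ∈ U) (hxy : ‖x - y‖ ≤ tau U h x * h / (6 * √n)) :
    y ∈ U ∧ 2 / 3 * tau U h x ≤ tau U h y ∧ 2 / 3 * tau U h y ≤ tau U h x := by
  have hn' : (0:ℝ) < n := by exact_mod_cast hn
  have hN : 0 < √(n:ℝ) := Real.sqrt_pos.2 hn'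
  have hT := tau_pos hUo hh hx
  have hb : 3 * ‖x - y‖ ≤ tau U h x * h / (2 * √n) := by
    refine (mul_le_mul_of_nonneg_left hxy (by norm_num)).trans (le_of_eq ?_)
    field_simp; norm_num
  have hp : x + (3:ℝ) • (y - x) ∈ U := in_of_close hn hUo hUc hh hx hT (by
    rw [add_sub_cancel_left, norm_smul, norm_sub_rev]; simpa using hb)
  have hp' : x + (2:ℝ) • (x - y) ∈ U := in_of_close hn hUo hUc hh hx hT (by
    rw [add_sub_cancel_left, norm_smul]
    simp only [Real.norm_ofNat]
    linarith [norm_nonneg (x - y)])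
  have hconc := tau_concave hUo hUc hh
  have ey : y = (2 / 3 : ℝ) • x + (1 / 3 : ℝ) • (x + (3:ℝ) • (y - x)) := by module
  have ex : x = (2 / 3 : ℝ) • y + (1 / 3 : ℝ) • (x + (2:ℝ) • (x - y)) := by module
  have hy : y ∈ U := by
    rw [ey]; exact hUc hx hp (by norm_num) (by norm_num) (by norm_num)
  refine ⟨hy, ?_, ?_⟩
  · have := hconc.2 hx hp (show (0:ℝ) ≤ 2 / 3 by norm_num) (show (0:ℝ) ≤ 1 / 3 by norm_num) (by norm_num)
    rw [← ey] at this
    simp only [smul_eq_mul] at this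
    linarith [tau_nonneg (U := U) (h := h) (x + (3:ℝ) • (y - x))]
  · have := hconc.2 hy hp' (show (0:ℝ) ≤ 2 / 3 by norm_num) (show (0:ℝ) ≤ 1 / 3 by norm_num) (by norm_num)
    rw [← ex] at this
    simp only [smul_eq_mul] at this
    linarith [tau_nonneg (U := U) (h := h) (x + (2:ℝ) • (x - y))]

end
end HR

end

section
open MeasureTheory ProbabilityTheory
open scoped ENNReal Pointwise

namespace HR

section
variable {n : ℕ} (hn : 0 < n) {U : Set (EE n)} (hUo : IsOpen U) (hUc : Convex ℝ U) {h : ℝ} (hh : 0 < h)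

include hn in
lemma compl_of_fr {W : Set (EE n)} (hW : MeasurableSet W) {x : EE n} {ρ : ℝ} (h0 : 0 < ρ)
    (h2 : ENNReal.ofReal (5 / 6) * volume (Metric.ball (0 : EE n) 1) ≤ fr W x ρ) :
    volume (Metric.ball x ρ \ W) ≤ ENNReal.ofReal (1 / 6) * volume (Metric.ball (0 : EE n) ρ) := by
  have h3 : ENNReal.ofReal (5 / 6) * volume (Metric.ball (0 : EE n) ρ) ≤ volume (Metric.ball x ρ ∩ W) := by
    rw [fr_scale W x h0, vol_ball hn h0 0, mul_left_comm]
    exact mul_le_mul_right h2 _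
  have h4 := measure_inter_add_sdiff (μ := volume) (Metric.ball x ρ) hW
  have h5 : volume (Metric.ball x ρ) = ENNReal.ofReal (5 / 6) * volume (Metric.ball (0 : EE n) ρ)
      + ENNReal.ofReal (1 / 6) * volume (Metric.ball (0 : EE n) ρ) := by
    rw [← add_mul, ← ENNReal.ofReal_add (by norm_num) (by norm_num), vol_ball_center x]
    norm_num
  have hfin : ENNReal.ofReal (5 / 6) * volume (Metric.ball (0 : EE n) ρ) ≠ ⊤ :=
    ENNReal.mul_ne_top (by simp) measure_ball_lt_top.ne
  refine (ENNReal.add_le_add_iff_left hfin).1 ?_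
  rw [← h5, ← h4]
  exact add_le_add h3 le_rfl

lemma fr_neg (x : EE n) (ρ : ℝ) (hUo : IsOpen U) : fr U x (-ρ) = fr U x ρ := by
  rw [fr, fr, ← (Measure.measurePreserving_neg (volume : Measure (EE n))).measure_preimage
    (fr_meas hUo x ρ).nullMeasurableSet]
  congr 1
  ext b; simp

include hn hh hUo hUc in
lemma overlap {x y : EE n} (hx : x ∈ U) (hxy : ‖x - y‖ ≤ tau U h x * h / (6 * √n)) {t : ℝ}
    (ht1 : tau U h x * h / 4 ≤ t) (ht2 : t ≤ tau U h x * h / 2) :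
    ∃ Z : Set (EE n), MeasurableSet Z ∧ Z ⊆ Metric.ball x t ∧ Z ⊆ Metric.ball y t ∧ Z ⊆ U ∧
      (∀ u ∈ Z, tau U h x / 2 ≤ tau U h u ∧ tau U h u ≤ 3 / 2 * tau U h x) ∧
      ENNReal.ofReal (1 / 3) * volume (Metric.ball (0 : EE n) t) ≤ volume Z := by
  have hn' : (0:ℝ) < n := by exact_mod_cast hn
  have hN : 0 < √(n:ℝ) := Real.sqrt_pos.2 hn'
  have hT := tau_pos hUo hh hx
  have ht0 : 0 < t := lt_of_lt_of_le (by positivity) ht1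
  set W1 := {u | x + (2:ℝ) • (u - x) ∈ U} with hW1
  set W2 := {u | x + (-2:ℝ) • (u - x) ∈ U} with hW2
  have hW1o : IsOpen W1 := hUo.preimage (by fun_prop)
  have hW2o : IsOpen W2 := hUo.preimage (by fun_prop)
  have hfr := fr_ge hUc hh hx (ρ := t * 2) (by positivity) (by linarith)
  have h1 : volume (Metric.ball x t \ W1) ≤ ENNReal.ofReal (1 / 6) * volume (Metric.ball (0 : EE n) t) := by
    refine compl_of_fr hn hW1o.measurableSet ht0 (hfr.trans (le_of_eq ?_))
    rw [fr, fr]; congr 1; ext b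
    simp only [hW1, Set.mem_ofPred_eq, add_sub_cancel_left, smul_smul, mul_comm t]
  have h2 : volume (Metric.ball x t \ W2) ≤ ENNReal.ofReal (1 / 6) * volume (Metric.ball (0 : EE n) t) := by
    refine compl_of_fr hn hW2o.measurableSet ht0 (hfr.trans (le_of_eq ?_))
    rw [← fr_neg x _ hUo, fr, fr]; congr 1; ext b
    simp only [hW2, Set.mem_ofPred_eq, add_sub_cancel_left, smul_smul]
    rw [show -(t * 2) = -2 * t by ring]
  have h3 : volume (Metric.ball x t \ Metric.ball y t) ≤
      ENNReal.ofReal (1 / 3) * volume (Metric.ball (0 : EE n) t) := by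
    refine (ball_shift hn ht0 x y).trans (mul_le_mul_left (ENNReal.ofReal_le_ofReal ?_) _)
    rw [div_le_iff₀ (by positivity)]
    calc √n * ‖x - y‖ ≤ √n * (tau U h x * h / (6 * √n)) := by gcongr
      _ = tau U h x * h / 6 := by field_simp
      _ ≤ _ := by linarith
  set Z := Metric.ball x t ∩ Metric.ball y t ∩ (W1 ∩ W2) with hZ
  have hmid : ∀ u ∈ Z, u = (1 / 2 : ℝ) • x + (1 / 2 : ℝ) • (x + (2:ℝ) • (u - x)) := fun u _ => by module
  have hconc := tau_concave hUo hUc hh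
  have hZU : Z ⊆ U := fun u hu => by
    rw [hmid u hu]; exact hUc hx hu.2.1 (by norm_num) (by norm_num) (by norm_num)
  refine ⟨Z, (measurableSet_ball.inter measurableSet_ball).inter
    (hW1o.measurableSet.inter hW2o.measurableSet), fun u hu => hu.1.1, fun u hu => hu.1.2,
    hZU, fun u hu => ⟨?_, ?_⟩, ?_⟩
  · have := hconc.2 hx hu.2.1 (show (0:ℝ) ≤ 1 / 2 by norm_num) (show (0:ℝ) ≤ 1 / 2 by norm_num) (by norm_num)
    rw [← hmid u hu] at this
    simp only [smul_eq_mul] at this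
    linarith [tau_nonneg (U := U) (h := h) (x + (2:ℝ) • (u - x))]
  · have := hconc.2 (hZU hu) hu.2.2 (show (0:ℝ) ≤ 2 / 3 by norm_num) (show (0:ℝ) ≤ 1 / 3 by norm_num) (by norm_num)
    rw [show (2 / 3 : ℝ) • u + (1 / 3 : ℝ) • (x + (-2:ℝ) • (u - x)) = x by module] at this
    simp only [smul_eq_mul] at this
    linarith [tau_nonneg (U := U) (h := h) (x + (-2:ℝ) • (u - x))]
  · set V := volume (Metric.ball (0 : EE n) t) with hV
    have hVf : V ≠ ⊤ := measure_ball_lt_top.ne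
    have h4 : V ≤ volume Z + (ENNReal.ofReal (1 / 3) * V + (ENNReal.ofReal (1 / 6) * V + ENNReal.ofReal (1 / 6) * V)) := by
      rw [hV, ← vol_ball_center x]
      calc _ ≤ volume (Z ∪ ((Metric.ball x t \ Metric.ball y t) ∪ ((Metric.ball x t \ W1) ∪ (Metric.ball x t \ W2)))) := by
            refine measure_mono fun u hu => ?_
            simp only [hZ, Set.mem_union, Set.mem_inter_iff, Set.mem_sdiff]
            tauto
        _ ≤ _ := by
            refine (measure_union_le _ _).trans (add_le_add le_rfl ?_)
            refine (measure_union_le _ _).trans (add_le_add ?_ ?_)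
            · rw [vol_ball_center x]; exact h3
            refine (measure_union_le _ _).trans (add_le_add ?_ ?_)
            · rw [vol_ball_center x]; exact h1
            · rw [vol_ball_center x]; exact h2
    have h5 : ENNReal.ofReal (1 / 3) * V + (ENNReal.ofReal (1 / 6) * V + ENNReal.ofReal (1 / 6) * V)
        = ENNReal.ofReal (2 / 3) * V := by
      rw [← add_mul, ← add_mul, ← ENNReal.ofReal_add (by norm_num) (by norm_num),
        ← ENNReal.ofReal_add (by norm_num) (by norm_num)]
      norm_num
    rw [h5] at h4
    have h6 : V = ENNReal.ofReal (1 / 3) * V + ENNReal.ofReal (2 / 3) * V := by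
      rw [← add_mul, ← ENNReal.ofReal_add (by norm_num) (by norm_num)]
      norm_num
    nth_rewrite 1 [h6] at h4
    exact (ENNReal.add_le_add_iff_right (ENNReal.mul_ne_top (by simp) hVf)).1 h4

include hh hUo hUc in
lemma tau_cont : ContinuousOn (tau U h) U := (tau_concave hUo hUc hh).continuousOn hUo

include hh hUo hUc in
lemma tau_open (a : ℝ) : IsOpen {x | x ∈ U ∧ a < tau U h x} :=
  (tau_cont hUo hUc hh).isOpen_inter_preimage hUo isOpen_Ioi

include hh hUo hUc in
lemma tau_meas_le (a : ℝ) : MeasurableSet {x | x ∈ U ∧ tau U h x ≤ a} := by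
  have : {x | x ∈ U ∧ tau U h x ≤ a} = U \ {x | x ∈ U ∧ a < tau U h x} := by
    ext x; simp +contextual [not_lt]
  rw [this]
  exact hUo.measurableSet.diff (tau_open hUo hUc hh a).measurableSet

include hn hUo hUc in
lemma good_vol {r : ℝ} (hr : 0 < r) (hUr : Metric.ball 0 r ⊆ U) (hfin : volume U ≠ ⊤)
    (hh' : h = r / (12 * √n)) :
    volume {x | x ∈ U ∧ tau U h x < 1} ≤ ENNReal.ofReal (1 / 4) * volume U := by
  have hn' : (0:ℝ) < n := by exact_mod_cast hn
  have hN : 0 < √(n:ℝ) := Real.sqrt_pos.2 hn'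
  have hh : 0 < h := by rw [hh']; positivity
  set V := volume (Metric.ball (0 : EE n) h) with hV
  have hVf : V ≠ ⊤ := measure_ball_lt_top.ne
  have hV0 : V ≠ 0 := (Metric.measure_ball_pos volume _ hh).ne'
  have h1 := surf2 hn hUo hUc hr hUr hfin hh
  have hmeas : MeasurableSet {x | x ∈ U ∧ tau U h x < 1} :=
    ((tau_cont hUo hUc hh).isOpen_inter_preimage hUo isOpen_Iio).measurableSet
  have h2 : ENNReal.ofReal (1 / 6) * V * volume {x | x ∈ U ∧ tau U h x < 1} ≤
      ∫⁻ x in U, volume (Metric.ball x h \ U) := by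
    calc _ = ∫⁻ x in {x | x ∈ U ∧ tau U h x < 1}, ENNReal.ofReal (1 / 6) * V := by
          rw [setLIntegral_const]
      _ ≤ ∫⁻ x in {x | x ∈ U ∧ tau U h x < 1}, volume (Metric.ball x h \ U) := by
          refine setLIntegral_mono' hmeas fun x hx => ?_
          by_contra hcon
          push Not at hcon
          have : ENNReal.ofReal (5 / 6) * volume (Metric.ball (0 : EE n) 1) ≤ fr U x h := by
            have h4 := measure_inter_add_sdiff (μ := volume) (Metric.ball x h) hUo.measurableSet
            have h5 : volume (Metric.ball x h) = ENNReal.ofReal (5 / 6) * V + ENNReal.ofReal (1 / 6) * V := by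
              rw [← add_mul, ← ENNReal.ofReal_add (by norm_num) (by norm_num), vol_ball_center x]
              norm_num; rfl
            have h6 : ENNReal.ofReal (5 / 6) * V ≤ volume (Metric.ball x h ∩ U) := by
              refine (ENNReal.add_le_add_iff_right (ENNReal.mul_ne_top (a := ENNReal.ofReal (1 / 6)) (b := V) ENNReal.ofReal_ne_top hVf)).1 ?_
              rw [← h5, ← h4]
              exact add_le_add le_rfl hcon.le
            rw [fr_scale U x hh, hV, vol_ball hn hh 0, mul_left_comm] at h6
            refine (ENNReal.mul_le_mul_iff_right ?_ (by simp)).1 h6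
            simp only [ne_eq, ENNReal.ofReal_eq_zero, not_le]
            positivity
          have h1T : (1:ℝ) ∈ TT U h x := ⟨zero_le_one, le_rfl, by rwa [one_mul]⟩
          have := le_csSup (TT_bdd x) h1T
          exact absurd hx.2 (not_lt.2 this)
      _ ≤ _ := lintegral_mono_set fun x hx => hx.1
  have h3 := h2.trans h1
  have e : h * √n / (2 * r) = 1 / 6 * (1 / 4) := by rw [hh']; field_simp; norm_num
  rw [e, ENNReal.ofReal_mul (by norm_num)] at h3
  have h4 : (ENNReal.ofReal (1 / 6) * V) * volume {x | x ∈ U ∧ tau U h x < 1} ≤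
     (ENNReal.ofReal (1 / 6) * V) * (ENNReal.ofReal (1 / 4) * volume U) := by
    refine h3.trans (le_of_eq ?_)
    ring
  exact (ENNReal.mul_le_mul_iff_right (mul_ne_zero (by simp) hV0) (ENNReal.mul_ne_top (by simp) hVf)).1 h4

end
end HR

end

section
open MeasureTheory ProbabilityTheory
open scoped ENNReal Pointwise

namespace HR

noncomputable def phi {n : ℕ} (U : Set (EE n)) (h d : ℝ) (A : Set (EE n)) (x : EE n) : ℝ :=
  ⨆ a : A, max 0 (1 - ‖x - a‖ / (d * tau U h a))

section
variable {n : ℕ} (hn : 0 < n) {U : Set (EE n)} (hUo : IsOpen U) (hUc : Convex ℝ U) {h d : ℝ} (hh : 0 < h)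
  (hd : 0 < d) {A : Set (EE n)} (hA : A ⊆ U)

include hd in
lemma phi_bdd (x : EE n) : BddAbove (Set.range fun a : A => max 0 (1 - ‖x - a‖ / (d * tau U h a))) := by
  refine ⟨1, ?_⟩
  rintro _ ⟨a, rfl⟩
  have : 0 ≤ ‖x - a‖ / (d * tau U h a) :=
    div_nonneg (norm_nonneg _) (mul_nonneg hd.le (tau_nonneg _))
  exact max_le zero_le_one (by linarith)

lemma phi_nonneg (x : EE n) : 0 ≤ phi U h d A x := Real.iSup_nonneg fun _ => le_max_left _ _

include hd in
lemma phi_le_one (x : EE n) : phi U h d A x ≤ 1 := by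
  refine Real.iSup_le (fun a => ?_) zero_le_one
  have : 0 ≤ ‖x - a‖ / (d * tau U h a) :=
    div_nonneg (norm_nonneg _) (mul_nonneg hd.le (tau_nonneg _))
  exact max_le zero_le_one (by linarith)

include hd in
lemma le_phi (x : EE n) (a : A) : 1 - ‖x - a‖ / (d * tau U h a) ≤ phi U h d A x :=
  (le_max_right _ _).trans (le_ciSup (phi_bdd hd x) a)

include hd in
lemma phi_eq_one {x : EE n} (hx : x ∈ A) : phi U h d A x = 1 := by
  refine le_antisymm (phi_le_one hd x) ?_
  simpa using le_phi (U := U) (h := h) hd x ⟨x, hx⟩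

include hd in
lemma phi_meas : Measurable (phi U h d A) := by
  refine LowerSemicontinuous.measurable ?_
  refine lowerSemicontinuous_ciSup (phi_bdd hd) fun a => ?_
  exact Continuous.lowerSemicontinuous (by fun_prop)

include hh hd hUo hA in
/-- if `phi x > l` there is a witness -/
lemma phi_wit {x : EE n} {l : ℝ} (hl : 0 ≤ l) (hx : l < phi U h d A x) :
    ∃ a ∈ A, l < 1 - ‖x - a‖ / (d * tau U h a) ∧ ‖x - a‖ < d * tau U h a := by
  have hne : Nonempty A := by
    by_contra hc
    rw [not_nonempty_iff] at hc
    simp [phi] at hx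
    linarith
  obtain ⟨a, ha⟩ := exists_lt_of_lt_ciSup hx
  rcases lt_max_iff.1 ha with h1 | h1
  · linarith
  refine ⟨a, a.2, h1, ?_⟩
  have hT := tau_pos hUo hh (hA a.2)
  have : ‖x - a‖ / (d * tau U h a) < 1 := by linarith
  rwa [div_lt_one (by positivity)] at this

include hn hh hd hUo hUc hA in
lemma phi_lip (hdh : d ≤ h / (6 * √n)) {x y : EE n} (hx : x ∈ U) :
    tau U h x * (phi U h d A x - phi U h d A y) ≤ 3 / 2 * ‖x - y‖ / d := by
  have hTx := tau_pos hUo hh hx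
  suffices H : phi U h d A x ≤ phi U h d A y + 3 / 2 * ‖x - y‖ / d / tau U h x by
    have := mul_le_mul_of_nonneg_left H hTx.le
    rw [mul_add, mul_div_cancel₀ _ hTx.ne'] at this
    linarith
  have hrhs : 0 ≤ phi U h d A y + 3 / 2 * ‖x - y‖ / d / tau U h x :=
    add_nonneg (phi_nonneg y) (by positivity)
  refine Real.iSup_le (fun a => max_le hrhs ?_) hrhs
  by_contra hcon
  push Not at hcon
  have hTa := tau_pos hUo hh (hA a.2)
  have h1 : ‖x - a‖ / (d * tau U h a) < 1 := by linarith
  rw [div_lt_one (by positivity)] at h1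
  have hcl := (tau_close hn hUo hUc hh (x := (a : EE n)) (y := x) (hA a.2) (by
    rw [norm_sub_rev]
    refine h1.le.trans ?_
    calc d * tau U h a ≤ h / (6 * √n) * tau U h a := by gcongr
      _ = _ := by ring)).2.2
  have h2 := le_phi (U := U) (h := h) hd y a
  have h3 : ‖y - a‖ / (d * tau U h a) - ‖x - a‖ / (d * tau U h a) ≤ ‖x - y‖ / (d * tau U h a) := by
    rw [← sub_div]
    gcongr
    have := norm_sub_le_norm_sub_add_norm_sub y x (a : EE n)
    rw [norm_sub_rev y x] at this
    linarith
  have h4 : ‖x - y‖ / (d * tau U h a) ≤ 3 / 2 * ‖x - y‖ / d / tau U h x := by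
    rw [div_div, div_le_div_iff₀ (by positivity) (by positivity)]
    have : 0 ≤ ‖x - y‖ * d := by positivity
    nlinarith
  linarith

set_option maxHeartbeats 1000000 in
include hn hh hd hUo hUc hA in
lemma core {A2 : Set (EE n)} (hdh : d = h / (7 * √n)) {R : ℝ} (hR : ∀ x ∈ U, ‖x‖ ≤ R) (hdR : d ≤ R)
    (hsep : ∀ x ∈ A, ∀ y ∈ A2, tau U h x * h / (6 * √n) < ‖x - y‖)
    {t : ℝ} (ht : 0 < t) (htd : t ≤ d / (18 * R)) {x z : EE n} (hx : x ∈ U) (hz : z ∈ U)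
    (hz1 : tau U h z = 1) {y : EE n} (hy : y = (1 - t) • x + t • z) :
    tau U h x * phi U h d A x ≤ phi U h d A y * (tau U h y - t * (1 - tau U h y))
      + 3 * R / d * t * Set.indicator (U \ (A ∪ A2)) 1 y
      + (3 * R / d + 1) * t * Set.indicator {y | y ∈ U ∧ Metric.infDist y Uᶜ ≤ (18 * R * h / d + 2 * R) * t} 1 y := by
  have hn' : (0:ℝ) < n := by exact_mod_cast hn
  have hN : 0 < √(n:ℝ) := Real.sqrt_pos.2 hn'
  have hR0 : 0 < R := hd.trans_le hdR
  have ht1 : t < 1 := by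
    refine htd.trans_lt ?_
    rw [div_lt_one (by positivity)]; linarith
  have hyU : y ∈ U := by rw [hy]; exact hUc hx hz (by linarith) ht.le (by ring)
  have hTx := tau_pos hUo hh hx
  have hTy := tau_pos hUo hh hyU
  have hTy1 := tau_le_one (U := U) (h := h) y
  have hconc : (1 - t) * tau U h x + t ≤ tau U h y := by
    have := (tau_concave hUo hUc hh).2 hx hz (show 0 ≤ 1 - t by linarith) ht.le (by ring)
    rw [← hy, hz1] at this
    simpa using this
  set N := {y | y ∈ U ∧ Metric.infDist y Uᶜ ≤ (18 * R * h / d + 2 * R) * t} with hNdef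
  have hty : t ≤ tau U h y := by nlinarith
  have hxb : tau U h x ≤ tau U h y - t * (1 - tau U h y) := by
    have hx1 := tau_le_one (U := U) (h := h) x
    have e1 := mul_le_mul_of_nonneg_left hconc (show 0 ≤ 1 + t by linarith)
    have e2 := mul_le_mul_of_nonneg_left hx1 (sq_nonneg t)
    nlinarith
  have hφx := phi_nonneg (U := U) (h := h) (d := d) (A := A) x
  have hφy := phi_nonneg (U := U) (h := h) (d := d) (A := A) y
  have hφx1 := phi_le_one (U := U) (h := h) hd (A := A) x
  have hφy1 := phi_le_one (U := U) (h := h) hd (A := A) y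
  have hdist : ‖x - y‖ ≤ 2 * R * t := by
    have : x - y = t • (x - z) := by rw [hy]; module
    rw [this, norm_smul, Real.norm_of_nonneg ht.le]
    have h1 := norm_sub_le x z
    have h2 := hR x hx
    have h3 := hR z hz
    nlinarith
  have hdh' : d ≤ h / (6 * √n) := by rw [hdh]; gcongr; norm_num
  have hΛ : 0 ≤ 3 * R / d * t := by positivity
  have hi1 : (0:ℝ) ≤ Set.indicator (U \ (A ∪ A2)) 1 y := Set.indicator_nonneg (fun _ _ => zero_le_one) _
  have hi2 : (0:ℝ) ≤ Set.indicator N 1 y := Set.indicator_nonneg (fun _ _ => zero_le_one) _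
  have hterm1 : phi U h d A y * tau U h x ≤ phi U h d A y * (tau U h y - t * (1 - tau U h y)) := by gcongr
  have hlip := phi_lip hn hUo hUc hh hd hA hdh' hx (y := y)
  have hlip2 : 3 / 2 * ‖x - y‖ / d ≤ 3 * R / d * t := by
    rw [show 3 * R / d * t = 3 * R * t / d by ring]
    refine div_le_div_of_nonneg_right ?_ hd.le
    linarith
  have hN0 : 0 ≤ (3 * R / d + 1) * t * Set.indicator N 1 y := by positivity
  by_cases hyA : y ∈ A
  · have := phi_eq_one (U := U) (h := h) hd hyA
    rw [this] at hterm1 ⊢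
    have h5 : tau U h x * phi U h d A x ≤ tau U h x := by nlinarith
    have h6 := mul_nonneg hΛ hi1
    linarith
  by_cases hyA2 : y ∈ A2
  · rcases hφx.eq_or_lt with h0 | h0
    · rw [← h0]
      have h6 := mul_nonneg hΛ hi1
      have h7 : 0 ≤ phi U h d A y * (tau U h y - t * (1 - tau U h y)) := by
        refine mul_nonneg hφy (hTx.le.trans hxb)
      linarith
    obtain ⟨a, haA, -, hxa⟩ := phi_wit hUo hh hd hA le_rfl h0
    have hTa := tau_pos hUo hh (hA haA)
    have hs := hsep a haA y hyA2
    have hcl := (tau_close hn hUo hUc hh (x := (a : EE n)) (y := x) (hA haA) (by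
      rw [norm_sub_rev]
      refine hxa.le.trans ?_
      calc d * tau U h a ≤ h / (6 * √n) * tau U h a := by gcongr
        _ = _ := by ring)).2.2
    have hda : tau U h a * h / (6 * √n) = 7 / 6 * d * tau U h a := by
      rw [hdh]; field_simp
    rw [hda] at hs
    have htri := norm_sub_le_norm_sub_add_norm_sub a x y
    rw [norm_sub_rev a x] at htri
    have hta : d * tau U h a < 12 * R * t := by nlinarith
    have htx : tau U h x < 18 * R * t / d := by
      rw [lt_div_iff₀ hd]; nlinarith
    set e := 18 * R * t / d * h with he
    have he0 : 0 ≤ e := by positivity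
    have hnb : ¬ Metric.ball x e ⊆ U := by
      intro hb
      have := tau_ge_of_ball (U := U) hh he0 (by
        rw [he]
        have : 18 * R * t / d ≤ 1 := by
          rw [div_le_one hd]
          rw [le_div_iff₀ (by positivity)] at htd
          linarith
        exact mul_le_of_le_one_left hh.le this) hb hx
      rw [he, mul_div_cancel_right₀ _ hh.ne'] at this
      linarith
    obtain ⟨w, hw, hwU⟩ := Set.not_subset.1 hnb
    have hyN : y ∈ N := by
      refine ⟨hyU, ?_⟩
      refine (Metric.infDist_le_dist_of_mem (show w ∈ Uᶜ from hwU)).trans ?_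
      rw [mem_ball_iff_norm] at hw
      rw [dist_eq_norm]
      have h8 := norm_sub_le_norm_sub_add_norm_sub y x w
      rw [norm_sub_rev y x, norm_sub_rev x w] at h8
      have : (18 * R * h / d + 2 * R) * t = e + 2 * R * t := by rw [he]; ring
      rw [this]; linarith
    rw [Set.indicator_of_mem hyN]
    have h6 := mul_nonneg hΛ hi1
    simp only [Pi.one_apply, mul_one]
    have h9 : tau U h x * phi U h d A x ≤ phi U h d A y * tau U h x + 3 * R / d * t := by
      linarith
    linarith
  · have : y ∈ U \ (A ∪ A2) := ⟨hyU, by simp [hyA, hyA2]⟩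
    rw [Set.indicator_of_mem this]
    simp only [Pi.one_apply, mul_one]
    linarith

end
end HR

end

section
open MeasureTheory ProbabilityTheory
open scoped ENNReal Pointwise

namespace HR

section
variable {n : ℕ} (hn : 0 < n) {U : Set (EE n)} (hUo : IsOpen U) (hUc : Convex ℝ U) {h d : ℝ} (hh : 0 < h)
  (hd : 0 < d) {A : Set (EE n)} (hA : A ⊆ U)

include hh hUo hUc in
lemma tau0_meas : Measurable (U.indicator (tau U h)) := by
  refine measurable_of_Ioi fun a => ?_
  by_cases ha : 0 ≤ a
  · have : U.indicator (tau U h) ⁻¹' Set.Ioi a = {x | x ∈ U ∧ a < tau U h x} := by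
      ext x
      by_cases hx : x ∈ U <;> simp [Set.indicator, hx, ha]
    rw [this]; exact (tau_open hUo hUc hh a).measurableSet
  · have : U.indicator (tau U h) ⁻¹' Set.Ioi a = Set.univ := by
      ext x
      have : 0 ≤ U.indicator (tau U h) x := Set.indicator_nonneg (fun x _ => tau_nonneg x) x
      simp only [Set.mem_preimage, Set.mem_Ioi, Set.mem_univ, iff_true]
      linarith
    rw [this]; exact MeasurableSet.univ

/-- abstract Prekopa–Leindler type consequence -/
lemma layer (hU : MeasurableSet U) {G : Set (EE n)} (hG : MeasurableSet G)
    {f g : EE n → ℝ} (hf : Measurable f) (hg : Measurable g) (hf0 : ∀ x ∈ U, 0 ≤ f x)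
    (hg0 : ∀ x ∈ U, 0 ≤ g x) {t c : ℝ} (ht : 0 < t) (ht1 : t < 1)
    (hfg : ∀ x ∈ U, ∀ z ∈ G, (1 - t) • x + t • z ∈ U ∧ f x ≤ g ((1 - t) • x + t • z))
    (hL : ENNReal.ofReal (Real.exp c) * volume {x | x ∈ U ∧ 0 < f x} ≤ volume G) :
    ENNReal.ofReal (Real.exp (c * t)) * ∫⁻ x in U, ENNReal.ofReal (f x) ≤
      ∫⁻ x in U, ENNReal.ofReal (g x) := by
  have hlev : ∀ l : ℝ, 0 < l → ENNReal.ofReal (Real.exp (c * t)) * volume.restrict U {x | l < f x} ≤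
      volume.restrict U {x | l < g x} := by
    intro l hl
    rw [Measure.restrict_apply' hU, Measure.restrict_apply' hU]
    set L := {x | l < f x} ∩ U with hLdef
    have hLm : MeasurableSet L := (measurableSet_lt measurable_const hf).inter hU
    have h1 := bm (n := n) ht ht1 hLm hG ((measurableSet_lt measurable_const hg).inter hU)
      (C := {x | l < g x} ∩ U) (by
        intro x hx z hz
        obtain ⟨h1, h2⟩ := hfg x hx.2 z hz
        exact ⟨lt_of_lt_of_le hx.1 h2, h1⟩)
    refine le_trans ?_ h1
    have h2 : ENNReal.ofReal (Real.exp c) * volume L ≤ volume G := by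
      refine le_trans ?_ hL
      refine mul_le_mul_right (measure_mono (t := {x | x ∈ U ∧ 0 < f x}) fun x hx => show x ∈ U ∧ 0 < f x from ⟨hx.2, hl.trans hx.1⟩) _
    calc ENNReal.ofReal (Real.exp (c * t)) * volume L
        = volume L ^ (1 - t) * (ENNReal.ofReal (Real.exp c) * volume L) ^ t := by
          rw [ENNReal.mul_rpow_of_nonneg _ _ ht.le, ENNReal.ofReal_rpow_of_pos (Real.exp_pos c),
            ← Real.exp_mul, mul_left_comm, ← ENNReal.rpow_add_of_nonneg _ _ (by linarith) ht.le]
          simp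
      _ ≤ _ := mul_le_mul_right (ENNReal.rpow_le_rpow h2 ht.le) _
  rw [lintegral_eq_lintegral_meas_lt _ ((ae_restrict_iff' hU).2 (ae_of_all _ hf0)) hf.aemeasurable,
    lintegral_eq_lintegral_meas_lt _ ((ae_restrict_iff' hU).2 (ae_of_all _ hg0)) hg.aemeasurable,
    ← lintegral_const_mul' _ _ ENNReal.ofReal_ne_top]
  exact setLIntegral_mono' measurableSet_Ioi fun l hl => hlev l hl

include hn hh hd hUo hUc hA in
lemma isop_t {A2 : Set (EE n)} (hAm : MeasurableSet A) (hA2m : MeasurableSet A2)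
    (hdh : d = h / (7 * √n)) {R : ℝ} (hR : ∀ x ∈ U, ‖x‖ ≤ R) (hdR : d ≤ R) (hfin : volume U ≠ ⊤)
    (hsep : ∀ x ∈ A, ∀ y ∈ A2, tau U h x * h / (6 * √n) < ‖x - y‖)
    {c : ℝ} (hc0 : 0 < c) (hc1 : c ≤ 1)
    (hL : ENNReal.ofReal (Real.exp c) * volume (U \ A2) ≤ volume {x | x ∈ U ∧ tau U h x = 1})
    {t : ℝ} (ht : 0 < t) (htd : t ≤ d / (18 * R)) :
    c * (volume A).toReal ≤ 3 * R / d * (volume (U \ (A ∪ A2))).toReal + (3 * R / d + 1) *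
      (volume {y | y ∈ U ∧ Metric.infDist y Uᶜ ≤ (18 * R * h / d + 2 * R) * t}).toReal := by
  have hn' : (0:ℝ) < n := by exact_mod_cast hn
  have hN : 0 < √(n:ℝ) := Real.sqrt_pos.2 hn'
  have hR0 : 0 < R := hd.trans_le hdR
  have ht1 : t < 1 := by
    refine htd.trans_lt ?_
    rw [div_lt_one (by positivity)]; linarith
  have hUm := hUo.measurableSet
  set N := {y | y ∈ U ∧ Metric.infDist y Uᶜ ≤ (18 * R * h / d + 2 * R) * t} with hNdef
  have hNm : MeasurableSet N := hUm.inter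
    (measurableSet_le (Metric.continuous_infDist_pt _).measurable measurable_const)
  set A3 := U \ (A ∪ A2) with hA3
  have hA3m : MeasurableSet A3 := hUm.diff (hAm.union hA2m)
  set G := {x | x ∈ U ∧ tau U h x = 1} with hG
  have hGm : MeasurableSet G := by
    have : G = U \ {x | x ∈ U ∧ tau U h x < 1} := by
      ext x
      simp only [hG, Set.mem_ofPred_eq, Set.mem_sdiff, not_and, not_lt]
      constructor
      · rintro ⟨h1, h2⟩; exact ⟨h1, fun _ => h2.ge⟩
      · rintro ⟨h1, h2⟩; exact ⟨h1, le_antisymm (tau_le_one x) (h2 h1)⟩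
    rw [this]
    exact hUm.diff ((tau_cont hUo hUc hh).isOpen_inter_preimage hUo isOpen_Iio).measurableSet
  set τ := U.indicator (tau U h) with hτ
  have hτm : Measurable τ := tau0_meas hUo hUc hh
  have hτU : ∀ x ∈ U, τ x = tau U h x := fun x hx => Set.indicator_of_mem hx _
  have hτ0 : ∀ x, 0 ≤ τ x := fun x => Set.indicator_nonneg (fun x _ => tau_nonneg x) x
  have hτ1 : ∀ x, τ x ≤ 1 := fun x => by
    by_cases hx : x ∈ U
    · rw [hτU x hx]; exact tau_le_one x
    · simp [hτ, hx]
  set φ := phi U h d A with hφ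
  have hφm : Measurable φ := phi_meas hd
  have hφ0 : ∀ x, 0 ≤ φ x := phi_nonneg
  have hφ1 : ∀ x, φ x ≤ 1 := phi_le_one hd
  set Λ := 3 * R / d with hΛ
  have hΛ0 : 0 < Λ := by positivity
  set g : EE n → ℝ := fun y => φ y * (τ y - t * (1 - τ y)) + Λ * t * A3.indicator 1 y
    + (Λ + 1) * t * N.indicator 1 y with hg
  set f : EE n → ℝ := fun y => τ y * φ y with hf
  have hi3 : ∀ y, (0:ℝ) ≤ A3.indicator 1 y := fun y => Set.indicator_nonneg (fun _ _ => zero_le_one) _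
  have hiN : ∀ y, (0:ℝ) ≤ N.indicator 1 y := fun y => Set.indicator_nonneg (fun _ _ => zero_le_one) _
  have hi3m : Measurable (A3.indicator (1 : EE n → ℝ)) := measurable_one.indicator hA3m
  have hiNm : Measurable (N.indicator (1 : EE n → ℝ)) := measurable_one.indicator hNm
  have hgm : Measurable g := by fun_prop
  have hfm : Measurable f := by fun_prop
  have hg0 : ∀ y ∈ U, 0 ≤ g y := by
    intro y hy
    have h1 := hi3 y
    have h2 := hiN y
    have h3 := hφ0 y
    have h4 := hφ1 y
    have h5 := hτ0 y
    have h6 := hτ1 y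
    by_cases hty : t ≤ τ y
    · have : 0 ≤ τ y - t * (1 - τ y) := by nlinarith
      simp only [hg]; positivity
    · push Not at hty
      have hyN : y ∈ N := by
        refine ⟨hy, ?_⟩
        have hnb : ¬ Metric.ball y (t * h) ⊆ U := by
          intro hb
          have := tau_ge_of_ball (U := U) hh (d := t * h) (by positivity) (by nlinarith) hb hy
          rw [mul_div_cancel_right₀ _ hh.ne', ← hτU y hy] at this
          linarith
        obtain ⟨w, hw, hwU⟩ := Set.not_subset.1 hnb
        refine (Metric.infDist_le_dist_of_mem (show w ∈ Uᶜ from hwU)).trans ?_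
        rw [Metric.mem_ball, dist_comm] at hw
        refine hw.le.trans ?_
        have h7 : h ≤ 18 * R * h / d := by
          rw [le_div_iff₀ hd]; nlinarith
        nlinarith
      simp only [hg]
      rw [Set.indicator_of_mem hyN]
      simp only [Pi.one_apply, mul_one]
      have h8 : -t ≤ φ y * (τ y - t * (1 - τ y)) := by
        have : -t ≤ τ y - t * (1 - τ y) := by nlinarith
        nlinarith
      have h9 : 0 ≤ Λ * t * A3.indicator 1 y := by positivity
      have h10 : 0 ≤ Λ * t := by positivity
      linarith
  have hlay := layer (U := U) hUm hGm hfm hgm (fun x _ => mul_nonneg (hτ0 x) (hφ0 x)) hg0 ht ht1 (c := c)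
    (by
      intro x hx z hz
      have hyU : (1 - t) • x + t • z ∈ U := hUc hx hz.1 (by linarith) ht.le (by ring)
      refine ⟨hyU, ?_⟩
      have := core hn hUo hUc hh hd hA hdh hR hdR hsep ht htd hx hz.1 hz.2 rfl
      simp only [hf, hg, hτU x hx, hτU _ hyU]
      exact this)
    (by
      refine le_trans (mul_le_mul_right (measure_mono ?_) _) hL
      rintro x ⟨hx, hfx⟩
      refine ⟨hx, fun hx2 => ?_⟩
      have h0 : 0 < φ x := by
        rcases (hφ0 x).eq_or_lt with h0 | h0
        · simp [hf, ← h0] at hfx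
        · exact h0
      obtain ⟨a, haA, -, hxa⟩ := phi_wit hUo hh hd hA le_rfl h0
      have hs := hsep a haA x hx2
      rw [norm_sub_rev] at hs
      have hTa := tau_pos hUo hh (hA haA)
      have : d * tau U h a ≤ tau U h a * h / (6 * √n) := by
        rw [hdh, show tau U h a * h / (6 * √n) = h / (6 * √n) * tau U h a by ring]
        gcongr; norm_num
      linarith)
  set μ := volume.restrict U with hμ
  haveI : IsFiniteMeasure μ := ⟨by rw [hμ, Measure.restrict_apply_univ]; exact hfin.lt_top⟩
  have hqint : ∀ (q : EE n → ℝ), Measurable q → (∃ C, ∀ x, |q x| ≤ C) → Integrable q μ := by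
    rintro q hq ⟨C, hC⟩
    exact Integrable.of_bound hq.aestronglyMeasurable C (ae_of_all _ hC)
  have hφi : Integrable φ μ := hqint _ hφm ⟨1, fun x => by rw [abs_of_nonneg (hφ0 x)]; exact hφ1 x⟩
  have hfi : Integrable f μ := hqint _ hfm ⟨1, fun x => by
    rw [abs_of_nonneg (mul_nonneg (hτ0 x) (hφ0 x))]
    exact mul_le_one₀ (hτ1 x) (hφ0 x) (hφ1 x)⟩
  have h3i : Integrable (A3.indicator (1 : EE n → ℝ)) μ := (integrable_const (1:ℝ)).indicator hA3m
  have hNi : Integrable (N.indicator (1 : EE n → ℝ)) μ := (integrable_const (1:ℝ)).indicator hNm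
  have hgeq : g = fun y => f y - t * (φ y - f y) + Λ * t * A3.indicator 1 y + (Λ + 1) * t * N.indicator 1 y := by
    ext y; simp only [hg, hf]; ring
  have hi0 : Integrable (fun y => f y - t * (φ y - f y)) μ := hfi.sub ((hφi.sub hfi).const_mul t)
  have hi1 : Integrable (fun y => f y - t * (φ y - f y) + Λ * t * A3.indicator 1 y) μ :=
    hi0.add (h3i.const_mul _)
  have hgi : Integrable g μ := by
    rw [hgeq]; exact hi1.add (hNi.const_mul _)
  have hgint : ∫ y, g y ∂μ = (∫ y, f y ∂μ) - t * ((∫ y, φ y ∂μ) - ∫ y, f y ∂μ) + Λ * t * (volume A3).toReal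
      + (Λ + 1) * t * (volume N).toReal := by
    have e3 : ∫ y, A3.indicator (1 : EE n → ℝ) y ∂μ = (volume A3).toReal := by
      rw [integral_indicator_one hA3m, hμ, measureReal_restrict_apply hA3m,
        Set.inter_eq_left.2 (fun x hx => hx.1)]; rfl
    have eN : ∫ y, N.indicator (1 : EE n → ℝ) y ∂μ = (volume N).toReal := by
      rw [integral_indicator_one hNm, hμ, measureReal_restrict_apply hNm,
        Set.inter_eq_left.2 (fun x hx => hx.1)]; rfl
    have hφf : Integrable (fun y => φ y - f y) μ := hφi.sub hfi
    rw [hgeq, integral_add hi1 (hNi.const_mul _), integral_add hi0 (h3i.const_mul _),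
      integral_sub hfi (hφf.const_mul t), integral_const_mul, integral_const_mul,
      integral_const_mul, integral_sub hφi hfi, e3, eN]
  have hmain : Real.exp (c * t) * ∫ y, f y ∂μ ≤ ∫ y, g y ∂μ := by
    rw [← ofReal_integral_eq_lintegral_ofReal hfi (ae_of_all _ fun x => mul_nonneg (hτ0 x) (hφ0 x)),
      ← ofReal_integral_eq_lintegral_ofReal hgi ((ae_restrict_iff' hUm).2 (ae_of_all _ hg0)),
      ← ENNReal.ofReal_mul (Real.exp_pos _).le] at hlay
    refine (ENNReal.ofReal_le_ofReal_iff ?_).1 hlay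
    exact integral_nonneg_of_ae ((ae_restrict_iff' hUm).2 (ae_of_all _ hg0))
  have hf0 : 0 ≤ ∫ y, f y ∂μ := integral_nonneg fun x => mul_nonneg (hτ0 x) (hφ0 x)
  have hfφ : ∫ y, f y ∂μ ≤ ∫ y, φ y ∂μ := by
    refine integral_mono hfi hφi fun x => ?_
    exact mul_le_of_le_one_left (hφ0 x) (hτ1 x)
  have hAφ : (volume A).toReal ≤ ∫ y, φ y ∂μ := by
    have e : ∫ y, A.indicator (1 : EE n → ℝ) y ∂μ = (volume A).toReal := by
      rw [integral_indicator_one hAm, hμ, measureReal_restrict_apply hAm,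
        Set.inter_eq_left.2 hA]; rfl
    rw [← e]
    refine integral_mono ((integrable_const (1:ℝ)).indicator hAm) hφi fun x => ?_
    by_cases hx : x ∈ A
    · simp only [Set.indicator_of_mem hx, hφ, phi_eq_one hd hx]; rfl
    · simp only [Set.indicator_of_notMem hx]; exact hφ0 x
  have hexp : 1 + c * t ≤ Real.exp (c * t) := by linarith [Real.add_one_le_exp (c * t)]
  set If := ∫ y, f y ∂μ
  set Iφ := ∫ y, φ y ∂μ
  rw [hgint] at hmain
  have h1 : (1 + c * t) * If ≤ Real.exp (c * t) * If := by gcongr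
  have h2 : t * (c * If + (Iφ - If)) ≤ t * (Λ * (volume A3).toReal + (Λ + 1) * (volume N).toReal) := by
    linarith
  have h3 := le_of_mul_le_mul_left h2 ht
  have h4 : c * Iφ ≤ c * If + (Iφ - If) := by nlinarith
  have h5 : c * (volume A).toReal ≤ c * Iφ := by gcongr
  linarith

include hn hh hd hUo hUc hA in
lemma isop {A2 : Set (EE n)} (hAm : MeasurableSet A) (hA2m : MeasurableSet A2)
    (hdh : d = h / (7 * √n)) {R : ℝ} (hR : ∀ x ∈ U, ‖x‖ ≤ R) (hdR : d ≤ R) (hfin : volume U ≠ ⊤)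
    (hsep : ∀ x ∈ A, ∀ y ∈ A2, tau U h x * h / (6 * √n) < ‖x - y‖)
    {c : ℝ} (hc0 : 0 < c) (hc1 : c ≤ 1)
    (hL : ENNReal.ofReal (Real.exp c) * volume (U \ A2) ≤ volume {x | x ∈ U ∧ tau U h x = 1}) :
    c * (volume A).toReal ≤ 3 * R / d * (volume (U \ (A ∪ A2))).toReal := by
  have hR0 : 0 < R := hd.trans_le hdR
  set C := 18 * R * h / d + 2 * R with hC
  have hC0 : 0 < C := by positivity
  set Nk : ℕ → Set (EE n) := fun k => {y | y ∈ U ∧ Metric.infDist y Uᶜ ≤ C * (1 / ((k:ℝ) + 1))} with hNk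
  have hUne : (Uᶜ).Nonempty := by
    haveI : NeZero n := ⟨hn.ne'⟩
    refine ⟨EuclideanSpace.single 0 (R + 1), fun hc => ?_⟩
    have := hR _ hc
    rw [EuclideanSpace.norm_single, Real.norm_of_nonneg (by linarith)] at this
    linarith
  have hNkm : ∀ k, MeasurableSet (Nk k) := fun k => hUo.measurableSet.inter
    (measurableSet_le (Metric.continuous_infDist_pt _).measurable measurable_const)
  have htend : Filter.Tendsto (fun k => volume (Nk k)) Filter.atTop (nhds 0) := by
    have hemp : (⋂ k, Nk k) = ∅ := by
      rw [Set.eq_empty_iff_forall_notMem]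
      intro y hy
      rw [Set.mem_iInter] at hy
      have hyU := (hy 0).1
      have hle : Metric.infDist y Uᶜ ≤ 0 := by
        refine ge_of_tendsto (f := fun k : ℕ => C * (1 / ((k:ℝ) + 1))) (x := Filter.atTop) ?_ ?_
        · have := (tendsto_one_div_add_atTop_nhds_zero_nat (𝕜 := ℝ)).const_mul C
          simpa using this
        · exact Filter.Eventually.of_forall fun k => (hy k).2
      have h0 : Metric.infDist y Uᶜ = 0 := le_antisymm hle Metric.infDist_nonneg
      exact ((hUo.isClosed_compl).mem_iff_infDist_zero hUne).2 h0 hyU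
    have := tendsto_measure_iInter_atTop (μ := volume) (s := Nk) (fun k => (hNkm k).nullMeasurableSet) (by
      intro i j hij y hy
      refine ⟨hy.1, hy.2.trans ?_⟩
      have : (i:ℝ) ≤ j := by exact_mod_cast hij
      gcongr) ⟨0, ne_top_of_le_ne_top hfin (measure_mono fun y hy => hy.1)⟩
    rw [hemp, measure_empty] at this
    exact this
  have htend2 : Filter.Tendsto (fun k => 3 * R / d * (volume (U \ (A ∪ A2))).toReal + (3 * R / d + 1) *
      (volume (Nk k)).toReal) Filter.atTop (nhds (3 * R / d * (volume (U \ (A ∪ A2))).toReal + (3 * R / d + 1) * 0)) := by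
    refine Filter.Tendsto.const_add _ (Filter.Tendsto.const_mul _ ?_)
    have := (ENNReal.tendsto_toReal ENNReal.zero_ne_top).comp htend
    rw [ENNReal.toReal_zero] at this
    exact this
  rw [mul_zero, add_zero] at htend2
  refine ge_of_tendsto htend2 ?_
  have hev : ∀ᶠ k : ℕ in Filter.atTop, 1 / ((k:ℝ) + 1) < d / (18 * R) :=
    (tendsto_one_div_add_atTop_nhds_zero_nat (𝕜 := ℝ)).eventually (gt_mem_nhds (by positivity))
  filter_upwards [hev] with k hk
  exact isop_t hn hUo hUc hh hd hA hAm hA2m hdh hR hdR hfin hsep hc0 hc1 hL (by positivity) hk.le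

end
end HR

end

section
open MeasureTheory ProbabilityTheory
open scoped ENNReal Pointwise

namespace HR

/-- dyadic layers of `tau` -/
def Rj {n : ℕ} (U : Set (EE n)) (h : ℝ) (j : ℕ) : Set (EE n) :=
  {x | x ∈ U ∧ (1 / 2 : ℝ) ^ (j + 2) < tau U h x ∧ tau U h x ≤ 2 * (1 / 2 : ℝ) ^ j}

noncomputable def tj (h : ℝ) (j : ℕ) : ℝ := (1 / 2 : ℝ) ^ (j + 2) * h

open Classical in
noncomputable def kj {n : ℕ} (U : Set (EE n)) (h : ℝ) (j : ℕ) (x y : EE n) : ℝ≥0∞ :=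
  if x ∈ Rj U h j ∧ y ∈ Rj U h j ∧ ‖x - y‖ < tj h j then (volume (Metric.ball (0 : EE n) (tj h j)))⁻¹ else 0

noncomputable def kk {n : ℕ} (U : Set (EE n)) (h : ℝ) (x y : EE n) : ℝ≥0∞ := ∑' j, kj U h j x y

section
variable {n : ℕ} (hn : 0 < n) {U : Set (EE n)} (hUo : IsOpen U) (hUc : Convex ℝ U) {h : ℝ} (hh : 0 < h)

lemma kj_symm (j : ℕ) (x y : EE n) : kj U h j x y = kj U h j y x := by
  unfold kj
  rw [norm_sub_rev]
  congr 1
  simp only [eq_iff_iff]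
  tauto

lemma kk_symm (x y : EE n) : kk U h x y = kk U h y x := by
  unfold kk
  exact tsum_congr fun j => kj_symm j x y

include hUo hUc hh in
lemma Rj_meas (j : ℕ) : MeasurableSet (Rj U h j) := by
  have : Rj U h j = {x | x ∈ U ∧ (1 / 2 : ℝ) ^ (j + 2) < tau U h x} ∩ {x | x ∈ U ∧ tau U h x ≤ 2 * (1 / 2 : ℝ) ^ j} := by
    ext x; simp only [Rj, Set.mem_ofPred_eq, Set.mem_inter_iff]; tauto
  rw [this]
  exact (tau_open hUo hUc hh _).measurableSet.inter (tau_meas_le hUo hUc hh _)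

include hUo hUc hh in
lemma kj_meas (j : ℕ) : Measurable (Function.uncurry (kj U h j)) := by
  have : Function.uncurry (kj U h j) = Set.indicator ((Rj U h j ×ˢ Rj U h j) ∩ {p : EE n × EE n | ‖p.1 - p.2‖ < tj h j})
      (fun _ => (volume (Metric.ball (0 : EE n) (tj h j)))⁻¹) := by
    ext ⟨x, y⟩
    change kj U h j x y = _
    unfold kj
    split_ifs with hx
    · rw [Set.indicator_of_mem]
      exact ⟨⟨hx.1, hx.2.1⟩, hx.2.2⟩
    · rw [Set.indicator_of_notMem]
      exact fun hc => hx ⟨hc.1.1, hc.1.2, hc.2⟩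
  rw [this]
  refine measurable_const.indicator (((Rj_meas hUo hUc hh j).prod (Rj_meas hUo hUc hh j)).inter ?_)
  exact measurableSet_lt (by fun_prop) measurable_const

include hUo hUc hh in
lemma kk_meas : Measurable (Function.uncurry (kk U h)) := by
  have : Function.uncurry (kk U h) = fun p => ∑' j, Function.uncurry (kj U h j) p := by
    ext ⟨x, y⟩; rfl
  rw [this]
  exact Measurable.ennreal_tsum fun j => kj_meas hUo hUc hh j

include hh in
lemma tj_pos (j : ℕ) : 0 < tj h j := by unfold tj; positivity

include hh in
lemma V_pos (j : ℕ) : volume (Metric.ball (0 : EE n) (tj h j)) ≠ 0 := (Metric.measure_ball_pos _ _ (tj_pos hh j)).ne'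

lemma V_fin (j : ℕ) : volume (Metric.ball (0 : EE n) (tj h j)) ≠ ⊤ := measure_ball_lt_top.ne

open Classical in
include hUo hUc hh in
lemma kj_int (j : ℕ) (x : EE n) : ∫⁻ y, kj U h j x y ≤ if x ∈ Rj U h j then 1 else 0 := by
  split_ifs with hx
  · calc ∫⁻ y, kj U h j x y ≤ ∫⁻ y, (Metric.ball x (tj h j)).indicator
          (fun _ => (volume (Metric.ball (0 : EE n) (tj h j)))⁻¹) y := by
          refine lintegral_mono fun y => ?_
          unfold kj
          split_ifs with h1
          · rw [Set.indicator_of_mem]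
            rw [Metric.mem_ball, dist_eq_norm, norm_sub_rev]; exact h1.2.2
          · exact zero_le
      _ = 1 := by
          rw [lintegral_indicator_const measurableSet_ball, vol_ball_center x]
          exact ENNReal.inv_mul_cancel (V_pos hh j) (V_fin j)
  · have : ∀ y, kj U h j x y = 0 := fun y => by
      unfold kj; rw [if_neg]; tauto
    simp [this]

open Classical in
lemma Rj_count (x : EE n) : ∑' j, (if x ∈ Rj U h j then (1:ℝ≥0∞) else 0) ≤ 3 := by
  by_cases hex : ∃ j, x ∈ Rj U h j
  · set j0 := Nat.find hex with hj0
    have h0 : x ∈ Rj U h j0 := Nat.find_spec hex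
    rw [tsum_eq_sum (s := Finset.Ico j0 (j0 + 3))]
    · refine (Finset.sum_le_card_nsmul _ _ 1 fun j _ => ?_).trans ?_
      · split_ifs <;> simp
      · simp
    · intro j hj
      rw [if_neg]
      intro hxj
      rw [Finset.mem_Ico] at hj
      have h1 : j0 ≤ j := Nat.find_min' hex hxj
      have h2 : j0 + 3 ≤ j := by omega
      have h3 := h0.2.1
      have h4 := hxj.2.2
      have h5 : (1 / 2 : ℝ) ^ j ≤ (1 / 2 : ℝ) ^ (j0 + 3) := pow_le_pow_of_le_one (by norm_num) (by norm_num) h2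
      rw [pow_succ] at h5
      rw [show j0 + 3 = (j0 + 2) + 1 from rfl] at *
      linarith
  · push Not at hex
    simp [hex]

include hUo hUc hh in
lemma kk_int (x : EE n) : ∫⁻ y, kk U h x y ≤ 3 := by
  classical
  unfold kk
  have hm : ∀ j, AEMeasurable (fun y => kj U h j x y) := fun j =>
    ((kj_meas hUo hUc hh j).comp (measurable_prodMk_left (x := x))).aemeasurable
  rw [lintegral_tsum hm]
  exact (ENNReal.tsum_le_tsum fun j => kj_int hUo hUc hh j x).trans (Rj_count x)

include hn hUo hUc hh in
lemma sep {A : Set (EE n)} (hA : MeasurableSet A) {x y : EE n} (hx : x ∈ U)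
    (h1 : ∫⁻ z in U \ A, kk U h x z < ENNReal.ofReal (1 / 6))
    (h2 : ∫⁻ z in U ∩ A, kk U h y z < ENNReal.ofReal (1 / 6)) :
    tau U h x * h / (6 * √n) < ‖x - y‖ := by
  by_contra! hc
  obtain ⟨j, hj1, hj2⟩ : ∃ j : ℕ, (1 / 2 : ℝ) ^ (j + 1) < tau U h x ∧ tau U h x ≤ (1 / 2 : ℝ) ^ j :=
    exists_nat_pow_near_of_lt_one (tau_pos hUo hh hx) (tau_le_one x) (by norm_num) (by norm_num)
  have hp : (0:ℝ) < (1 / 2) ^ j := by positivity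
  have e1 : (1 / 2 : ℝ) ^ (j + 1) = (1 / 2) ^ j / 2 := by rw [pow_succ]; ring
  have e2 : (1 / 2 : ℝ) ^ (j + 2) = (1 / 2) ^ j / 4 := by rw [pow_add]; ring
  rw [e1] at hj1
  have et : tj h j = (1 / 2) ^ j / 4 * h := by rw [tj, e2]
  obtain ⟨Z, hZm, hZx, hZy, hZU, hZτ, hZv⟩ := overlap hn hUo hUc hh hx hc (t := tj h j)
    (by rw [et]; nlinarith) (by rw [et]; nlinarith)
  obtain ⟨hyU, hy1, hy2⟩ := tau_close hn hUo hUc hh hx hc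
  have hxR : x ∈ Rj U h j := ⟨hx, by rw [e2]; linarith, by linarith⟩
  have hyR : y ∈ Rj U h j := ⟨hyU, by rw [e2]; linarith, by linarith⟩
  have hZR : ∀ z ∈ Z, z ∈ Rj U h j := fun z hz => by
    obtain ⟨a, b⟩ := hZτ z hz
    exact ⟨hZU hz, by rw [e2]; linarith, by linarith⟩
  set V := volume (Metric.ball (0 : EE n) (tj h j)) with hV
  have kx : ∀ z ∈ Z, V⁻¹ ≤ kk U h x z := fun z hz => by
    refine le_trans ?_ (ENNReal.le_tsum j)
    have := hZx hz
    rw [Metric.mem_ball, dist_eq_norm, norm_sub_rev] at this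
    rw [kj, if_pos ⟨hxR, hZR z hz, this⟩]
  have ky : ∀ z ∈ Z, V⁻¹ ≤ kk U h y z := fun z hz => by
    refine le_trans ?_ (ENNReal.le_tsum j)
    have := hZy hz
    rw [Metric.mem_ball, dist_eq_norm, norm_sub_rev] at this
    rw [kj, if_pos ⟨hyR, hZR z hz, this⟩]
  have b1 : V⁻¹ * volume (Z \ A) ≤ ∫⁻ z in U \ A, kk U h x z := by
    rw [← setLIntegral_const]
    refine (setLIntegral_mono' (hZm.diff hA) fun z hz => kx z hz.1).trans ?_
    exact lintegral_mono_set (Set.diff_subset_diff_left hZU)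
  have b2 : V⁻¹ * volume (Z ∩ A) ≤ ∫⁻ z in U ∩ A, kk U h y z := by
    rw [← setLIntegral_const]
    refine (setLIntegral_mono' (hZm.inter hA) fun z hz => ky z hz.1).trans ?_
    exact lintegral_mono_set (Set.inter_subset_inter_left _ hZU)
  have b3 : ENNReal.ofReal (1 / 3) ≤ V⁻¹ * volume Z := by
    calc ENNReal.ofReal (1 / 3) = V⁻¹ * (ENNReal.ofReal (1 / 3) * V) := by
          rw [mul_left_comm, ENNReal.inv_mul_cancel (V_pos hh j) (V_fin j), mul_one]
      _ ≤ _ := by gcongr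
  rw [← measure_inter_add_sdiff Z hA, mul_add] at b3
  have : ENNReal.ofReal (1 / 3) < ENNReal.ofReal (1 / 6) + ENNReal.ofReal (1 / 6) :=
    b3.trans_lt (ENNReal.add_lt_add (b2.trans_lt h2) (b1.trans_lt h1))
  rw [← ENNReal.ofReal_add (by norm_num) (by norm_num)] at this
  norm_num at this

include hn hUo hUc in
lemma conductance {r R : ℝ} (hr : 0 < r) (hrR : r ≤ R) (hUr : Metric.ball 0 r ⊆ U)
    (hR : ∀ x ∈ U, ‖x‖ ≤ R) (hfin : volume U ≠ ⊤) (hh' : h = r / (12 * √n))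
    {A : Set (EE n)} (hA : MeasurableSet A)
    (hle : volume.restrict U A ≤ volume.restrict U Aᶜ) :
    ENNReal.ofReal (r / (n * R) / 10 ^ 4) * volume.restrict U A ≤
      ∫⁻ x in A, ∫⁻ y in Aᶜ, kk U h x y ∂(volume.restrict U) ∂(volume.restrict U) := by
  have hN : (0:ℝ) < n := by exact_mod_cast hn
  have hN1 : (1:ℝ) ≤ n := by exact_mod_cast hn
  have hR0 : 0 < R := hr.trans_le hrR
  have hsN : 0 < √(n:ℝ) := Real.sqrt_pos.2 hN
  have hh : 0 < h := by rw [hh']; positivity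
  have hUm : MeasurableSet U := hUo.measurableSet
  have eA : volume.restrict U A = volume (U ∩ A) := by rw [Measure.restrict_apply hA, Set.inter_comm]
  have eAc : volume.restrict U Aᶜ = volume (U \ A) := by
    rw [Measure.restrict_apply hA.compl, Set.inter_comm]; rfl
  have rA : (volume.restrict U).restrict A = volume.restrict (U ∩ A) := by
    rw [Measure.restrict_restrict hA, Set.inter_comm]
  have rAc : (volume.restrict U).restrict Aᶜ = volume.restrict (U \ A) := by
    rw [Measure.restrict_restrict hA.compl, Set.inter_comm]; rfl
  rw [rA, rAc, eA]
  rw [eA, eAc] at hle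
  by_contra! hlt
  set Q := ∫⁻ x in U ∩ A, ∫⁻ y in U \ A, kk U h x y with hQ
  have km := kk_meas hUo hUc hh
  have hq1 : Measurable fun x => ∫⁻ y in U \ A, kk U h x y := km.lintegral_prod_right
  have hq2 : Measurable fun x => ∫⁻ y in U ∩ A, kk U h x y := km.lintegral_prod_right
  have hQ2 : ∫⁻ x in U \ A, ∫⁻ y in U ∩ A, kk U h x y = Q := by
    rw [lintegral_lintegral_swap km.aemeasurable]
    rw [hQ]
    refine lintegral_congr fun x => lintegral_congr fun y => kk_symm _ _
  set A1 := {x | x ∈ U ∩ A ∧ ∫⁻ y in U \ A, kk U h x y < ENNReal.ofReal (1 / 6)} with hA1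
  set A2 := {x | x ∈ U \ A ∧ ∫⁻ y in U ∩ A, kk U h x y < ENNReal.ofReal (1 / 6)} with hA2
  have hA1m : MeasurableSet A1 := (hUm.inter hA).inter (measurableSet_lt hq1 measurable_const)
  have hA2m : MeasurableSet A2 := (hUm.diff hA).inter (measurableSet_lt hq2 measurable_const)
  have m1 : ENNReal.ofReal (1 / 6) * volume ((U ∩ A) \ A1) ≤ Q := by
    rw [← setLIntegral_const, hQ]
    refine (setLIntegral_mono' ((hUm.inter hA).diff hA1m) fun x hx => ?_).trans
      (lintegral_mono_set Set.diff_subset)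
    by_contra! hc
    exact hx.2 ⟨hx.1, hc⟩
  have m2 : ENNReal.ofReal (1 / 6) * volume ((U \ A) \ A2) ≤ Q := by
    rw [← setLIntegral_const, ← hQ2]
    refine (setLIntegral_mono' ((hUm.diff hA).diff hA2m) fun x hx => ?_).trans
      (lintegral_mono_set Set.diff_subset)
    by_contra! hc
    exact hx.2 ⟨hx.1, hc⟩
  have fin : ∀ {B : Set (EE n)}, B ⊆ U → volume B ≠ ⊤ := fun hB => ne_top_of_le_ne_top hfin (measure_mono hB)
  set α := (volume (U ∩ A)).toReal with hα
  set u := (volume U).toReal with hu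
  set q := Q.toReal with hq
  set a1 := (volume A1).toReal with ha1
  set b1 := (volume ((U ∩ A) \ A1)).toReal with hb1
  set b2 := (volume ((U \ A) \ A2)).toReal with hb2
  have hsA1 : A1 ⊆ U ∩ A := fun x hx => hx.1
  have hsA2 : A2 ⊆ U \ A := fun x hx => hx.1
  have hQfin : Q ≠ ⊤ := ne_top_of_lt hlt
  have sum1 : a1 + b1 = α := by
    rw [ha1, hb1, hα, ← ENNReal.toReal_add (fin fun x hx => hx.1.1) (fin fun x hx => hx.1.1), ← measure_inter_add_sdiff (U ∩ A) hA1m,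
      Set.inter_eq_right.2 hsA1]
  have sum2 : α + (volume (U \ A)).toReal = u := by
    rw [hα, hu, ← ENNReal.toReal_add (fin fun x hx => hx.1) (fin fun x hx => hx.1), measure_inter_add_sdiff U hA]
  have hle' : α ≤ (volume (U \ A)).toReal := ENNReal.toReal_mono (fin fun x hx => hx.1) hle
  have m1' : 1 / 6 * b1 ≤ q := by
    have := ENNReal.toReal_mono hQfin m1
    rwa [ENNReal.toReal_mul, ENNReal.toReal_ofReal (by norm_num)] at this
  have m2' : 1 / 6 * b2 ≤ q := by
    have := ENNReal.toReal_mono hQfin m2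
    rwa [ENNReal.toReal_mul, ENNReal.toReal_ofReal (by norm_num)] at this
  set X := r / (n * R) with hX
  have hX0 : 0 < X := by positivity
  have hX1 : X ≤ 1 := by
    rw [hX, div_le_one (by positivity)]; nlinarith
  have hq' : q < X / 10 ^ 4 * α := by
    have := (ENNReal.toReal_lt_toReal hQfin (ne_top_of_lt hlt |> fun _ => ENNReal.mul_ne_top ENNReal.ofReal_ne_top (fin fun x hx => hx.1))).2 hlt
    rwa [ENNReal.toReal_mul, ENNReal.toReal_ofReal (by positivity)] at this
  have hα0 : 0 ≤ α := ENNReal.toReal_nonneg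
  have hq'' : q ≤ 1 / 10 ^ 4 * α := by nlinarith
  have hUA2 : (volume (U \ A2)).toReal ≤ α + b2 := by
    rw [hα, hb2, ← ENNReal.toReal_add (fin fun x hx => hx.1) (fin fun x hx => hx.1.1)]
    refine ENNReal.toReal_mono (ENNReal.add_ne_top.2 ⟨fin fun x hx => hx.1, fin fun x hx => hx.1.1⟩) ?_
    refine (measure_mono ?_).trans (measure_union_le _ _)
    intro x hx
    by_cases hxA : x ∈ A
    · exact Or.inl ⟨hx.1, hxA⟩
    · exact Or.inr ⟨⟨hx.1, hxA⟩, hx.2⟩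
  have hA3 : (volume (U \ (A1 ∪ A2))).toReal ≤ b1 + b2 := by
    rw [hb1, hb2, ← ENNReal.toReal_add (fin fun x hx => hx.1.1) (fin fun x hx => hx.1.1)]
    refine ENNReal.toReal_mono (ENNReal.add_ne_top.2 ⟨fin fun x hx => hx.1.1, fin fun x hx => hx.1.1⟩) ?_
    refine (measure_mono ?_).trans (measure_union_le _ _)
    intro x hx
    by_cases hxA : x ∈ A
    · exact Or.inl ⟨⟨hx.1, hxA⟩, fun h => hx.2 (Or.inl h)⟩
    · exact Or.inr ⟨⟨hx.1, hxA⟩, fun h => hx.2 (Or.inr h)⟩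
  have hG : 3 / 4 * u ≤ (volume {x | x ∈ U ∧ tau U h x = 1}).toReal := by
    have h1 := good_vol hn hUo hUc hr hUr hfin hh'
    have h2 := ENNReal.toReal_mono (ENNReal.mul_ne_top ENNReal.ofReal_ne_top hfin) h1
    rw [ENNReal.toReal_mul, ENNReal.toReal_ofReal (by norm_num)] at h2
    have h3 : u ≤ (volume {x | x ∈ U ∧ tau U h x = 1}).toReal + (volume {x | x ∈ U ∧ tau U h x < 1}).toReal := by
      rw [hu, ← ENNReal.toReal_add (fin fun x hx => hx.1) (fin fun x hx => hx.1)]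
      refine ENNReal.toReal_mono (ENNReal.add_ne_top.2 ⟨fin fun x hx => hx.1, fin fun x hx => hx.1⟩) ?_
      refine (measure_mono ?_).trans (measure_union_le _ _)
      intro x hx
      rcases (tau_le_one (U := U) (h := h) x).lt_or_eq with h4 | h4
      · exact Or.inr ⟨hx, h4⟩
      · exact Or.inl ⟨hx, h4⟩
    linarith
  set d := h / (7 * √n) with hd
  have hd0 : 0 < d := by positivity
  have hdv : d = r / (84 * n) := by
    rw [hd, hh', div_div]
    congr 1
    have := Real.mul_self_sqrt hN.le
    linear_combination 84 * this
  have hdR : d ≤ R := by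
    rw [hdv, div_le_iff₀ (by positivity)]; nlinarith
  have hexp : Real.exp (1 / 3) ≤ 1.4 := by
    have h1 : Real.exp (1 / 3) ^ 3 ≤ 1.4 ^ 3 := by
      rw [← Real.exp_nat_mul]
      have := Real.exp_one_lt_d9
      norm_num at this ⊢
      linarith
    exact le_of_pow_le_pow_left₀ (by norm_num) (by norm_num) h1
  have hu0 : 0 ≤ u := ENNReal.toReal_nonneg
  have hL : ENNReal.ofReal (Real.exp (1 / 3)) * volume (U \ A2) ≤ volume {x | x ∈ U ∧ tau U h x = 1} := by
    rw [← ENNReal.toReal_le_toReal (ENNReal.mul_ne_top ENNReal.ofReal_ne_top (fin fun x hx => hx.1)) (fin fun x hx => hx.1),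
      ENNReal.toReal_mul, ENNReal.toReal_ofReal (Real.exp_pos _).le]
    refine le_trans ?_ hG
    calc Real.exp (1 / 3) * (volume (U \ A2)).toReal ≤ 1.4 * (α + b2) := by gcongr
      _ ≤ 3 / 4 * u := by linarith
  have key := isop hn hUo hUc hh hd0 (A := A1) (fun x hx => hx.1.1) hA1m hA2m hd hR hdR hfin
    (fun x hx y hy => sep hn hUo hUc hh hA hx.1.1 hx.2 hy.2) (c := 1 / 3) (by norm_num) (by norm_num) hL
  have e : 3 * R / d = 252 / X := by
    rw [hdv, hX]; field_simp; ring
  rw [e] at key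
  have k2 : 252 / X * (volume (U \ (A1 ∪ A2))).toReal ≤ 252 / X * (12 * (X / 10 ^ 4 * α)) := by
    gcongr; linarith
  have k3 : 252 / X * (12 * (X / 10 ^ 4 * α)) = 3024 / 10 ^ 4 * α := by field_simp; ring
  have hαpos : 0 < α := by
    by_contra! hc
    have : α = 0 := le_antisymm hc hα0
    rw [this, mul_zero] at hq'
    exact absurd hq' (not_lt.2 ENNReal.toReal_nonneg)
  linarith
end
end HR

end

section
open MeasureTheory ProbabilityTheory
open scoped ENNReal Pointwise

namespace HR

/-- line integral -/
noncomputable def JJ {n : ℕ} (G : EE n → ℝ≥0∞) (x w : EE n) : ℝ≥0∞ := ∫⁻ s : ℝ, G (x + s • w)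

/-- chord average -/
noncomputable def mE {n : ℕ} (U : Set (EE n)) (F : EE n → ℝ≥0∞) (x w : EE n) : ℝ≥0∞ :=
  JJ (U.indicator F) x w / JJ (U.indicator 1) x w

lemma JJ_meas {n : ℕ} {G : EE n → ℝ≥0∞} (hG : Measurable G) :
    Measurable (fun p : EE n × EE n => JJ G p.1 p.2) := by
  unfold JJ
  have : Measurable (fun q : (EE n × EE n) × ℝ => G (q.1.1 + q.2 • q.1.2)) := hG.comp (by fun_prop)
  exact this.lintegral_prod_right'

lemma JJ_shift {n : ℕ} (G : EE n → ℝ≥0∞) (x w : EE n) (t : ℝ) : JJ G (x + t • w) w = JJ G x w := by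
  unfold JJ
  rw [← lintegral_add_left_eq_self (fun s : ℝ => G (x + s • w)) t]
  refine lintegral_congr fun s => ?_
  rw [add_smul, add_assoc]

lemma JJ_scale {n : ℕ} {G : EE n → ℝ≥0∞} (hG : Measurable G) (x w : EE n) {c : ℝ} (hc : c ≠ 0) :
    JJ G x (c • w) = ENNReal.ofReal |c⁻¹| * JJ G x w := by
  unfold JJ
  have hm : Measurable (fun s : ℝ => G (x + s • w)) := hG.comp (by fun_prop)
  have := lintegral_map (μ := volume) hm (measurable_mul_const c)
  rw [Real.map_volume_mul_right hc, lintegral_smul_measure, smul_eq_mul] at this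
  rw [this]
  refine lintegral_congr fun s => ?_
  rw [smul_smul]

section
variable {n : ℕ} {U : Set (EE n)} (hUo : IsOpen U)

include hUo in
lemma ind1_meas : Measurable (U.indicator (1 : EE n → ℝ≥0∞)) := measurable_one.indicator hUo.measurableSet

include hUo in
lemma mE_meas {F : EE n → ℝ≥0∞} (hF : Measurable F) : Measurable (fun p : EE n × EE n => mE U F p.1 p.2) :=
  (JJ_meas (hF.indicator hUo.measurableSet)).div (JJ_meas (ind1_meas hUo))

lemma mE_shift (F : EE n → ℝ≥0∞) (x w : EE n) (t : ℝ) : mE U F (x + t • w) w = mE U F x w := by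
  unfold mE; rw [JJ_shift, JJ_shift]

include hUo in
lemma mE_scale {F : EE n → ℝ≥0∞} (hF : Measurable F) (x w : EE n) {c : ℝ} (hc : c ≠ 0) :
    mE U F x (c • w) = mE U F x w := by
  unfold mE
  rw [JJ_scale (hF.indicator hUo.measurableSet) x w hc, JJ_scale (ind1_meas hUo) x w hc]
  refine ENNReal.mul_div_mul_left _ _ ?_ ENNReal.ofReal_ne_top
  simpa using hc

lemma LL_eq (hUo : IsOpen U) (x w : EE n) : JJ (U.indicator 1) x w = volume {s : ℝ | x + s • w ∈ U} := by
  unfold JJ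
  have ho : IsOpen {s : ℝ | x + s • w ∈ U} := hUo.preimage (by fun_prop)
  rw [← lintegral_indicator_one ho.measurableSet]
  rfl

include hUo in
lemma LL_pos {x : EE n} (hx : x ∈ U) (w : EE n) : JJ (U.indicator 1) x w ≠ 0 := by
  rw [LL_eq hUo]
  have ho : IsOpen {s : ℝ | x + s • w ∈ U} := hUo.preimage (by fun_prop)
  exact (ho.measure_pos volume ⟨0, by simpa using hx⟩).ne'

include hUo in
lemma LL_fin {R : ℝ} (hR : ∀ x ∈ U, ‖x‖ ≤ R) (x : EE n) {w : EE n} (hw : w ≠ 0) :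
    JJ (U.indicator 1) x w ≠ ⊤ := by
  rw [LL_eq hUo]
  refine ne_top_of_le_ne_top (measure_closedBall_lt_top (x := (0:ℝ)) (r := (R + ‖x‖) / ‖w‖)).ne (measure_mono ?_)
  intro s hs
  have h1 := hR _ hs
  rw [mem_closedBall_zero_iff, le_div_iff₀ (norm_pos_iff.2 hw), ← norm_smul]
  calc ‖s • w‖ = ‖(x + s • w) - x‖ := by congr 1; abel
    _ ≤ ‖x + s • w‖ + ‖x‖ := norm_sub_le _ _
    _ ≤ _ := by linarith

lemma mE_le {F : EE n → ℝ≥0∞} {M : ℝ≥0∞} (hM : ∀ x, F x ≤ M) (x w : EE n) (hUo : IsOpen U) : mE U F x w ≤ M := by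
  unfold mE
  refine ENNReal.div_le_of_le_mul ?_
  unfold JJ
  have hm : Measurable (fun s : ℝ => U.indicator (1 : EE n → ℝ≥0∞) (x + s • w)) := (ind1_meas hUo).comp (by fun_prop)
  rw [← lintegral_const_mul _ hm]
  refine lintegral_mono fun s => ?_
  by_cases h : x + s • w ∈ U
  · simp [h, hM]
  · simp [h]

include hUo in
lemma mE_one {R : ℝ} (hR : ∀ x ∈ U, ‖x‖ ≤ R) {x : EE n} (hx : x ∈ U) {w : EE n} (hw : w ≠ 0) :
    mE U 1 x w = 1 := ENNReal.div_self (LL_pos hUo hx w) (LL_fin hUo hR x hw)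

include hUo in
lemma selfadj {R : ℝ} (hR : ∀ x ∈ U, ‖x‖ ≤ R) {w : EE n} (hw : w ≠ 0) {F G : EE n → ℝ≥0∞}
    (hF : Measurable F) (hG : Measurable G) (hGw : ∀ x (s : ℝ), G (x + s • w) = G x) :
    ∫⁻ x in U, mE U F x w * G x = ∫⁻ x in U, F x * G x := by
  have hUm := hUo.measurableSet
  set L : EE n → ℝ≥0∞ := fun x => JJ (U.indicator 1) x w with hL
  have hLm : Measurable L := (JJ_meas (ind1_meas hUo)).comp (measurable_prodMk_right (y := w))
  have hI := ind1_meas hUo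
  have hFI := hF.indicator hUm
  set H : EE n → ℝ≥0∞ := fun x => U.indicator 1 x * (L x)⁻¹ * G x with hH
  have hHm : Measurable H := (hI.mul hLm.inv).mul hG
  calc ∫⁻ x in U, mE U F x w * G x = ∫⁻ x, ∫⁻ s : ℝ, U.indicator F (x + s • w) * H x := by
        rw [← lintegral_indicator hUm]
        refine lintegral_congr fun x => ?_
        have hm : Measurable (fun s : ℝ => U.indicator F (x + s • w)) := hFI.comp (by fun_prop)
        rw [lintegral_mul_const _ hm]
        by_cases hx : x ∈ U
        · simp only [hx, Set.indicator_of_mem, hH, Pi.one_apply, one_mul, mE, JJ, hL, div_eq_mul_inv, mul_assoc]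
        · simp [hx, hH]
    _ = ∫⁻ s : ℝ, ∫⁻ x, U.indicator F (x + s • w) * H x := by
        refine lintegral_lintegral_swap (Measurable.aemeasurable ?_)
        exact (hFI.comp (by fun_prop)).mul (hHm.comp measurable_fst)
    _ = ∫⁻ s : ℝ, ∫⁻ y, U.indicator F y * (U.indicator 1 (y - s • w) * (L y)⁻¹ * G y) := by
        refine lintegral_congr fun s => ?_
        rw [← lintegral_add_right_eq_self (fun y => U.indicator F y * (U.indicator 1 (y - s • w) * (L y)⁻¹ * G y)) (s • w)]
        refine lintegral_congr fun x => ?_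
        simp only [hH, hL, add_sub_cancel_right, hGw, JJ_shift]
    _ = ∫⁻ y, ∫⁻ s : ℝ, U.indicator F y * (U.indicator 1 (y - s • w) * (L y)⁻¹ * G y) := by
        refine lintegral_lintegral_swap (Measurable.aemeasurable ?_)
        exact (hFI.comp measurable_snd).mul (((hI.comp (by fun_prop)).mul (hLm.comp measurable_snd).inv).mul
          (hG.comp measurable_snd))
    _ = ∫⁻ x in U, F x * G x := by
        rw [← lintegral_indicator hUm]
        refine lintegral_congr fun y => ?_
        by_cases hy : y ∈ U
        · have e : ∀ s : ℝ, U.indicator F y * (U.indicator 1 (y - s • w) * (L y)⁻¹ * G y) =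
              (F y * G y * (L y)⁻¹) * U.indicator 1 (y + (-s) • w) := fun s => by
            rw [Set.indicator_of_mem hy, neg_smul, ← sub_eq_add_neg]; ring
          simp_rw [e]
          have hm : Measurable (fun s : ℝ => U.indicator (1 : EE n → ℝ≥0∞) (y + (-s) • w)) := hI.comp (by fun_prop)
          rw [lintegral_const_mul _ hm, Set.indicator_of_mem hy,
            lintegral_neg_eq_self (fun s : ℝ => U.indicator 1 (y + s • w))]
          change F y * G y * (L y)⁻¹ * L y = _
          rw [mul_assoc, ENNReal.inv_mul_cancel (LL_pos hUo hy w) (LL_fin hUo hR y hw), mul_one]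
        · simp [hy]

end

/-- average over directions -/
noncomputable def PP {n : ℕ} (U : Set (EE n)) (F : EE n → ℝ≥0∞) (x : EE n) : ℝ≥0∞ :=
  (volume (Metric.ball (0 : EE n) 1))⁻¹ * ∫⁻ w in Metric.ball (0 : EE n) 1, mE U F x w

noncomputable def ee {n : ℕ} (U : Set (EE n)) (f : EE n → ℝ) (x w : EE n) : ℝ≥0∞ :=
  ENNReal.ofReal ((f x - (mE U (fun y => ENNReal.ofReal (f y)) x w).toReal) ^ 2)

/-- variance dropped in one step -/
noncomputable def VV {n : ℕ} (U : Set (EE n)) (f : EE n → ℝ) : ℝ≥0∞ :=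
  (volume (Metric.ball (0 : EE n) 1))⁻¹ * ∫⁻ w in Metric.ball (0 : EE n) 1, ∫⁻ x in U, ee U f x w

lemma two_mul_le_sq (a b : ℝ≥0∞) : 2 * (a * b) ≤ a ^ 2 + b ^ 2 := by
  by_cases ha : a = ⊤
  · subst ha; simp
  by_cases hb : b = ⊤
  · subst hb; simp
  lift a to NNReal using ha
  lift b to NNReal using hb
  have := two_mul_le_add_sq a b
  rw [mul_assoc] at this
  exact_mod_cast this

lemma sq_lintegral_le {α : Type*} [MeasurableSpace α] (μ : Measure α) {g : α → ℝ≥0∞} (hg : Measurable g) :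
    (∫⁻ x, g x ∂μ) ^ 2 ≤ μ Set.univ * ∫⁻ x, g x ^ 2 ∂μ := by
  have h1 : 2 * (∫⁻ x, g x ∂μ) ^ 2 ≤ 2 * (μ Set.univ * ∫⁻ x, g x ^ 2 ∂μ) := by
    calc 2 * (∫⁻ x, g x ∂μ) ^ 2 = ∫⁻ x, ∫⁻ y, 2 * (g x * g y) ∂μ ∂μ := by
          have : ∀ x, ∫⁻ y, 2 * (g x * g y) ∂μ = (2 * ∫⁻ y, g y ∂μ) * g x := fun x => by
            rw [lintegral_const_mul _ (hg.const_mul _), lintegral_const_mul _ hg]; ring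
          simp_rw [this]
          rw [lintegral_const_mul _ hg]; ring
      _ ≤ ∫⁻ x, ∫⁻ y, (g x ^ 2 + g y ^ 2) ∂μ ∂μ :=
          lintegral_mono fun x => lintegral_mono fun y => two_mul_le_sq _ _
      _ = 2 * (μ Set.univ * ∫⁻ x, g x ^ 2 ∂μ) := by
          have : ∀ x, ∫⁻ y, (g x ^ 2 + g y ^ 2) ∂μ = μ Set.univ * g x ^ 2 + ∫⁻ y, g y ^ 2 ∂μ := fun x => by
            rw [lintegral_add_left measurable_const, lintegral_const, mul_comm]
          simp_rw [this]
          rw [lintegral_add_right _ measurable_const, lintegral_const_mul _ (hg.pow_const 2), lintegral_const]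
          ring
  exact (ENNReal.mul_le_mul_iff_right (by norm_num) (by norm_num)).1 h1

section
variable {n : ℕ} (hn : 0 < n) {U : Set (EE n)} (hUo : IsOpen U) {R : ℝ} (hR : ∀ x ∈ U, ‖x‖ ≤ R)
  (hfin : volume U ≠ ⊤)

include hUo in
lemma PP_meas {F : EE n → ℝ≥0∞} (hF : Measurable F) : Measurable (PP U F) :=
  (Measurable.lintegral_prod_right' (mE_meas hUo hF)).const_mul _

lemma vB_ne0 : volume (Metric.ball (0 : EE n) 1) ≠ 0 := (Metric.measure_ball_pos _ _ one_pos).ne'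
lemma vB_ne : volume (Metric.ball (0 : EE n) 1) ≠ ⊤ := measure_ball_lt_top.ne

include hUo in
lemma PP_le {F : EE n → ℝ≥0∞} {M : ℝ≥0∞} (hM : ∀ x, F x ≤ M) (x : EE n) : PP U F x ≤ M := by
  unfold PP
  calc _ ≤ (volume (Metric.ball (0 : EE n) 1))⁻¹ * ∫⁻ w in Metric.ball (0 : EE n) 1, M := by
        gcongr with w; exact mE_le hM x w hUo
    _ = M := by
        rw [setLIntegral_const, mul_left_comm, ENNReal.inv_mul_cancel vB_ne0 vB_ne, mul_one]

include hn in
lemma ae_ne0 (s : Set (EE n)) : ∀ᵐ w ∂(volume.restrict s), w ≠ 0 := by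
  haveI : Nonempty (Fin n) := ⟨⟨0, hn⟩⟩
  exact ae_restrict_of_ae (Measure.ae_ne volume 0)

include hn hUo hR in
lemma PP_one {x : EE n} (hx : x ∈ U) : PP U 1 x = 1 := by
  unfold PP
  rw [lintegral_congr_ae (g := fun _ => 1) ((ae_ne0 hn _).mono fun w hw => mE_one hUo hR hx hw),
    setLIntegral_const, one_mul, ENNReal.inv_mul_cancel vB_ne0 vB_ne]

include hn hUo hR in
lemma PP_mean {F : EE n → ℝ≥0∞} (hF : Measurable F) : ∫⁻ x in U, PP U F x = ∫⁻ x in U, F x := by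
  have hm := mE_meas hUo hF
  unfold PP
  rw [lintegral_const_mul _ (Measurable.lintegral_prod_right' hm), lintegral_lintegral_swap hm.aemeasurable,
    lintegral_congr_ae (g := fun _ => ∫⁻ x in U, F x), setLIntegral_const, mul_left_comm,
    ENNReal.inv_mul_cancel vB_ne0 vB_ne, mul_one]
  refine (ae_ne0 hn _).mono fun w hw => ?_
  have := selfadj hUo hR hw hF (measurable_const (a := (1:ℝ≥0∞))) (fun _ _ => rfl)
  simpa using this

include hUo in
lemma ee_meas {f : EE n → ℝ} (hf : Measurable f) : Measurable (fun p : EE n × EE n => ee U f p.1 p.2) := by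
  unfold ee
  have := mE_meas hUo hf.ennreal_ofReal
  fun_prop

include hn hUo hR hfin in
lemma PP_sq {f : EE n → ℝ} (hf : Measurable f) (hf0 : ∀ x, 0 ≤ f x) {M : ℝ} (hM : ∀ x, f x ≤ M) :
    (∫⁻ x in U, PP U (fun y => ENNReal.ofReal (f y)) x ^ 2) + VV U f ≤ ∫⁻ x in U, ENNReal.ofReal (f x) ^ 2 := by
  set F : EE n → ℝ≥0∞ := fun y => ENNReal.ofReal (f y) with hF
  have hFm : Measurable F := hf.ennreal_ofReal
  have hm := mE_meas hUo hFm
  have he := ee_meas (U := U) hUo hf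
  set vB := volume (Metric.ball (0 : EE n) 1) with hvB
  have hmle : ∀ x w, mE U F x w ≤ ENNReal.ofReal M := fun x w =>
    mE_le (fun y => ENNReal.ofReal_le_ofReal (hM y)) x w hUo
  have key : ∀ w : EE n, w ≠ 0 → (∫⁻ x in U, mE U F x w ^ 2) + (∫⁻ x in U, ee U f x w) = ∫⁻ x in U, F x ^ 2 := by
    intro w hw
    have hmw : Measurable (fun x => mE U F x w) := hm.comp (measurable_prodMk_right (y := w))
    have hew : Measurable (fun x => ee U f x w) := he.comp (measurable_prodMk_right (y := w))
    have hpt : ∀ x, ee U f x w + 2 * (F x * mE U F x w) = F x ^ 2 + mE U F x w ^ 2 := by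
      intro x
      have hne : mE U F x w ≠ ⊤ := ne_top_of_le_ne_top ENNReal.ofReal_ne_top (hmle x w)
      have hb : 0 ≤ (mE U F x w).toReal := ENNReal.toReal_nonneg
      unfold ee
      change ENNReal.ofReal ((f x - (mE U F x w).toReal) ^ 2) + _ = _
      conv_lhs => rw [← ENNReal.ofReal_toReal hne]
      conv_rhs => rw [← ENNReal.ofReal_toReal hne]
      rw [ENNReal.toReal_ofReal hb]
      generalize (mE U F x w).toReal = b at hb
      have ha := hf0 x
      simp only [hF]
      rw [← ENNReal.ofReal_pow ha, ← ENNReal.ofReal_pow hb, ← ENNReal.ofReal_mul ha,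
        ← ENNReal.ofReal_add (by positivity) (by positivity), show (2:ℝ≥0∞) = ENNReal.ofReal 2 by simp,
        ← ENNReal.ofReal_mul (by norm_num), ← ENNReal.ofReal_add (by positivity) (by positivity)]
      congr 1; ring
    have h1 : (∫⁻ x in U, ee U f x w) + 2 * (∫⁻ x in U, F x * mE U F x w) =
        (∫⁻ x in U, F x ^ 2) + ∫⁻ x in U, mE U F x w ^ 2 := by
      have hmm : Measurable (fun x => F x * mE U F x w) := hFm.mul hmw
      rw [← lintegral_const_mul _ hmm, ← lintegral_add_left hew, ← lintegral_add_left (hFm.pow_const 2)]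
      exact lintegral_congr hpt
    have h2 := selfadj hUo hR hw hFm hmw (fun x s => mE_shift F x w s)
    rw [← h2] at h1
    have h3 : ∫⁻ x in U, mE U F x w * mE U F x w = ∫⁻ x in U, mE U F x w ^ 2 :=
      lintegral_congr fun x => (sq _).symm
    rw [h3] at h1
    have h4 : ∫⁻ x in U, mE U F x w ^ 2 ≠ ⊤ := by
      refine ne_top_of_le_ne_top (b := ENNReal.ofReal M ^ 2 * volume U)
        (ENNReal.mul_ne_top (ENNReal.pow_ne_top ENNReal.ofReal_ne_top) hfin) ?_
      rw [← setLIntegral_const]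
      exact lintegral_mono fun x => pow_le_pow_left' (hmle x w) 2
    rw [two_mul, ← add_assoc] at h1
    rw [add_comm]
    exact (ENNReal.add_left_inj h4).1 h1
  have hj : ∀ x, PP U F x ^ 2 ≤ vB⁻¹ * ∫⁻ w in Metric.ball (0 : EE n) 1, mE U F x w ^ 2 := by
    intro x
    have h1 := sq_lintegral_le (volume.restrict (Metric.ball (0 : EE n) 1))
      (hm.comp (measurable_prodMk_left (x := x)))
    rw [Measure.restrict_apply_univ] at h1
    calc PP U F x ^ 2 = vB⁻¹ ^ 2 * (∫⁻ w in Metric.ball (0 : EE n) 1, mE U F x w) ^ 2 := by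
          rw [PP, mul_pow]
      _ ≤ vB⁻¹ ^ 2 * (vB * ∫⁻ w in Metric.ball (0 : EE n) 1, mE U F x w ^ 2) := by
          gcongr; exact h1
      _ = vB⁻¹ * ∫⁻ w in Metric.ball (0 : EE n) 1, mE U F x w ^ 2 := by
          rw [sq, ← mul_assoc, mul_assoc vB⁻¹ vB⁻¹ vB, ENNReal.inv_mul_cancel vB_ne0 vB_ne, mul_one]
  have hm2 : Measurable (fun p : EE n × EE n => mE U F p.1 p.2 ^ 2) := hm.pow_const 2
  have h5 : ∫⁻ x in U, PP U F x ^ 2 ≤ vB⁻¹ * ∫⁻ w in Metric.ball (0 : EE n) 1, ∫⁻ x in U, mE U F x w ^ 2 := by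
    refine (lintegral_mono hj).trans_eq ?_
    rw [lintegral_const_mul _ (Measurable.lintegral_prod_right' hm2), lintegral_lintegral_swap hm2.aemeasurable]
  refine (add_le_add h5 le_rfl).trans_eq ?_
  have hm3 : Measurable (fun w => ∫⁻ x in U, mE U F x w ^ 2) := Measurable.lintegral_prod_left' hm2
  rw [VV, ← mul_add, ← lintegral_add_left hm3,
    lintegral_congr_ae (g := fun _ => ∫⁻ x in U, F x ^ 2) ((ae_ne0 hn _).mono fun w hw => key w hw),
    setLIntegral_const, mul_left_comm, ENNReal.inv_mul_cancel vB_ne0 vB_ne, mul_one]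
end
end HR

end

section
open MeasureTheory ProbabilityTheory
open scoped ENNReal Pointwise

namespace HR
section
variable {n : ℕ} (hn : 0 < n) {U : Set (EE n)} (hUo : IsOpen U) (hUc : Convex ℝ U) {h : ℝ} (hh : 0 < h)

noncomputable def EX {n : ℕ} (U : Set (EE n)) (f : EE n → ℝ) (x : EE n) : ℝ≥0∞ :=
  (volume (Metric.ball (0 : EE n) 1))⁻¹ * ∫⁻ w in Metric.ball (0 : EE n) 1, ee U f x w

include hUo in
lemma VV_eq {f : EE n → ℝ} (hf : Measurable f) : VV U f = ∫⁻ x in U, EX U f x := by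
  have he := ee_meas (U := U) hUo hf
  unfold EX VV
  rw [lintegral_const_mul _ (Measurable.lintegral_prod_right' (f := fun p : EE n × EE n => ee U f p.1 p.2) he), lintegral_lintegral_swap (f := fun x w => ee U f x w) he.aemeasurable]

include hn hUo in
lemma EX_scale {f : EE n → ℝ} (hf : Measurable f) (x : EE n) {t : ℝ} (ht : 0 < t) :
    (volume (Metric.ball (0 : EE n) t))⁻¹ * ∫⁻ w in Metric.ball (0 : EE n) t, ee U f x w = EX U f x := by
  have he : Measurable (ee U f x) := (ee_meas (U := U) hUo hf).comp (measurable_prodMk_left (x := x))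
  have h1 := lintegral_map (μ := volume) (he.indicator (measurableSet_ball (x := (0 : EE n)) (ε := t)))
    (measurable_const_smul t)
  rw [Measure.map_addHaar_smul _ ht.ne', lintegral_smul_measure, lintegral_indicator measurableSet_ball, smul_eq_mul] at h1
  have h2 : ∫⁻ w, (Metric.ball (0 : EE n) t).indicator (ee U f x) (t • w) =
      ∫⁻ w in Metric.ball (0 : EE n) 1, ee U f x w := by
    rw [← lintegral_indicator measurableSet_ball]
    refine lintegral_congr fun w => ?_
    have h3 : t • w ∈ Metric.ball (0 : EE n) t ↔ w ∈ Metric.ball (0 : EE n) 1 := by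
      rw [mem_ball_zero_iff, mem_ball_zero_iff, norm_smul, Real.norm_of_nonneg ht.le]
      constructor
      · intro h; nlinarith
      · intro h; nlinarith
    by_cases hw : w ∈ Metric.ball (0 : EE n) 1
    · rw [Set.indicator_of_mem hw, Set.indicator_of_mem (h3.2 hw), ee, ee, mE_scale hUo hf.ennreal_ofReal x w ht.ne']
    · rw [Set.indicator_of_notMem hw, Set.indicator_of_notMem (fun hc => hw (h3.1 hc))]
  rw [h2] at h1
  have hp : (0:ℝ) < t ^ n := pow_pos ht n
  rw [EX, ← h1, vol_ball hn ht, ENNReal.mul_inv (Or.inr vB_ne) (Or.inr vB_ne0), finrank_euclideanSpace_fin,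
    abs_of_pos (inv_pos.2 hp), ENNReal.ofReal_inv_of_pos hp]
  ring

lemma mE_swap (hUo : IsOpen U) {F : EE n → ℝ≥0∞} (hF : Measurable F) (x y : EE n) :
    mE U F x (y - x) = mE U F y (x - y) := by
  have h1 := mE_scale hUo hF y (y - x) (c := -1) (by norm_num)
  have h2 := mE_shift (U := U) F x (y - x) 1
  rw [one_smul, add_sub_cancel] at h2
  rw [neg_one_smul, neg_sub] at h1
  rw [h1, h2]

open Classical in
include hn hUo hUc hh in
lemma kj_energy {f : EE n → ℝ} (hf : Measurable f) (j : ℕ) (x : EE n) :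
    ∫⁻ y, kj U h j x y * ee U f x (y - x) ≤ (if x ∈ Rj U h j then 1 else 0) * EX U f x := by
  split_ifs with hx
  · rw [one_mul, ← EX_scale hn hUo hf x (tj_pos hh j)]
    have he : Measurable (ee U f x) := (ee_meas (U := U) hUo hf).comp (measurable_prodMk_left (x := x))
    rw [← lintegral_const_mul _ he, ← lintegral_indicator measurableSet_ball,
      ← lintegral_sub_right_eq_self ((Metric.ball (0 : EE n) (tj h j)).indicator _) x]
    refine lintegral_mono fun y => ?_
    unfold kj
    split_ifs with h1
    · rw [Set.indicator_of_mem]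
      rw [mem_ball_zero_iff, norm_sub_rev]; exact h1.2.2
    · simp
  · have : ∀ y, kj U h j x y = 0 := fun y => by
      unfold kj; rw [if_neg]; tauto
    simp [this]

include hn hUo hUc hh in
lemma kk_energy {f : EE n → ℝ} (hf : Measurable f) (x : EE n) :
    ∫⁻ y in U, kk U h x y * ee U f x (y - x) ≤ 3 * EX U f x := by
  classical
  refine (setLIntegral_le_lintegral _ _).trans ?_
  unfold kk
  simp_rw [← ENNReal.tsum_mul_right]
  have he : Measurable (fun y => ee U f x (y - x)) :=
    (ee_meas (U := U) hUo hf).comp (f := fun y => (x, y - x)) (by fun_prop)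
  have hm : ∀ j, AEMeasurable (fun y => kj U h j x y * ee U f x (y - x)) := fun j =>
    (((kj_meas hUo hUc hh j).comp (measurable_prodMk_left (x := x))).mul he).aemeasurable
  rw [lintegral_tsum hm]
  refine (ENNReal.tsum_le_tsum fun j => kj_energy hn hUo hUc hh hf j x).trans ?_
  rw [ENNReal.tsum_mul_right]
  gcongr
  exact Rj_count x

include hn hUo hUc hh in
lemma energy {f : EE n → ℝ} (hf : Measurable f) :
    ∫⁻ x in U, ∫⁻ y in U, kk U h x y * ENNReal.ofReal ((f x - f y) ^ 2) ≤ 12 * VV U f := by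
  have he := ee_meas (U := U) hUo hf
  have km := kk_meas hUo hUc hh
  have hg : Measurable (fun p : EE n × EE n => kk U h p.1 p.2 * ee U f p.1 (p.2 - p.1)) :=
    Measurable.mul km (he.comp (f := fun p : EE n × EE n => (p.1, p.2 - p.1)) (by fun_prop))
  have hg' : Measurable (fun p : EE n × EE n => kk U h p.2 p.1 * ee U f p.2 (p.1 - p.2)) :=
    hg.comp measurable_swap
  have hEm : Measurable (EX U f) := (Measurable.lintegral_prod_right' he).const_mul _
  have hpt : ∀ x y, kk U h x y * ENNReal.ofReal ((f x - f y) ^ 2) ≤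
      2 * (kk U h x y * ee U f x (y - x)) + 2 * (kk U h y x * ee U f y (x - y)) := by
    intro x y
    rw [kk_symm y x, show 2 * (kk U h x y * ee U f x (y - x)) + 2 * (kk U h x y * ee U f y (x - y)) =
      kk U h x y * (2 * ee U f x (y - x) + 2 * ee U f y (x - y)) by ring]
    gcongr
    unfold ee
    rw [mE_swap hUo hf.ennreal_ofReal y x]
    generalize (mE U (fun y => ENNReal.ofReal (f y)) x (y - x)).toReal = b
    rw [show (2:ℝ≥0∞) = ENNReal.ofReal 2 by simp, ← ENNReal.ofReal_mul (by norm_num),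
      ← ENNReal.ofReal_mul (by norm_num), ← ENNReal.ofReal_add (by positivity) (by positivity)]
    refine ENNReal.ofReal_le_ofReal ?_
    nlinarith [sq_nonneg (f x + f y - 2 * b)]
  calc ∫⁻ x in U, ∫⁻ y in U, kk U h x y * ENNReal.ofReal ((f x - f y) ^ 2)
      ≤ ∫⁻ x in U, ∫⁻ y in U, (2 * (kk U h x y * ee U f x (y - x)) + 2 * (kk U h y x * ee U f y (x - y))) :=
        lintegral_mono fun x => lintegral_mono fun y => hpt x y
    _ = 2 * (∫⁻ x in U, ∫⁻ y in U, kk U h x y * ee U f x (y - x)) +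
        2 * (∫⁻ x in U, ∫⁻ y in U, kk U h y x * ee U f y (x - y)) := by
        have e1 : ∀ x, ∫⁻ y in U, (2 * (kk U h x y * ee U f x (y - x)) + 2 * (kk U h y x * ee U f y (x - y))) =
            2 * (∫⁻ y in U, kk U h x y * ee U f x (y - x)) + 2 * (∫⁻ y in U, kk U h y x * ee U f y (x - y)) := by
          intro x
          have a1 : Measurable (fun y => kk U h x y * ee U f x (y - x)) := hg.comp (measurable_prodMk_left (x := x))
          have a2 : Measurable (fun y => kk U h y x * ee U f y (x - y)) := hg'.comp (measurable_prodMk_left (x := x))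
          rw [lintegral_add_left (a1.const_mul 2), lintegral_const_mul _ a1, lintegral_const_mul _ a2]
        simp_rw [e1]
        have a1 : Measurable (fun x => ∫⁻ y in U, kk U h x y * ee U f x (y - x)) := Measurable.lintegral_prod_right' hg
        have a2 : Measurable (fun x => ∫⁻ y in U, kk U h y x * ee U f y (x - y)) := Measurable.lintegral_prod_right' hg'
        rw [lintegral_add_left (a1.const_mul 2), lintegral_const_mul _ a1, lintegral_const_mul _ a2]
    _ = 4 * (∫⁻ x in U, ∫⁻ y in U, kk U h x y * ee U f x (y - x)) := by
        rw [lintegral_lintegral_swap (f := fun x y => kk U h y x * ee U f y (x - y)) hg'.aemeasurable, ← add_mul]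
        norm_num
    _ ≤ 4 * ∫⁻ x in U, 3 * EX U f x := by
        gcongr with x; exact kk_energy hn hUo hUc hh hf x
    _ = 12 * VV U f := by
        rw [lintegral_const_mul _ hEm, VV_eq hUo hf, ← mul_assoc]; norm_num
end
end HR

end

section
open MeasureTheory ProbabilityTheory
open scoped ENNReal Pointwise

namespace HR
section
variable {n : ℕ} (hn : 0 < n) {U : Set (EE n)} (hUo : IsOpen U) (hUc : Convex ℝ U)

/-- one step of the chain on densities -/
noncomputable def Pf {n : ℕ} (U : Set (EE n)) (f : EE n → ℝ) (x : EE n) : ℝ :=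
  (PP U (fun y => ENNReal.ofReal (f y)) x).toReal

include hUo in
lemma Pf_meas {f : EE n → ℝ} (hf : Measurable f) : Measurable (Pf U f) :=
  (PP_meas hUo hf.ennreal_ofReal).ennreal_toReal

lemma Pf_nonneg {f : EE n → ℝ} (x : EE n) : 0 ≤ Pf U f x := ENNReal.toReal_nonneg

include hUo in
lemma Pf_ofReal {f : EE n → ℝ} {M : ℝ} (hM : ∀ x, f x ≤ M) (x : EE n) :
    ENNReal.ofReal (Pf U f x) = PP U (fun y => ENNReal.ofReal (f y)) x :=
  ENNReal.ofReal_toReal (ne_top_of_le_ne_top ENNReal.ofReal_ne_top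
    (PP_le hUo (fun y => ENNReal.ofReal_le_ofReal (hM y)) x))

include hUo in
lemma Pf_le {f : EE n → ℝ} {M : ℝ} (hM0 : 0 ≤ M) (hM : ∀ x, f x ≤ M) (x : EE n) : Pf U f x ≤ M :=
  ENNReal.toReal_le_of_le_ofReal hM0 (PP_le hUo (fun y => ENNReal.ofReal_le_ofReal (hM y)) x)

include hn hUo hUc in
lemma step {r R : ℝ} (hr : 0 < r) (hrR : r ≤ R) (hUr : Metric.ball 0 r ⊆ U)
    (hR : ∀ x ∈ U, ‖x‖ ≤ R) (hfin : volume U ≠ ⊤)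
    {f : EE n → ℝ} (hf : Measurable f) (hf0 : ∀ x, 0 ≤ f x) {M : ℝ} (hM : ∀ x, f x ≤ M) :
    (∫ x in U, Pf U f x = ∫ x in U, f x) ∧
    (∫ x in U, Pf U f x ^ 2) - (∫ x in U, f x) ^ 2 / (volume U).toReal ≤
      (1 - (r / (n * R) / 10 ^ 4) ^ 2 / 36) *
        ((∫ x in U, f x ^ 2) - (∫ x in U, f x) ^ 2 / (volume U).toReal) := by
  have hN : (0:ℝ) < n := by exact_mod_cast hn
  have hR0 : 0 < R := hr.trans_le hrR
  have hM0 : 0 ≤ M := (hf0 0).trans (hM 0)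
  have hh : 0 < r / (12 * √n) := by have := Real.sqrt_pos.2 hN; positivity
  set h := r / (12 * √n) with hh'
  set Φ := r / (n * R) / 10 ^ 4 with hΦ
  have hΦ0 : 0 < Φ := by positivity
  set μ := volume.restrict U with hμ
  haveI : IsFiniteMeasure μ := ⟨by rw [hμ, Measure.restrict_apply_univ]; exact hfin.lt_top⟩
  have hPm := Pf_meas hUo hf
  have bint : ∀ {g : EE n → ℝ} {C : ℝ}, Measurable g → (∀ x, |g x| ≤ C) → Integrable g μ :=
    fun hg hC => Integrable.of_bound hg.aestronglyMeasurable _ (ae_of_all _ hC)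
  have fb : ∀ x, |f x| ≤ M := fun x => by rw [abs_of_nonneg (hf0 x)]; exact hM x
  have pb : ∀ x, |Pf U f x| ≤ M := fun x => by rw [abs_of_nonneg (Pf_nonneg x)]; exact Pf_le hUo hM0 hM x
  have sqb : ∀ {a : ℝ}, |a| ≤ M → |a ^ 2| ≤ M ^ 2 := fun {a} ha => by
    rw [abs_pow]; exact pow_le_pow_left₀ (abs_nonneg _) ha 2
  have fi := bint hf fb
  have f2i := bint (hf.pow_const 2) fun x => sqb (fb x)
  have pi := bint hPm pb
  have p2i := bint (hPm.pow_const 2) fun x => sqb (pb x)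
  have hmean : ∫ x, Pf U f x ∂μ = ∫ x, f x ∂μ := by
    rw [integral_eq_lintegral_of_nonneg_ae (ae_of_all _ fun x => Pf_nonneg x) hPm.aestronglyMeasurable,
      integral_eq_lintegral_of_nonneg_ae (ae_of_all _ hf0) hf.aestronglyMeasurable]
    simp_rw [Pf_ofReal hUo hM]
    rw [PP_mean hn hUo hR hf.ennreal_ofReal]
  refine ⟨hmean, ?_⟩
  have hsq := PP_sq hn hUo hR hfin hf hf0 hM
  set A := ∫ x, f x ^ 2 ∂μ with hA
  set A' := ∫ x, Pf U f x ^ 2 ∂μ with hA'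
  set B := ∫ x, f x ∂μ with hB
  have eA : ∫⁻ x in U, ENNReal.ofReal (f x) ^ 2 = ENNReal.ofReal A := by
    rw [hA, ofReal_integral_eq_lintegral_ofReal f2i (ae_of_all _ fun x => sq_nonneg _)]
    exact lintegral_congr fun x => (ENNReal.ofReal_pow (hf0 x) 2).symm
  have eA' : ∫⁻ x in U, PP U (fun y => ENNReal.ofReal (f y)) x ^ 2 = ENNReal.ofReal A' := by
    rw [hA', ofReal_integral_eq_lintegral_ofReal p2i (ae_of_all _ fun x => sq_nonneg _)]
    refine lintegral_congr fun x => ?_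
    rw [ENNReal.ofReal_pow (Pf_nonneg x) 2, Pf_ofReal hUo hM]
  rw [eA, eA'] at hsq
  have hA0 : 0 ≤ A := integral_nonneg fun x => sq_nonneg _
  have hA'0 : 0 ≤ A' := integral_nonneg fun x => sq_nonneg _
  have hVfin : VV U f ≠ ⊤ := ne_top_of_le_ne_top ENNReal.ofReal_ne_top (le_add_self.trans hsq)
  set v := (VV U f).toReal with hv
  have hv0 : 0 ≤ v := ENNReal.toReal_nonneg
  have h1 : A' + v ≤ A := by
    rw [← ENNReal.ofReal_toReal hVfin, ← ENNReal.ofReal_add hA'0 hv0] at hsq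
    exact (ENNReal.ofReal_le_ofReal_iff hA0).1 hsq
  obtain ⟨c, hc⟩ := cheeger μ (kk_meas hUo hUc hh) (fun x y => kk_symm x y) (C := 3) (by norm_num) hΦ0
    (fun x => by
      refine (setLIntegral_le_lintegral _ _).trans ?_
      simpa using kk_int hUo hUc hh x)
    (fun S hS hle => conductance hn hUo hUc hr hrR hUr hR hfin hh' hS hle) hf fb
  have h2 : ENNReal.ofReal (Φ ^ 2) * ∫⁻ x, ENNReal.ofReal ((f x - c) ^ 2) ∂μ ≤ ENNReal.ofReal (36 * v) := by
    refine hc.trans ?_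
    refine (mul_le_mul_right (energy hn hUo hUc hh hf) _).trans_eq ?_
    rw [ENNReal.ofReal_mul (by norm_num), hv, ENNReal.ofReal_toReal hVfin, ← mul_assoc]
    congr 1
    rw [ENNReal.ofReal_ofNat, ENNReal.ofReal_ofNat]; norm_num
  have fci : Integrable (fun x => (f x - c) ^ 2) μ := by
    refine bint (C := (M + |c|) ^ 2) ((hf.sub_const c).pow_const 2) fun x => ?_
    rw [abs_pow]
    refine pow_le_pow_left₀ (abs_nonneg _) ?_ 2
    exact (abs_sub _ _).trans (by linarith [fb x])
  rw [← ofReal_integral_eq_lintegral_ofReal fci (ae_of_all _ fun x => sq_nonneg _),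
    ← ENNReal.ofReal_mul (by positivity), ENNReal.ofReal_le_ofReal_iff (by positivity)] at h2
  set u := (volume U).toReal with hu
  have hu0 : 0 < u := by
    refine ENNReal.toReal_pos ?_ hfin
    exact (hUo.measure_pos volume ⟨0, hUr (Metric.mem_ball_self hr)⟩).ne'
  have h3 : ∫ x, (f x - c) ^ 2 ∂μ = A - 2 * c * B + c ^ 2 * u := by
    have e : ∀ x, (f x - c) ^ 2 = f x ^ 2 - 2 * c * f x + c ^ 2 := fun x => by ring
    simp_rw [e]
    have i1 : Integrable (fun x => 2 * c * f x) μ := fi.const_mul _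
    have i2 : Integrable (fun x => f x ^ 2 - 2 * c * f x) μ := f2i.sub i1
    rw [integral_add i2 (integrable_const _), integral_sub f2i i1, integral_const_mul, integral_const]
    simp only [hμ, measureReal_restrict_apply_univ, smul_eq_mul]
    rw [hu, Measure.real]; ring
  have h4 : A - B ^ 2 / u ≤ ∫ x, (f x - c) ^ 2 ∂μ := by
    rw [h3]
    have : (A - 2 * c * B + c ^ 2 * u) - (A - B ^ 2 / u) = (c * u - B) ^ 2 / u := by field_simp; ring
    have h5 : 0 ≤ (c * u - B) ^ 2 / u := by positivity
    linarith
  have h5 : Φ ^ 2 * (A - B ^ 2 / u) ≤ 36 * v := (mul_le_mul_of_nonneg_left h4 (by positivity)).trans h2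
  linarith
end
end HR

end

section
open MeasureTheory ProbabilityTheory
open scoped ENNReal Pointwise

namespace HR

lemma radial_half {n : ℕ} (hn : 0 < n) {a : ℝ} (ha : 0 < a) :
    ∫⁻ s in Set.Ioi a, ENNReal.ofReal (|s|⁻¹ ^ (n + 1)) = ENNReal.ofReal (1 / n * a⁻¹ ^ n) := by
  have hN : (0:ℝ) < n := by exact_mod_cast hn
  have h1 : ∀ s ∈ Set.Ioi a, |s|⁻¹ ^ (n + 1) = s ^ (-((n:ℝ) + 1)) := by
    intro s hs
    have hs0 : 0 < s := ha.trans hs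
    rw [abs_of_pos hs0, Real.rpow_neg hs0.le, inv_pow]
    congr 1
    rw [← Real.rpow_natCast]; push_cast; rfl
  have hi := integrableOn_Ioi_rpow_of_lt (a := -((n:ℝ) + 1)) (by linarith) ha
  have h2 := integral_Ioi_rpow_of_lt (a := -((n:ℝ) + 1)) (by linarith) ha
  rw [setLIntegral_congr_fun measurableSet_Ioi (g := fun s => ENNReal.ofReal (s ^ (-((n:ℝ) + 1))))
    (fun s hs => by simp only [h1 s hs]), ← ofReal_integral_eq_lintegral_ofReal hi, h2]
  · congr 1
    rw [show -((n:ℝ) + 1) + 1 = -n by ring, Real.rpow_neg ha.le, Real.rpow_natCast, inv_pow]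
    field_simp
  · exact (ae_restrict_iff' measurableSet_Ioi).2 (ae_of_all _ fun s hs => Real.rpow_nonneg (ha.trans hs).le _)

lemma radial {n : ℕ} (hn : 0 < n) {a : ℝ} (ha : 0 < a) :
    ∫⁻ s in {s : ℝ | a < |s|}, ENNReal.ofReal (|s|⁻¹ ^ (n + 1)) = ENNReal.ofReal (2 / n * a⁻¹ ^ n) := by
  have hN : (0:ℝ) < n := by exact_mod_cast hn
  have e : {s : ℝ | a < |s|} = Set.Ioi a ∪ Neg.neg ⁻¹' (Set.Ioi a) := by
    ext s; simp only [Set.mem_ofPred_eq, Set.mem_union, Set.mem_preimage, Set.mem_Ioi, lt_abs]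
  have hm : MeasurableSet (Neg.neg ⁻¹' (Set.Ioi a)) := measurableSet_Ioi.preimage measurable_neg
  rw [e, lintegral_union hm]
  · rw [← lintegral_indicator hm, ← lintegral_neg_eq_self
      ((Neg.neg ⁻¹' (Set.Ioi a)).indicator (fun s : ℝ => ENNReal.ofReal (|s|⁻¹ ^ (n + 1))))]
    have : ∀ s : ℝ, (Neg.neg ⁻¹' (Set.Ioi a)).indicator (fun s => ENNReal.ofReal (|s|⁻¹ ^ (n + 1))) (-s) =
        (Set.Ioi a).indicator (fun s => ENNReal.ofReal (|s|⁻¹ ^ (n + 1))) s := by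
      intro s
      by_cases hs : s ∈ Set.Ioi a
      · rw [Set.indicator_of_mem hs, Set.indicator_of_mem (by simpa using hs), abs_neg]
      · rw [Set.indicator_of_notMem hs, Set.indicator_of_notMem (by simpa using hs)]
    simp_rw [this]
    rw [lintegral_indicator measurableSet_Ioi, radial_half hn ha, ← ENNReal.ofReal_add (by positivity) (by positivity)]
    congr 1; ring
  · rw [Set.disjoint_left]
    intro s h1 h2
    simp only [Set.mem_preimage, Set.mem_Ioi] at h1 h2
    linarith

/-- the hit-and-run density -/
noncomputable def pp {n : ℕ} (U : Set (EE n)) (x z : EE n) : ℝ≥0∞ :=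
  ENNReal.ofReal (2 / (n * (volume (Metric.ball (0 : EE n) 1)).toReal) *
    (‖z - x‖ * (JJ (U.indicator 1) x (z - x)).toReal * ‖z - x‖ ^ (n - 1))⁻¹)

section
variable {n : ℕ} (hn : 0 < n) {U : Set (EE n)} (hUo : IsOpen U) {R : ℝ} (hR : ∀ x ∈ U, ‖x‖ ≤ R)

include hUo in
lemma pp_meas : Measurable (Function.uncurry (pp U)) := by
  have h1 : Measurable (fun p : EE n × EE n => JJ (U.indicator 1) p.1 (p.2 - p.1)) :=
    (JJ_meas (ind1_meas hUo)).comp (f := fun p : EE n × EE n => (p.1, p.2 - p.1)) (by fun_prop)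
  have : Function.uncurry (pp U) = fun p : EE n × EE n => ENNReal.ofReal (2 / (n * (volume (Metric.ball (0 : EE n) 1)).toReal) *
    (‖p.2 - p.1‖ * (JJ (U.indicator 1) p.1 (p.2 - p.1)).toReal * ‖p.2 - p.1‖ ^ (n - 1))⁻¹) := rfl
  rw [this]
  fun_prop

lemma pp_symm (hUo : IsOpen U) (x z : EE n) : pp U x z = pp U z x := by
  have h1 := JJ_scale (ind1_meas hUo) z (z - x) (c := -1) (by norm_num)
  have h2 := JJ_shift (U.indicator 1) x (z - x) 1
  rw [one_smul, add_sub_cancel] at h2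
  rw [neg_one_smul, neg_sub, h2] at h1
  unfold pp
  rw [h1, norm_sub_rev]
  norm_num

lemma swap_aux {q : EE n → ℝ≥0∞} {g : EE n → ℝ → ℝ≥0∞} (hqm : Measurable q)
    (hgm : Measurable (Function.uncurry g)) :
    ∫⁻ s : ℝ, ∫⁻ v, q v * g v s = ∫⁻ v, q v * ∫⁻ s : ℝ, g v s := by
  have a1 : Measurable (fun p : ℝ × EE n => q p.2) := hqm.comp measurable_snd
  have a2 : Measurable (fun p : ℝ × EE n => g p.2 p.1) := hgm.comp measurable_swap
  have a3 : Measurable (fun p : ℝ × EE n => q p.2 * g p.2 p.1) := a1.mul a2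
  rw [lintegral_lintegral_swap (f := fun (s : ℝ) (v : EE n) => q v * g v s) a3.aemeasurable]
  refine lintegral_congr fun v => ?_
  have a2 : Measurable (g v) := hgm.comp (measurable_prodMk_left (x := v))
  rw [lintegral_const_mul _ a2]

set_option maxHeartbeats 1000000 in
include hn hUo hR in
lemma pp_int {x : EE n} (hx : x ∈ U) {G : EE n → ℝ≥0∞} (hG : Measurable G) :
    ∫⁻ z in U, pp U x z * G z = PP U G x := by
  have hN : (0:ℝ) < n := by exact_mod_cast hn
  have hUm := hUo.measurableSet
  set B := Metric.ball (0 : EE n) 1 with hB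
  have hBm : MeasurableSet B := measurableSet_ball
  set UG := U.indicator G with hUG
  have hUGm : Measurable UG := hG.indicator hUm
  set L : EE n → ℝ≥0∞ := fun v => JJ (U.indicator 1) x v with hL
  have hLm : Measurable L := (JJ_meas (ind1_meas hUo)).comp (measurable_prodMk_left (x := x))
  set q : EE n → ℝ≥0∞ := fun v => UG (x + v) * (L v)⁻¹ with hq
  have hqm : Measurable q := (hUGm.comp (by fun_prop)).mul hLm.inv
  set D : Set (EE n × ℝ) := {p | ‖p.1‖ < |p.2|} with hD
  have hDm : MeasurableSet D := measurableSet_lt (by fun_prop) (by fun_prop)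
  set g : EE n → ℝ → ℝ≥0∞ := fun v s => D.indicator (fun p => ENNReal.ofReal (|p.2|⁻¹ ^ (n + 1))) (v, s) with hg
  have hgm : Measurable (Function.uncurry g) := Measurable.indicator (by fun_prop) hDm
  have main : ∫⁻ w in B, mE U G x w = ∫⁻ v, q v * ∫⁻ s : ℝ, g v s := by
    calc ∫⁻ w in B, mE U G x w = ∫⁻ w, ∫⁻ s : ℝ, B.indicator 1 w * (UG (x + s • w) * (L w)⁻¹) := by
          rw [← lintegral_indicator hBm]
          refine lintegral_congr fun w => ?_
          have m1 : Measurable (fun s : ℝ => UG (x + s • w)) := hUGm.comp (by fun_prop)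
          rw [lintegral_const_mul _ (m1.mul_const _), lintegral_mul_const _ m1]
          by_cases hw : w ∈ B
          · rw [Set.indicator_of_mem hw, Set.indicator_of_mem hw, Pi.one_apply, one_mul, mE, div_eq_mul_inv]; rfl
          · rw [Set.indicator_of_notMem hw, Set.indicator_of_notMem hw, zero_mul]
      _ = ∫⁻ s : ℝ, ∫⁻ w, B.indicator 1 w * (UG (x + s • w) * (L w)⁻¹) := by
          refine lintegral_lintegral_swap (Measurable.aemeasurable ?_)
          exact ((measurable_one.indicator hBm).comp measurable_fst).mul
            ((hUGm.comp (by fun_prop)).mul (hLm.comp measurable_fst).inv)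
      _ = ∫⁻ s : ℝ, ∫⁻ v, q v * g v s := by
          refine lintegral_congr_ae ((Measure.ae_ne volume (0:ℝ)).mono fun s hs => ?_)
          have hs' : 0 < |s| := abs_pos.2 hs
          set H : EE n → ℝ≥0∞ := fun v => {v : EE n | ‖v‖ < |s|}.indicator (fun v => q v * ENNReal.ofReal |s⁻¹|) v with hH
          have hHm : Measurable H := (hqm.mul_const _).indicator (measurableSet_lt (by fun_prop) (by fun_prop))
          have h1 := lintegral_map (μ := volume) hHm (measurable_const_smul s)
          rw [Measure.map_addHaar_smul _ hs, lintegral_smul_measure, smul_eq_mul] at h1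
          have h2 : ∀ w, H (s • w) = B.indicator 1 w * (UG (x + s • w) * (L w)⁻¹) := by
            intro w
            have h3 : s • w ∈ {v : EE n | ‖v‖ < |s|} ↔ w ∈ B := by
              rw [hB, mem_ball_zero_iff]
              change ‖s • w‖ < |s| ↔ _
              rw [norm_smul, Real.norm_eq_abs]
              constructor
              · intro h; nlinarith
              · intro h; nlinarith
            by_cases hw : w ∈ B
            · simp only [hH]
              rw [Set.indicator_of_mem (h3.2 hw), Set.indicator_of_mem hw, Pi.one_apply, one_mul]
              simp only [hq, hL]
              rw [JJ_scale (ind1_meas hUo) x w hs, ENNReal.mul_inv (Or.inl (by simpa using hs)) (Or.inl ENNReal.ofReal_ne_top)]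
              have h4 : (ENNReal.ofReal |s⁻¹|)⁻¹ * ENNReal.ofReal |s⁻¹| = 1 :=
                ENNReal.inv_mul_cancel (by simpa using hs) ENNReal.ofReal_ne_top
              rw [mul_comm (ENNReal.ofReal |s⁻¹|)⁻¹, ← mul_assoc, mul_assoc, h4, mul_one]
            · simp only [hH]
              rw [Set.indicator_of_notMem (fun hc => hw (h3.1 hc)), Set.indicator_of_notMem hw, zero_mul]
          simp_rw [h2] at h1
          change ∫⁻ w, B.indicator 1 w * (UG (x + s • w) * (L w)⁻¹) = ∫⁻ v, q v * g v s
          rw [← h1, ← lintegral_const_mul _ hHm]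
          refine lintegral_congr fun v => ?_
          by_cases hv : ‖v‖ < |s|
          · simp only [hH, hg]
            rw [Set.indicator_of_mem (show v ∈ {v : EE n | ‖v‖ < |s|} from hv), Set.indicator_of_mem (show (v, s) ∈ D from hv),
              mul_left_comm, ← ENNReal.ofReal_mul (abs_nonneg _), finrank_euclideanSpace_fin]
            congr 2
            rw [abs_inv, abs_inv, abs_pow, inv_pow, pow_succ, mul_inv]
          · simp only [hH, hg]
            rw [Set.indicator_of_notMem (show v ∉ {v : EE n | ‖v‖ < |s|} from hv), Set.indicator_of_notMem (show (v, s) ∉ D from hv),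
              mul_zero, mul_zero]
      _ = ∫⁻ v, q v * ∫⁻ s : ℝ, g v s := swap_aux hqm hgm
  have hgint : ∀ v : EE n, v ≠ 0 → ∫⁻ s : ℝ, g v s = ENNReal.ofReal (2 / n * ‖v‖⁻¹ ^ n) := by
    intro v hv
    rw [← radial hn (norm_pos_iff.2 hv), ← lintegral_indicator (measurableSet_lt measurable_const (by fun_prop))]
    rfl
  unfold PP
  rw [main]
  have hqg : Measurable (fun v => q v * ∫⁻ s : ℝ, g v s) := hqm.mul hgm.lintegral_prod_right
  rw [← lintegral_const_mul _ hqg, ← lintegral_indicator hUm,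
    ← lintegral_sub_right_eq_self (fun v => (volume B)⁻¹ * (q v * ∫⁻ s : ℝ, g v s)) x]
  haveI : Nonempty (Fin n) := ⟨⟨0, hn⟩⟩
  refine lintegral_congr_ae ((Measure.ae_ne volume x).mono fun z hz => ?_)
  have hzx : z - x ≠ 0 := sub_ne_zero.2 hz
  simp only [hgint _ hzx, hq, add_sub_cancel]
  by_cases hzU : z ∈ U
  · rw [Set.indicator_of_mem hzU, hUG, Set.indicator_of_mem hzU]
    have hLp : L (z - x) ≠ 0 := LL_pos hUo hx _
    have hLf : L (z - x) ≠ ⊤ := LL_fin hUo hR x hzx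
    have hl : 0 < (L (z - x)).toReal := ENNReal.toReal_pos hLp hLf
    have hb : 0 < (volume B).toReal := ENNReal.toReal_pos vB_ne0 vB_ne
    have hno : 0 < ‖z - x‖ := norm_pos_iff.2 hzx
    have e1 : (L (z - x))⁻¹ = ENNReal.ofReal ((L (z - x)).toReal⁻¹) := by
      rw [ENNReal.ofReal_inv_of_pos hl, ENNReal.ofReal_toReal hLf]
    have e2 : (volume B)⁻¹ = ENNReal.ofReal ((volume B).toReal⁻¹) := by
      rw [ENNReal.ofReal_inv_of_pos hb, ENNReal.ofReal_toReal vB_ne]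
    have e3 : pp U x z = (volume B)⁻¹ * (L (z - x))⁻¹ * ENNReal.ofReal (2 / n * ‖z - x‖⁻¹ ^ n) := by
      rw [e1, e2, ← ENNReal.ofReal_mul (by positivity), ← ENNReal.ofReal_mul (by positivity), pp]
      congr 1
      obtain ⟨k, rfl⟩ : ∃ k, n = k + 1 := ⟨n - 1, by omega⟩
      simp only [Nat.add_sub_cancel]
      change 2 / (((k + 1 : ℕ):ℝ) * (volume B).toReal) * (‖z - x‖ * (L (z - x)).toReal * ‖z - x‖ ^ k)⁻¹ = _
      rw [inv_pow, pow_succ]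
      field_simp
    rw [e3]; ring
  · rw [Set.indicator_of_notMem hzU, hUG, Set.indicator_of_notMem hzU]; simp
end
end HR

end

section
open MeasureTheory ProbabilityTheory
open scoped ENNReal Pointwise
namespace HR
section
variable {n : ℕ}

lemma chord_vol {K : Set (EE n)} (hKc : Convex ℝ K) {x : EE n} (hx : x ∈ interior K) (w : EE n) :
    volume {t : ℝ | x + t • w ∈ K} = volume {t : ℝ | x + t • w ∈ interior K} := by
  set I : Set ℝ := {t : ℝ | x + t • w ∈ K} with hI
  have hIc : Convex ℝ I := by
    intro s hs t ht a b ha hb hab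
    have := hKc hs ht ha hb hab
    change x + (a • s + b • t) • w ∈ K
    convert this using 1
    have : x = (a + b) • x := by rw [hab, one_smul]
    conv_lhs => rw [this]
    simp only [smul_eq_mul, add_smul, smul_add, mul_smul]
    abel
  refine le_antisymm ?_ (measure_mono (show {t : ℝ | x + t • w ∈ interior K} ⊆ I from fun t ht => interior_subset (s := K) ht))
  rw [← measure_congr (interior_ae_eq_of_null_frontier (hIc.addHaar_frontier volume))]
  refine measure_mono fun t ht => ?_
  change x + t • w ∈ interior K
  have hc : Filter.Tendsto (fun d : ℝ => (1 + d) * t) (nhdsWithin 0 (Set.Ioi 0)) (nhds t) := by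
    have : Continuous (fun d : ℝ => (1 + d) * t) := by fun_prop
    have h := this.tendsto 0
    simp only [add_zero, one_mul] at h
    exact h.mono_left nhdsWithin_le_nhds
  have h1 := hc.eventually (mem_interior_iff_mem_nhds.1 ht)
  obtain ⟨d, hd, hd0⟩ := (h1.and self_mem_nhdsWithin).exists
  have hd0 : (0:ℝ) < d := hd0
  have hd : x + ((1 + d) * t) • w ∈ K := hd
  have hdp : (0:ℝ) < 1 + d := by linarith
  have := hKc.combo_interior_self_mem_interior hx hd (a := d / (1 + d)) (b := 1 / (1 + d))
    (by positivity) (by positivity) (by field_simp; ring)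
  convert this using 1
  rw [smul_add, smul_smul, ← add_assoc, ← add_smul]
  congr 1
  · rw [show d / (1 + d) + 1 / (1 + d) = 1 by field_simp; ring, one_smul]
  · congr 1; field_simp

lemma vn_eq (hn : 0 < n) : Real.pi ^ ((n : ℝ) / 2) / Real.Gamma (1 + (n : ℝ) / 2) =
    (volume (Metric.ball (0 : EE n) 1)).toReal := by
  haveI : Nonempty (Fin n) := ⟨⟨0, hn⟩⟩
  rw [EuclideanSpace.volume_ball, ENNReal.ofReal_one, one_pow, one_mul, ENNReal.toReal_ofReal, Fintype.card_fin,
    Real.sqrt_eq_rpow, ← Real.rpow_natCast, ← Real.rpow_mul Real.pi_pos.le, add_comm]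
  · congr 2; ring
  · have : 0 < Real.Gamma ((Fintype.card (Fin n) : ℝ) / 2 + 1) := Real.Gamma_pos_of_pos (by positivity)
    positivity

lemma vol_K {K : Set (EE n)} (hKc : Convex ℝ K) : (volume.restrict K : Measure (EE n)) = volume.restrict (interior K) :=
  (Measure.restrict_congr_set (interior_ae_eq_of_null_frontier (hKc.addHaar_frontier volume))).symm

lemma P_eq (hn : 0 < n) {K : Set (EE n)} (hKcomp : IsCompact K) (hKc : Convex ℝ K) {R : ℝ}
    (hKR : K ⊆ Metric.closedBall 0 R)
    (chord : EE n → EE n → ℝ)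
    (hchord : ∀ u x, chord u x = ‖x - u‖ * (volume {t : ℝ | u + t • (x - u) ∈ K}).toReal)
    (vn : ℝ) (hvn : vn = Real.pi ^ ((n : ℝ) / 2) / Real.Gamma (1 + (n : ℝ) / 2))
    (P : Kernel (EE n) (EE n)) [IsMarkovKernel P]
    (hP : ∀ u ∈ K, ∀ A : Set (EE n), MeasurableSet A → A ⊆ K →
      P u A = ∫⁻ x in A,
        ENNReal.ofReal ((2 / (n * vn)) * (chord u x * ‖x - u‖ ^ (n - 1))⁻¹) ∂volume)
    {x : EE n} (hx : x ∈ interior K) :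
    P x = (volume.restrict (interior K)).withDensity (pp (interior K) x) := by
  set U := interior K with hU
  have hUo : IsOpen U := isOpen_interior
  have hUK : U ⊆ K := interior_subset
  have hUm := hUo.measurableSet
  have hR : ∀ x ∈ U, ‖x‖ ≤ R := fun y hy => by simpa using hKR (hUK hy)
  have key : ∀ A : Set (EE n), MeasurableSet A → A ⊆ K → P x A = ∫⁻ z in A, pp U x z := by
    intro A hA hAK
    rw [hP x (hUK hx) A hA hAK]
    refine lintegral_congr fun z => ?_
    rw [hchord, chord_vol hKc hx, hvn, vn_eq hn, pp, LL_eq hUo]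
  have h1 : P x U = 1 := by
    have h2 := pp_int hn hUo hR hx (G := 1) measurable_one
    rw [PP_one hn hUo hR hx] at h2
    rw [key U hUm hUK, ← h2]
    simp
  have h0 : P x Uᶜ = 0 := by
    rw [prob_compl_eq_zero_iff hUm, h1]
  ext T hT
  rw [withDensity_apply _ hT, Measure.restrict_restrict hT, ← key _ (hT.inter hUm) (fun z hz => hUK hz.2),
    ← measure_inter_add_sdiff T hUm]
  rw [show P x (T \ U) = 0 from measure_mono_null (fun z hz => hz.2) h0, add_zero]
end
end HR

end

section
open MeasureTheory ProbabilityTheory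
open scoped ENNReal Pointwise
namespace HR
section
variable {n : ℕ}

lemma bind_step (hn : 0 < n) {U : Set (EE n)} (hUo : IsOpen U) {R : ℝ} (hR : ∀ x ∈ U, ‖x‖ ≤ R)
    (P : Kernel (EE n) (EE n)) (hP : ∀ x ∈ U, P x = (volume.restrict U).withDensity (pp U x))
    {F : EE n → ℝ≥0∞} (hF : Measurable F) :
    ((volume.restrict U).withDensity F).bind (fun x => P x) = (volume.restrict U).withDensity (PP U F) := by
  have hUm := hUo.measurableSet
  have hppm := pp_meas hUo
  ext T hT
  have hPm : Measurable (fun x => P x) := P.measurable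
  have hPT : Measurable (fun x => P x T) := P.measurable_coe hT
  have hPPm := PP_meas hUo hF
  set I : EE n → ℝ≥0∞ := T.indicator 1 with hI
  have hIm : Measurable I := measurable_one.indicator hT
  rw [Measure.bind_apply hT hPm.aemeasurable, lintegral_withDensity_eq_lintegral_mul _ hF hPT,
    withDensity_apply _ hT]
  have e1 : ∫⁻ x in U, (F * fun x => P x T) x = ∫⁻ x in U, ∫⁻ z in U, I z * (pp U x z * F x) := by
    refine setLIntegral_congr_fun hUm fun x hx => ?_
    have m1 : Measurable (pp U x) := hppm.of_uncurry_left (x := x)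
    have m2 : Measurable (fun z => I z * pp U x z) := hIm.mul m1
    simp only [Pi.mul_apply]
    rw [hP x hx, withDensity_apply _ hT, ← lintegral_indicator hT, ← lintegral_const_mul _ (m1.indicator hT)]
    refine lintegral_congr fun z => ?_
    by_cases hz : z ∈ T
    · rw [hI, Set.indicator_of_mem hz, Set.indicator_of_mem hz, Pi.one_apply, one_mul, mul_comm]
    · rw [hI, Set.indicator_of_notMem hz, Set.indicator_of_notMem hz, zero_mul, mul_zero]
  have m3 : Measurable (fun p : EE n × EE n => I p.2 * (pp U p.1 p.2 * F p.1)) :=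
    (hIm.comp measurable_snd).mul (hppm.mul (hF.comp measurable_fst))
  rw [e1, lintegral_lintegral_swap (f := fun x z => I z * (pp U x z * F x)) m3.aemeasurable, ← lintegral_indicator hT]
  refine setLIntegral_congr_fun hUm fun z hz => ?_
  have m4 : Measurable (fun x => pp U x z * F x) :=
    (hppm.of_uncurry_right (y := z)).mul hF
  change ∫⁻ x in U, I z * (pp U x z * F x) = T.indicator (PP U F) z
  rw [lintegral_const_mul _ m4]
  simp_rw [pp_symm hUo _ z]
  rw [pp_int hn hUo hR hz hF]
  by_cases hz : z ∈ T
  · rw [hI, Set.indicator_of_mem hz, Set.indicator_of_mem hz, Pi.one_apply, one_mul]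
  · rw [hI, Set.indicator_of_notMem hz, Set.indicator_of_notMem hz, zero_mul]

/-- Half of the L1 norm bounds the integral on any set, for mean zero. -/
lemma half_bound {μ : Measure (EE n)} [IsFiniteMeasure μ] {g : EE n → ℝ} (hg : Measurable g) {C : ℝ}
    (hC : ∀ x, |g x| ≤ C) (h0 : ∫ x, g x ∂μ = 0) {T : Set (EE n)} (hT : MeasurableSet T) :
    |∫ x in T, g x ∂μ| ≤ (1/2) * √((μ Set.univ).toReal * ∫ x, g x ^ 2 ∂μ) := by
  have hgi : Integrable g μ := Integrable.of_bound hg.aestronglyMeasurable C (Filter.Eventually.of_forall hC)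
  have h1 : ∫ x in T, g x ∂μ + ∫ x in Tᶜ, g x ∂μ = 0 := by rw [integral_add_compl hT hgi, h0]
  have h2 : ∫ x in T, |g x| ∂μ + ∫ x in Tᶜ, |g x| ∂μ = ∫ x, |g x| ∂μ := integral_add_compl hT hgi.abs
  have h3 : |∫ x in T, g x ∂μ| ≤ ∫ x in T, |g x| ∂μ := abs_integral_le_integral_abs
  have h4 : |∫ x in Tᶜ, g x ∂μ| ≤ ∫ x in Tᶜ, |g x| ∂μ := abs_integral_le_integral_abs
  have h5 : |∫ x in Tᶜ, g x ∂μ| = |∫ x in T, g x ∂μ| := by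
    rw [show ∫ x in Tᶜ, g x ∂μ = - ∫ x in T, g x ∂μ by linarith, abs_neg]
  have hg2 : Integrable (fun x => g x ^ 2) μ := Integrable.of_bound (hg.pow_const 2).aestronglyMeasurable (C ^ 2)
    (Filter.Eventually.of_forall fun x => by
      rw [Real.norm_eq_abs, abs_pow]; exact pow_le_pow_left₀ (abs_nonneg _) (hC x) 2)
  have h6 : ∫ x, |g x| ∂μ ≤ √((μ Set.univ).toReal * ∫ x, g x ^ 2 ∂μ) := by
    apply Real.le_sqrt_of_sq_le
    have hm : Measurable (fun x => ENNReal.ofReal |g x|) := by fun_prop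
    have h7 := sq_lintegral_le μ hm
    rw [← ofReal_integral_eq_lintegral_ofReal hgi.abs (Filter.Eventually.of_forall fun x => abs_nonneg _)] at h7
    have h8 : ∫⁻ x, ENNReal.ofReal |g x| ^ 2 ∂μ = ENNReal.ofReal (∫ x, g x ^ 2 ∂μ) := by
      rw [ofReal_integral_eq_lintegral_ofReal hg2 (Filter.Eventually.of_forall fun x => sq_nonneg _)]
      refine lintegral_congr fun x => ?_
      rw [← ENNReal.ofReal_pow (abs_nonneg _), sq_abs]
    rw [h8, ← ENNReal.ofReal_pow (integral_nonneg fun _ => abs_nonneg _),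
      ← ENNReal.ofReal_toReal (measure_ne_top μ Set.univ), ← ENNReal.ofReal_mul ENNReal.toReal_nonneg] at h7
    exact (ENNReal.ofReal_le_ofReal_iff (mul_nonneg ENNReal.toReal_nonneg (integral_nonneg fun _ => sq_nonneg _))).1 h7
  linarith

/-- numerical conclusion -/
lemma num_bound {γ M ε L : ℝ} {X : ℝ} (hX0 : 0 < X) (hX1 : X ≤ 1) (hγ : γ = (X / 10 ^ 4) ^ 2 / 36)
    (hε0 : 0 < ε) (hε1 : ε < 1) (hM : 1 ≤ M) (m : ℕ) (hL : L = Real.log (M / ε))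
    (hm : (10:ℝ) ^ 10 * (X ^ 2)⁻¹ * L < m) :
    (1/2) * √(M * (1 - γ) ^ m) < ε / 2 := by
  have hM0 : 0 < M := by linarith
  have hm0 : 0 ≤ (m:ℝ) := Nat.cast_nonneg _
  have h1 : (1 - γ) ^ m ≤ Real.exp (-(γ * m)) := by
    have := Real.add_one_le_exp (-γ)
    calc (1 - γ) ^ m ≤ (Real.exp (-γ)) ^ m := by
          apply pow_le_pow_left₀
          · rw [hγ]; nlinarith
          · linarith
      _ = _ := by rw [← Real.exp_nat_mul]; congr 1; ring
  have h2 : 2 * L < γ * m := by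
    have hX2 : 0 < X ^ 2 := by positivity
    have h3 : (10:ℝ) ^ 10 * L < m * X ^ 2 := by
      have := mul_lt_mul_of_pos_right hm hX2
      rwa [show (10:ℝ) ^ 10 * (X ^ 2)⁻¹ * L * X ^ 2 = 10 ^ 10 * L by field_simp] at this
    have hL0 : 0 < L := by rw [hL]; exact Real.log_pos (by rw [lt_div_iff₀ hε0]; linarith)
    rw [hγ]; nlinarith
  have h4 : Real.exp (-(γ * m)) < (ε / M) ^ 2 := by
    calc Real.exp (-(γ * m)) < Real.exp (-(2 * L)) := Real.exp_lt_exp.2 (by linarith)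
      _ = (Real.exp (-L)) ^ 2 := by rw [← Real.exp_nat_mul]; congr 1; push_cast; ring
      _ = _ := by rw [hL, Real.exp_neg, Real.exp_log (by positivity), inv_div]
  have h5 : M * (1 - γ) ^ m < ε ^ 2 := by
    calc M * (1 - γ) ^ m < M * (ε / M) ^ 2 := by gcongr; linarith
      _ = ε ^ 2 / M := by field_simp
      _ ≤ ε ^ 2 := div_le_self (by positivity) hM
  have h6 : √(M * (1 - γ) ^ m) < ε := by
    rw [← Real.sqrt_sq hε0.le]
    apply Real.sqrt_lt_sqrt _ h5
    have : 0 ≤ 1 - γ := by rw [hγ]; nlinarith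
    positivity
  linarith
end
end HR

end

section
open MeasureTheory ProbabilityTheory
open scoped ENNReal Pointwise
namespace HR
section
variable {n : ℕ}

lemma conv_T (hn : 0 < n) {U : Set (EE n)} (hUo : IsOpen U) (hUc : Convex ℝ U) {r R : ℝ} (hr : 0 < r) (hrR : r ≤ R)
    (hUr : Metric.ball 0 r ⊆ U) (hR : ∀ x ∈ U, ‖x‖ ≤ R) (hfin : volume U ≠ ⊤)
    {M : ℝ} (hM : 0 ≤ M) {f : EE n → ℝ} (hf : Measurable f) (hf0 : ∀ x, 0 ≤ f x)
    (hfM : ∀ x, f x ≤ M / (volume U).toReal) (hb1 : ∫ x in U, f x ≤ 1) (m : ℕ) {T : Set (EE n)} (hT : MeasurableSet T) :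
    |(∫ x in T ∩ U, (Pf U)^[m] f x) - (∫ x in U, f x) / (volume U).toReal * (volume (T ∩ U)).toReal| ≤
      (1/2) * √(M * (1 - (r / (n * R) / 10 ^ 4) ^ 2 / 36) ^ m) := by
  set u := (volume U).toReal with hu
  have hUm := hUo.measurableSet
  have hu0 : 0 < u := ENNReal.toReal_pos
    (ne_of_gt (lt_of_lt_of_le (Metric.measure_ball_pos volume 0 hr) (measure_mono hUr))) hfin
  haveI : IsFiniteMeasure (volume.restrict U : Measure (EE n)) := ⟨by simpa using hfin.lt_top⟩
  set γ := (r / (n * R) / 10 ^ 4) ^ 2 / 36 with hγ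
  set C := M / u with hC
  have hC0 : 0 ≤ C := by positivity
  have hγ1 : 0 ≤ 1 - γ := by
    have hN : (1:ℝ) ≤ n := by exact_mod_cast hn
    have h1 : r / (n * R) ≤ 1 := by rw [div_le_one (by nlinarith)]; nlinarith
    have h2 : 0 ≤ r / (n * R) := by have : 0 < R := by linarith
                                    positivity
    rw [hγ]; nlinarith
  set b := ∫ x in U, f x with hb
  have hb0 : 0 ≤ b := integral_nonneg hf0
  have all : ∀ k, Measurable ((Pf U)^[k] f) ∧ (∀ x, 0 ≤ (Pf U)^[k] f x) ∧ (∀ x, (Pf U)^[k] f x ≤ C) ∧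
      (∫ x in U, (Pf U)^[k] f x = b) ∧
      (∫ x in U, (Pf U)^[k] f x ^ 2) - b ^ 2 / u ≤ (1 - γ) ^ k * ((∫ x in U, f x ^ 2) - b ^ 2 / u) := by
    intro k
    induction k with
    | zero => exact ⟨hf, hf0, hfM, rfl, by simp⟩
    | succ k ih =>
      obtain ⟨i1, i2, i3, i4, i5⟩ := ih
      rw [Function.iterate_succ_apply']
      obtain ⟨s1, s2⟩ := step hn hUo hUc hr hrR hUr hR hfin i1 i2 i3
      rw [i4] at s1 s2
      refine ⟨Pf_meas hUo i1, Pf_nonneg, Pf_le hUo hC0 i3, s1, s2.trans ?_⟩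
      rw [pow_succ' (1 - γ), mul_assoc]
      exact mul_le_mul_of_nonneg_left i5 hγ1
  obtain ⟨i1, i2, i3, i4, i5⟩ := all m
  set g := (Pf U)^[m] f with hg
  have hfi : Integrable f (volume.restrict U) := Integrable.of_bound hf.aestronglyMeasurable C
    (Filter.Eventually.of_forall fun x => by rw [Real.norm_of_nonneg (hf0 x)]; exact hfM x)
  have hgi : Integrable g (volume.restrict U) := Integrable.of_bound i1.aestronglyMeasurable C
    (Filter.Eventually.of_forall fun x => by rw [Real.norm_of_nonneg (i2 x)]; exact i3 x)
  have hsqi : ∀ h : EE n → ℝ, Measurable h → (∀ x, 0 ≤ h x) → (∀ x, h x ≤ C) →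
      Integrable (fun x => h x ^ 2) (volume.restrict U) := fun h h1 h2 h3 =>
    Integrable.of_bound (h1.pow_const 2).aestronglyMeasurable (C ^ 2)
    (Filter.Eventually.of_forall fun x => by
      rw [Real.norm_of_nonneg (sq_nonneg _)]; exact pow_le_pow_left₀ (h2 x) (h3 x) 2)
  have hW0 : ∫ x in U, f x ^ 2 ≤ C := by
    calc ∫ x in U, f x ^ 2 ≤ ∫ x in U, C * f x := by
          refine integral_mono (hsqi f hf hf0 hfM) (hfi.const_mul C) fun x => ?_
          have h1 := hf0 x
          have h2 := hfM x
          change f x ^ 2 ≤ C * f x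
          nlinarith
      _ = C * b := by rw [integral_const_mul]
      _ ≤ C := mul_le_of_le_one_right hC0 hb1
  have hreal : (volume.restrict U : Measure (EE n)).real Set.univ = u := by
    rw [measureReal_def, Measure.restrict_apply_univ]
  have hmean : ∫ x in U, (g x - b / u) = 0 := by
    rw [integral_sub hgi (integrable_const _), i4, integral_const, hreal, smul_eq_mul]
    field_simp; ring
  have hvar : ∫ x in U, (g x - b / u) ^ 2 = (∫ x in U, g x ^ 2) - b ^ 2 / u := by
    have e : ∀ x, (g x - b / u) ^ 2 = g x ^ 2 - (2 * (b / u)) * g x + (b / u) ^ 2 := fun x => by ring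
    simp_rw [e]
    have hi3 : Integrable (fun x => g x ^ 2 - (2 * (b / u)) * g x) (volume.restrict U) := (hsqi g i1 i2 i3).sub (hgi.const_mul _)
    rw [integral_add hi3 (integrable_const _),
      integral_sub (hsqi g i1 i2 i3) (hgi.const_mul _), integral_const_mul, i4, integral_const, hreal, smul_eq_mul]
    field_simp; ring
  have hgm : Measurable (fun x => g x - b / u) := i1.sub_const _
  have hfinal := half_bound (μ := volume.restrict U) hgm (C := C + b / u) (fun x => by
    have h1 := i2 x
    have h2 := i3 x
    have h3 : 0 ≤ b / u := by positivity
    rw [abs_le]; constructor <;> linarith) hmean hT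
  rw [Measure.restrict_restrict hT, Measure.restrict_apply_univ, hvar] at hfinal
  have e1 : ∫ x in T ∩ U, (g x - b / u) = (∫ x in T ∩ U, g x) - b / u * (volume (T ∩ U)).toReal := by
    have hgi' : Integrable g (volume.restrict (T ∩ U)) :=
      hgi.mono_measure (Measure.restrict_mono Set.inter_subset_right le_rfl)
    haveI : IsFiniteMeasure (volume.restrict (T ∩ U) : Measure (EE n)) :=
      ⟨by simpa using (measure_mono Set.inter_subset_right).trans_lt hfin.lt_top⟩
    rw [integral_sub hgi' (integrable_const _), integral_const, smul_eq_mul, measureReal_def,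
      Measure.restrict_apply_univ, mul_comm]
  rw [e1] at hfinal
  refine hfinal.trans (mul_le_mul_of_nonneg_left (Real.sqrt_le_sqrt ?_) (by norm_num))
  calc u * ((∫ x in U, g x ^ 2) - b ^ 2 / u) ≤ u * ((1 - γ) ^ m * C) := by
        refine mul_le_mul_of_nonneg_left (i5.trans (mul_le_mul_of_nonneg_left ?_ (pow_nonneg hγ1 m))) hu0.le
        have : 0 ≤ b ^ 2 / u := by positivity
        linarith
    _ = M * (1 - γ) ^ m := by rw [hC]; field_simp

/-- evolution of a measure with bounded density -/
lemma evo (hn : 0 < n) {U : Set (EE n)} (hUo : IsOpen U) {R : ℝ} (hR : ∀ x ∈ U, ‖x‖ ≤ R)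
    (P : Kernel (EE n) (EE n)) (hP : ∀ x ∈ U, P x = (volume.restrict U).withDensity (pp U x))
    {C : ℝ} (hC : 0 ≤ C) {f : EE n → ℝ} (hf : Measurable f) (hfM : ∀ x, f x ≤ C)
    (μ : ℕ → Measure (EE n)) (hμ0 : μ 0 = (volume.restrict U).withDensity (fun x => ENNReal.ofReal (f x)))
    (hμs : ∀ k, μ (k + 1) = (μ k).bind (fun x => P x)) (m : ℕ) :
    Measurable ((Pf U)^[m] f) ∧ (∀ x, (Pf U)^[m] f x ≤ C) ∧
    μ m = (volume.restrict U).withDensity (fun x => ENNReal.ofReal ((Pf U)^[m] f x)) := by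
  induction m with
  | zero => exact ⟨hf, hfM, hμ0⟩
  | succ k ih =>
    obtain ⟨i1, i2, i3⟩ := ih
    rw [Function.iterate_succ_apply']
    refine ⟨Pf_meas hUo i1, Pf_le hUo hC i2, ?_⟩
    rw [hμs, i3, bind_step hn hUo hR P hP i1.ennreal_ofReal]
    congr 1
    funext x
    rw [Pf_ofReal hUo i2 x]

lemma dens {ν ρ : Measure (EE n)} [IsFiniteMeasure ν] [IsFiniteMeasure ρ] {C : ℝ} (hC : 0 ≤ C)
    (h : ∀ A, MeasurableSet A → ρ A ≤ ENNReal.ofReal C * ν A) :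
    ∃ f : EE n → ℝ, Measurable f ∧ (∀ x, 0 ≤ f x) ∧ (∀ x, f x ≤ C) ∧ ρ = ν.withDensity (fun x => ENNReal.ofReal (f x)) := by
  have hac : ρ ≪ ν := Measure.AbsolutelyContinuous.mk fun A hA h0 => by
    have := h A hA
    rw [h0, mul_zero] at this
    exact le_antisymm this zero_le
  set d := ρ.rnDeriv ν with hd
  have hdm : Measurable d := Measure.measurable_rnDeriv _ _
  haveI : ρ.HaveLebesgueDecomposition ν := Measure.haveLebesgueDecomposition_of_sigmaFinite ρ ν
  have hw : ν.withDensity d = ρ := Measure.withDensity_rnDeriv_eq _ _ hac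
  have hle : d ≤ᵐ[ν] fun _ => ENNReal.ofReal C := by
    refine ae_le_of_forall_setLIntegral_le_of_sigmaFinite hdm fun A hA _ => ?_
    rw [← withDensity_apply _ hA, hw, setLIntegral_const]
    exact h A hA
  refine ⟨fun x => min (d x).toReal C, hdm.ennreal_toReal.min measurable_const, fun x => le_min ENNReal.toReal_nonneg hC,
    fun x => min_le_right _ _, ?_⟩
  rw [← hw]
  refine withDensity_congr_ae (hle.mono fun x hx => ?_)
  have h1 : d x ≠ ⊤ := ne_top_of_le_ne_top ENNReal.ofReal_ne_top hx
  change d x = ENNReal.ofReal (min (d x).toReal C)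
  rw [min_eq_left (ENNReal.toReal_le_of_le_ofReal hC hx), ENNReal.ofReal_toReal h1]

end
end HR

end

open MeasureTheory ProbabilityTheory

/-- (Lovász–Vempala, mixing of hit-and-run.) Let `K ⊂ ℝⁿ` (`n ≥ 2`) be a
convex body with `B(0,r) ⊆ K ⊆ B(0,R)` (`0 < r ≤ R`), let `P` be the hit-and-run kernel on
`K` with stationary uniform distribution `π_K`, let `0 < ε < 1`, `M ≥ 1`, and let `σ` be a
probability measure on `K` such that for some measurable `S ⊆ K` with `σ(S) ≤ ε/2`, the
restriction of `σ` to `K∖S` has density at most `M` with respect to `π_K`. Then for every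
`m > 10^10 (n² R²/r²) ln(M/ε)`, the total variation distance between `σ^{(m)}` and `π_K` is
less than `ε`. -/
theorem hit_and_run_mixing
    (n : ℕ) (hn : 2 ≤ n) (K : Set (EuclideanSpace ℝ (Fin n)))
    (hK_compact : IsCompact K) (hK_convex : Convex ℝ K)
    (hK_interior : (interior K).Nonempty)
    (r R : ℝ) (hr : 0 < r) (hrR : r ≤ R)
    (hK_lower : Metric.closedBall 0 r ⊆ K) (hK_upper : K ⊆ Metric.closedBall 0 R)
    (chord : EuclideanSpace ℝ (Fin n) → EuclideanSpace ℝ (Fin n) → ℝ)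
    (hchord : ∀ u x, chord u x
      = ‖x - u‖ * (volume {t : ℝ | u + t • (x - u) ∈ K}).toReal)
    (vn : ℝ) (hvn : vn = Real.pi ^ ((n : ℝ) / 2) / Real.Gamma (1 + (n : ℝ) / 2))
    (P : Kernel (EuclideanSpace ℝ (Fin n)) (EuclideanSpace ℝ (Fin n))) [IsMarkovKernel P]
    (hP : ∀ u ∈ K, ∀ A : Set (EuclideanSpace ℝ (Fin n)), MeasurableSet A → A ⊆ K →
      P u A = ∫⁻ x in A,
        ENNReal.ofReal ((2 / (n * vn)) * (chord u x * ‖x - u‖ ^ (n - 1))⁻¹) ∂volume)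
    (πK : Measure (EuclideanSpace ℝ (Fin n)))
    (hπK : πK = (volume K)⁻¹ • volume.restrict K)
    (ε M : ℝ) (hε0 : 0 < ε) (hε1 : ε < 1) (hM : 1 ≤ M)
    (σ : Measure (EuclideanSpace ℝ (Fin n))) [IsProbabilityMeasure σ]
    (hσK : σ Kᶜ = 0)
    (S : Set (EuclideanSpace ℝ (Fin n))) (hS_meas : MeasurableSet S) (hSK : S ⊆ K)
    (hσS : σ S ≤ ENNReal.ofReal (ε / 2))
    (hdensity : ∀ A : Set (EuclideanSpace ℝ (Fin n)), MeasurableSet A →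
      σ (A ∩ (K \ S)) ≤ ENNReal.ofReal M * πK A)
    (σseq : ℕ → Measure (EuclideanSpace ℝ (Fin n)))
    (hσ0 : σseq 0 = σ)
    (hσsucc : ∀ k, σseq (k + 1) = (σseq k).bind (fun x => P x)) :
    ∀ m : ℕ, (10 : ℝ) ^ 10 * ((n : ℝ) ^ 2 * R ^ 2 / r ^ 2) * Real.log (M / ε) < m →
      ∀ T : Set (EuclideanSpace ℝ (Fin n)), MeasurableSet T →
        |(σseq m T).toReal - (πK T).toReal| < ε := by
  classical
  intro m hm T hT
  have hn0 : 0 < n := by omega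
  have hNp : (0:ℝ) < n := by exact_mod_cast hn0
  have hN1 : (1:ℝ) ≤ n := by exact_mod_cast hn0
  have hRp : 0 < R := by linarith
  set U := interior K with hU
  have hUo : IsOpen U := isOpen_interior
  have hUm := hUo.measurableSet
  have hUK : U ⊆ K := interior_subset
  have hUc : Convex ℝ U := hK_convex.interior
  have hKm : MeasurableSet K := hK_compact.measurableSet
  have hUr : Metric.ball 0 r ⊆ U := interior_maximal (Metric.ball_subset_closedBall.trans hK_lower) Metric.isOpen_ball
  have hR : ∀ x ∈ U, ‖x‖ ≤ R := fun y hy => by simpa using hK_upper (hUK hy)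
  have hrestr := HR.vol_K hK_convex
  have hvolK : volume K = volume U := by
    have := congrArg (fun μ : Measure (EuclideanSpace ℝ (Fin n)) => μ Set.univ) hrestr
    simpa using this
  have hfin : volume U ≠ ⊤ := by rw [← hvolK]; exact hK_compact.measure_ne_top
  have hupos : volume U ≠ 0 :=
    ne_of_gt (lt_of_lt_of_le (Metric.measure_ball_pos volume 0 hr) (measure_mono hUr))
  set u := (volume U).toReal with hu
  have hu0 : 0 < u := ENNReal.toReal_pos hupos hfin
  haveI : IsFiniteMeasure (volume.restrict U : Measure (EuclideanSpace ℝ (Fin n))) := ⟨by simpa using hfin.lt_top⟩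
  have hPeq : ∀ x ∈ U, P x = (volume.restrict U).withDensity (HR.pp U x) := fun x hx =>
    HR.P_eq hn0 hK_compact hK_convex hK_upper chord hchord vn hvn P hP hx
  have hPm : Measurable (fun x => P x) := P.measurable
  have hπ : ∀ A, MeasurableSet A → (πK A).toReal = (volume (A ∩ U)).toReal / u := by
    intro A hA
    rw [hπK, hrestr, hvolK, Measure.smul_apply, Measure.restrict_apply hA, smul_eq_mul, ENNReal.toReal_mul,
      ENNReal.toReal_inv, div_eq_inv_mul]
  -- splitting of the initial measure
  set D := K \ S with hD
  have hDm : MeasurableSet D := hKm.diff hS_meas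
  have hM0 : 0 ≤ M := by linarith
  have hC0 : 0 ≤ M / u := by positivity
  obtain ⟨f, hfm, hf0, hfC, hfρ⟩ := HR.dens (ν := volume.restrict U) (ρ := σ.restrict D) hC0 (by
    intro A hA
    rw [Measure.restrict_apply hA]
    refine (hdensity A hA).trans (le_of_eq ?_)
    rw [hπK, hrestr, hvolK, Measure.smul_apply, smul_eq_mul, ← mul_assoc]
    congr 1
    rw [div_eq_mul_inv, ENNReal.ofReal_mul hM0, ENNReal.ofReal_inv_of_pos hu0, hu, ENNReal.ofReal_toReal hfin])
  obtain ⟨ρ, hρ0, hρs⟩ : ∃ ρ : ℕ → Measure (EuclideanSpace ℝ (Fin n)), ρ 0 = σ.restrict D ∧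
      ∀ k, ρ (k + 1) = (ρ k).bind (fun x => P x) :=
    ⟨fun k => Nat.rec (σ.restrict D) (fun _ μ => μ.bind (fun x => P x)) k, rfl, fun k => rfl⟩
  obtain ⟨μ, hμ0, hμs⟩ : ∃ μ : ℕ → Measure (EuclideanSpace ℝ (Fin n)), μ 0 = σ.restrict Dᶜ ∧
      ∀ k, μ (k + 1) = (μ k).bind (fun x => P x) :=
    ⟨fun k => Nat.rec (σ.restrict Dᶜ) (fun _ μ => μ.bind (fun x => P x)) k, rfl, fun k => rfl⟩
  have hsplit : ∀ k, σseq k = ρ k + μ k := by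
    intro k
    induction k with
    | zero => rw [hσ0, hρ0, hμ0, Measure.restrict_add_restrict_compl hDm]
    | succ k ih =>
      rw [hσsucc, hρs, hμs, ih]
      ext A hA
      rw [Measure.add_apply, Measure.bind_apply hA hPm.aemeasurable, Measure.bind_apply hA hPm.aemeasurable,
        Measure.bind_apply hA hPm.aemeasurable, lintegral_add_measure]
  have hmass : ∀ k, μ k Set.univ = σ Dᶜ := by
    intro k
    induction k with
    | zero => rw [hμ0, Measure.restrict_apply_univ]
    | succ k ih =>
      rw [hμs, Measure.bind_apply MeasurableSet.univ hPm.aemeasurable]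
      simp [ih]
  have hDc : σ Dᶜ ≤ ENNReal.ofReal (ε / 2) := by
    calc σ Dᶜ ≤ σ (Kᶜ ∪ S) := measure_mono (by
          intro z hz
          by_cases hzK : z ∈ K
          · right; by_contra hzS; exact hz ⟨hzK, hzS⟩
          · left; exact hzK)
      _ ≤ σ Kᶜ + σ S := measure_union_le _ _
      _ ≤ _ := by rw [hσK, zero_add]; exact hσS
  set s := (σ Dᶜ).toReal with hs
  have hs0 : 0 ≤ s := ENNReal.toReal_nonneg
  have hse : s ≤ ε / 2 := ENNReal.toReal_le_of_le_ofReal (by positivity) hDc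
  have hsD : (σ D).toReal = 1 - s := by
    have h1 := prob_add_prob_compl (μ := σ) hDm
    have h2 := congrArg ENNReal.toReal h1
    rw [ENNReal.toReal_add (measure_ne_top _ _) (measure_ne_top _ _), ENNReal.toReal_one] at h2
    linarith
  have hWT : ∀ (g : EuclideanSpace ℝ (Fin n) → ℝ), Measurable g → (∀ x, 0 ≤ g x) → ∀ A, MeasurableSet A →
      ((volume.restrict U).withDensity (fun x => ENNReal.ofReal (g x)) A).toReal = ∫ x in A ∩ U, g x := by
    intro g hg hg0 A hA
    rw [withDensity_apply _ hA, Measure.restrict_restrict hA,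
      integral_eq_lintegral_of_nonneg_ae (Filter.Eventually.of_forall hg0) hg.aestronglyMeasurable]
  have hb : ∫ x in U, f x = 1 - s := by
    have h1 := hWT f hfm hf0 Set.univ MeasurableSet.univ
    rw [← hfρ, Measure.restrict_apply_univ, Set.univ_inter, hsD] at h1
    exact h1.symm
  obtain ⟨g1, g2, g3⟩ := HR.evo hn0 hUo hR P hPeq hC0 hfm hfC ρ (hρ0.trans hfρ) hρs m
  have g0 : ∀ x, 0 ≤ (HR.Pf U)^[m] f x := by
    cases m with
    | zero => exact hf0
    | succ k => rw [Function.iterate_succ_apply']; exact HR.Pf_nonneg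
  have hconv := HR.conv_T hn0 hUo hUc hr hrR hUr hR hfin hM0 hfm hf0 hfC (by rw [hb]; linarith) m hT
  have hX1 : r / (n * R) ≤ 1 := by rw [div_le_one (by positivity)]; nlinarith
  have hnum := HR.num_bound (X := r / (n * R)) (by positivity) hX1 rfl hε0 hε1 hM m rfl (by
    refine lt_of_eq_of_lt ?_ hm
    congr 2
    field_simp)
  rw [hb, ← hWT _ g1 g0 T hT, ← g3] at hconv
  have hle := hconv.trans_lt hnum
  have hσT : (σseq m T).toReal = (ρ m T).toReal + (μ m T).toReal := by
    have hfin1 : ρ m T ≠ ⊤ := by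
      rw [g3, withDensity_apply _ hT]
      refine ne_top_of_le_ne_top ?_ (lintegral_mono fun x => ENNReal.ofReal_le_ofReal (g2 x))
      rw [lintegral_const]
      refine ENNReal.mul_ne_top ENNReal.ofReal_ne_top (ne_top_of_le_ne_top hfin ?_)
      rw [Measure.restrict_apply_univ, Measure.restrict_apply hT] <;> exact measure_mono Set.inter_subset_right
    have hfin2 : μ m T ≠ ⊤ :=
      ne_top_of_le_ne_top (measure_ne_top σ Dᶜ) ((measure_mono (Set.subset_univ _)).trans (hmass m).le)
    rw [hsplit, Measure.add_apply, ENNReal.toReal_add hfin1 hfin2]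
  have hμT : (μ m T).toReal ≤ s :=
    ENNReal.toReal_mono (measure_ne_top σ Dᶜ) ((measure_mono (Set.subset_univ _)).trans (hmass m).le)
  have hμT0 : 0 ≤ (μ m T).toReal := ENNReal.toReal_nonneg
  rw [hσT, hπ T hT]
  set p := (volume (T ∩ U)).toReal with hp
  have hp0 : 0 ≤ p / u := by positivity
  have hp1 : p / u ≤ 1 := by
    rw [div_le_one hu0]
    exact ENNReal.toReal_mono hfin (measure_mono Set.inter_subset_right)
  have hpp : (1 - s) / u * p = p / u - s * (p / u) := by ring
  rw [hpp, abs_lt] at hle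
  have h1 : s * (p / u) ≤ s := mul_le_of_le_one_right hs0 hp1
  have h2 : 0 ≤ s * (p / u) := by positivity
  rw [abs_lt]
  constructor <;> linarith [hle.1, hle.2]
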